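/- arXiv:math/0703280 — 10 statements merged into one kernel-verified Lean document; each statement's English description precedes it below -/
import Mathlib

section
/- Let N ≥ 2 be an integer, ω > 0, A_N : ℝ → ℝ continuous, A_j : ℝ → ℂ continuous for 1 ≤ j ≤ N−1, and α ∈ ℝ. Assume the ray of argument α is invariant: for every t ∈ [0,ω] and every r ≥ 0 there is s ∈ ℝ with A_N(t)·(r·e^{iα})^N + Σ_{j=1}^{N−1} A_j(t)·(r·e^{iα})^j = s·e^{iα}. Assume there is γ ∈ ℝ with γ·cos((N−1)·α) > 0 such that either (γ > 0 and A_N(t) > γ for all t ∈ [0,ω]) or (γ < 0 and A_N(t) < γ for all t ∈ [0,ω]). Then the set { r ∈ ℝ | r > 0 and there exists a solution z of ż = A_N(t)z^N + Σ_{j=1}^{N−1} A_j(t)z^j on [0,ω] with z(0) = r·e^{iα} and z(ω) = z(0) } is finite; in particular, z = 0 is not a center for this equation. -/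
/-- `z` is a solution of `ż = F(t,z)` on `[0, ω]`. -/
def IsSolution (ω : ℝ) (F : ℝ → ℂ → ℂ) (z : ℝ → ℂ) : Prop :=
  ∀ t ∈ Set.Icc (0 : ℝ) ω, HasDerivAt z (F t (z t)) t

/-- `z = 0` is a center for `ż = F(t,z)` with period `ω`. -/
def IsCenter (ω : ℝ) (F : ℝ → ℂ → ℂ) : Prop :=
  ∃ ε > (0 : ℝ), ∀ c : ℂ, ‖c‖ < ε →
    ∃ z : ℝ → ℂ, IsSolution ω F z ∧ z 0 = c ∧ z ω = c

open Set Filter Topology MeasureTheory in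
theorem lin_aux (ω : ℝ) (g D : ℝ → ℂ) (hg : ContinuousOn g (Icc 0 ω))
    (hD : ∀ t ∈ Icc 0 ω, HasDerivWithinAt D (g t * D t) (Icc 0 ω) t) :
    ∀ t ∈ Icc 0 ω, D t = D 0 * Complex.exp (∫ s in (0:ℝ)..t, g s) := by
  intro t ht
  have h0ω : (0:ℝ) ≤ ω := ht.1.trans ht.2
  set g' : ℝ → ℂ := IccExtend h0ω ((Icc 0 ω).domRestrict g) with hg'
  have hc : Continuous g' := by
    rw [continuousOn_iff_continuous_domRestrict] at hg
    exact hg.Icc_extend'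
  have he : ∀ s ∈ Icc 0 ω, g' s = g s := fun s hs => by
    rw [hg', IccExtend_of_mem _ _ hs]; rfl
  have hI : ∀ s, HasDerivAt (fun u => ∫ x in (0:ℝ)..u, g' x) (g' s) s := fun s =>
    intervalIntegral.integral_hasDerivAt_right (hc.intervalIntegrable _ _)
      (hc.stronglyMeasurableAtFilter _ _) hc.continuousAt
  have hE : ∀ s ∈ Icc 0 ω, HasDerivWithinAt
      (fun u => D u * Complex.exp (-∫ x in (0:ℝ)..u, g' x)) 0 (Icc 0 ω) s := by
    intro s hs
    have := (hD s hs).mul ((hI s).neg.cexp.hasDerivWithinAt (s := Icc 0 ω))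
    have hz : g s * D s * Complex.exp ((-fun u => ∫ (x : ℝ) in 0..u, g' x) s) +
      D s * (Complex.exp ((-fun u => ∫ (x : ℝ) in 0..u, g' x) s) * -g' s) = 0 := by
      rw [he s hs]; ring
    rw [hz] at this
    exact this
  have := constant_of_has_deriv_right_zero (f := fun u => D u * Complex.exp (-∫ x in (0:ℝ)..u, g' x))
    (a := 0) (b := ω) (fun s hs => (hE s hs).continuousWithinAt)
    (fun s hs => (hE s (Ico_subset_Icc_self hs)).mono_of_mem_nhdsWithin (Icc_mem_nhdsGE_of_mem hs)) t ht
  simp only [intervalIntegral.integral_same, neg_zero, Complex.exp_zero, mul_one] at this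
  have hint : ∫ s in (0:ℝ)..t, g s = ∫ s in (0:ℝ)..t, g' s := by
    apply intervalIntegral.integral_congr
    intro s hs
    rw [uIcc_of_le ht.1] at hs
    exact (he s ⟨hs.1, hs.2.trans ht.2⟩).symm
  rw [hint, ← this, mul_assoc, ← Complex.exp_add]
  simp

open Set Filter Topology MeasureTheory in
theorem clamp_aux (R : ℝ) (hR : 0 ≤ R) : ∃ ρ : ℂ → ℂ, (∀ x y, ‖ρ x - ρ y‖ ≤ ‖x - y‖) ∧
    (∀ x, ‖ρ x‖ ≤ 2 * R) ∧ (∀ x, ‖x‖ ≤ R → ρ x = x) := by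
  have hRR : -R ≤ R := by linarith
  have key : ∀ u v : ℝ, |(projIcc (-R) R hRR u : ℝ) - projIcc (-R) R hRR v| ≤ |u - v| := fun u v => by
    have := (LipschitzWith.projIcc hRR).dist_le_mul u v
    simpa [Subtype.dist_eq, Real.dist_eq] using this
  refine ⟨fun z => ⟨projIcc (-R) R hRR z.re, projIcc (-R) R hRR z.im⟩, ?_, ?_, ?_⟩
  · intro x y
    rw [Complex.norm_eq_sqrt_sq_add_sq, Complex.norm_eq_sqrt_sq_add_sq]
    apply Real.sqrt_le_sqrt
    simp only [Complex.sub_re, Complex.sub_im]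
    exact add_le_add (sq_le_sq.2 (key _ _)) (sq_le_sq.2 (key _ _))
  · intro x
    refine (Complex.norm_le_abs_re_add_abs_im _).trans ?_
    have h1 := (projIcc (-R) R hRR x.re).2
    have h2 := (projIcc (-R) R hRR x.im).2
    have h1' := abs_le.2 h1
    have h2' := abs_le.2 h2
    simp only
    linarith
  · intro x hx
    apply Complex.ext
    · simp only
      rw [projIcc_of_mem hRR (abs_le.1 ((Complex.abs_re_le_norm x).trans hx))]
    · simp only
      rw [projIcc_of_mem hRR (abs_le.1 ((Complex.abs_im_le_norm x).trans hx))]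

open Set Filter Topology MeasureTheory in
theorem flow_aux (ω : ℝ) (hω : 0 < ω) (H : ℝ → ℂ → ℂ) (G : ℝ → ℂ → ℂ → ℂ)
    (hG : Continuous fun p : ℝ × ℂ × ℂ => G p.1 p.2.1 p.2.2)
    (hHc : Continuous fun p : ℝ × ℂ => H p.1 p.2)
    (hH : ∀ t x y, H t x - H t y = G t x y * (x - y)) (R : ℝ) (hR : 0 ≤ R) :
    ∃ (Φ : ℂ → ℝ → ℂ) (L : ℝ), 0 ≤ L ∧ (∀ c, Φ c 0 = c) ∧ (∀ c, ContinuousOn (Φ c) (Icc 0 ω)) ∧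
      (∀ c c', ∀ t ∈ Icc 0 ω, ‖Φ c t - Φ c' t‖ ≤ L * ‖c - c'‖) ∧
      (∀ c, (∀ t ∈ Icc 0 ω, ‖Φ c t‖ ≤ R) →
        ∀ t ∈ Icc 0 ω, HasDerivWithinAt (Φ c) (H t (Φ c t)) (Icc 0 ω) t) ∧
      (∀ w : ℝ → ℂ, (∀ t ∈ Icc 0 ω, HasDerivWithinAt w (H t (w t)) (Icc 0 ω) t) →
        (∀ t ∈ Icc 0 ω, ‖w t‖ ≤ R) → ∀ t ∈ Icc 0 ω, w t = Φ (w 0) t) := by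
  obtain ⟨ρ, hρ1, hρ2, hρ3⟩ := clamp_aux R hR
  have hρc : Continuous ρ := (LipschitzWith.of_dist_le_mul (K := 1) (fun x y => by
    simpa [dist_eq_norm] using hρ1 x y)).continuous
  obtain ⟨C, hC⟩ := ((isCompact_Icc (a := (0:ℝ)) (b := ω)).prod
    ((isCompact_closedBall (0:ℂ) (2*R)).prod (isCompact_closedBall (0:ℂ) (2*R)))).exists_bound_of_continuousOn
      hG.continuousOn
  obtain ⟨B, hB⟩ := ((isCompact_Icc (a := (0:ℝ)) (b := ω)).prod
    (isCompact_closedBall (0:ℂ) (2*R))).exists_bound_of_continuousOn hHc.continuousOn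
  set v : ℝ → ℂ → ℂ := fun t x => H t (ρ x) with hv
  have hmem : ∀ x, ρ x ∈ Metric.closedBall (0:ℂ) (2*R) := fun x => by simpa using hρ2 x
  have hlip : ∀ t ∈ Icc 0 ω, LipschitzWith C.toNNReal (v t) := by
    intro t ht
    apply LipschitzWith.of_dist_le_mul
    intro x y
    have hc := hC (t, ρ x, ρ y) ⟨ht, hmem x, hmem y⟩
    rw [dist_eq_norm, dist_eq_norm, hv]
    simp only
    rw [hH, norm_mul]
    exact mul_le_mul (hc.trans (Real.le_coe_toNNReal C)) (hρ1 x y) (norm_nonneg _) (by positivity)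
  have hex : ∀ c : ℂ, ∃ φ : ℝ → ℂ, φ 0 = c ∧
      ∀ t ∈ Icc 0 ω, HasDerivWithinAt φ (v t (φ t)) (Icc 0 ω) t := by
    intro c
    have hpl : IsPicardLindelof v (⟨0, left_mem_Icc.2 hω.le⟩ : Icc (0:ℝ) ω) c
        (B.toNNReal * ω.toNNReal) 0 B.toNNReal C.toNNReal := by
      refine ⟨fun t ht => (hlip t ht).lipschitzOnWith, fun x _ => ?_, fun t ht x _ => ?_, ?_⟩
      · exact (hHc.comp (by fun_prop : Continuous fun t : ℝ => (t, ρ x))).continuousOn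
      · exact (hB (t, ρ x) ⟨ht, hmem x⟩).trans (Real.le_coe_toNNReal B)
      · simp [hω.le]
    exact hpl.exists_eq_forall_mem_Icc_hasDerivWithinAt₀
  choose Φ hΦ0 hΦ using hex
  have hΦc : ∀ c, ContinuousOn (Φ c) (Icc 0 ω) := fun c s hs => (hΦ c s hs).continuousWithinAt
  have tr : ∀ φ φ' : ℝ → ℂ, ∀ s ∈ Ico 0 ω, HasDerivWithinAt φ (v s (φ s)) (Icc 0 ω) s →
      HasDerivWithinAt φ (v s (φ s)) (Ici s) s := fun φ _ s hs h =>
    h.mono_of_mem_nhdsWithin (Icc_mem_nhdsGE_of_mem hs)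
  have gron : ∀ φ φ' : ℝ → ℂ, (∀ t ∈ Icc 0 ω, HasDerivWithinAt φ (v t (φ t)) (Icc 0 ω) t) →
      (∀ t ∈ Icc 0 ω, HasDerivWithinAt φ' (v t (φ' t)) (Icc 0 ω) t) →
      ∀ t ∈ Icc 0 ω, dist (φ t) (φ' t) ≤ dist (φ 0) (φ' 0) * Real.exp (C.toNNReal * (t - 0)) := by
    intro φ φ' h h'
    exact dist_le_of_trajectories_ODE_of_mem (s := fun _ => univ)
      (fun t ht => (hlip t (Ico_subset_Icc_self ht)).lipschitzOnWith)
      (fun s hs => (h s hs).continuousWithinAt)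
      (fun s hs => tr φ φ s hs (h s (Ico_subset_Icc_self hs))) (fun _ _ => mem_univ _)
      (fun s hs => (h' s hs).continuousWithinAt)
      (fun s hs => tr φ' φ s hs (h' s (Ico_subset_Icc_self hs))) (fun _ _ => mem_univ _) le_rfl
  refine ⟨Φ, Real.exp (C.toNNReal * ω), (Real.exp_pos _).le, hΦ0, hΦc, ?_, ?_, ?_⟩
  · intro c c' t ht
    have := gron _ _ (hΦ c) (hΦ c') t ht
    rw [hΦ0, hΦ0, dist_eq_norm, dist_eq_norm, mul_comm] at this
    refine this.trans (mul_le_mul_of_nonneg_right ?_ (norm_nonneg _))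
    apply Real.exp_le_exp.2
    apply mul_le_mul_of_nonneg_left _ (by positivity)
    linarith [ht.2]
  · intro c hc t ht
    have := hΦ c t ht
    simp only [hv, hρ3 _ (hc t ht)] at this
    exact this
  · intro w hw hwR t ht
    have := gron w (Φ (w 0)) (fun s hs => by
      simp only [hv, hρ3 _ (hwR s hs)]; exact hw s hs) (hΦ _) t ht
    rw [hΦ0, dist_self, zero_mul] at this
    exact dist_le_zero.1 this

open Set Filter Topology MeasureTheory in
theorem finite_aux (ω : ℝ) (hω : 0 < ω) (H : ℝ → ℂ → ℂ) (G : ℝ → ℂ → ℂ → ℂ)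
    (hG : Continuous fun p : ℝ × ℂ × ℂ => G p.1 p.2.1 p.2.2)
    (hHc : Continuous fun p : ℝ × ℂ => H p.1 p.2)
    (hH : ∀ t x y, H t x - H t y = G t x y * (x - y)) (K : ℝ) (hK : 0 ≤ K)
    (hbd : ∀ r : ℝ, 0 ≤ r → ∀ w : ℝ → ℂ,
      (∀ t ∈ Icc 0 ω, HasDerivWithinAt w (H t (w t)) (Icc 0 ω) t) →
      w 0 = r → w ω = r → ∀ t ∈ Icc 0 ω, ‖w t‖ ≤ K) :
    {r : ℝ | 0 ≤ r ∧ ∃ w : ℝ → ℂ, (∀ t ∈ Icc 0 ω, HasDerivWithinAt w (H t (w t)) (Icc 0 ω) t) ∧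
      w 0 = r ∧ w ω = r}.Finite := by
  obtain ⟨Φ, L, hL, hΦ0, hΦc, hΦL, hΦs, hΦu⟩ := flow_aux ω hω H G hG hHc hH (K + 1) (by linarith)
  have h0m : (0:ℝ) ∈ Icc 0 ω := left_mem_Icc.2 hω.le
  have hωm : ω ∈ Icc 0 ω := right_mem_Icc.2 hω.le
  set Per := {r : ℝ | 0 ≤ r ∧ ∃ w : ℝ → ℂ,
    (∀ t ∈ Icc 0 ω, HasDerivWithinAt w (H t (w t)) (Icc 0 ω) t) ∧ w 0 = r ∧ w ω = r} with hPer
  have hchar : ∀ r : ℝ, r ∈ Per ↔ 0 ≤ r ∧ (∀ t ∈ Icc 0 ω, ‖Φ r t‖ ≤ K) ∧ Φ r ω = r := by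
    intro r
    constructor
    · rintro ⟨hr, w, hw, hw0, hw1⟩
      have hb := hbd r hr w hw hw0 hw1
      have hu := hΦu w hw (fun t ht => (hb t ht).trans (by linarith))
      rw [hw0] at hu
      exact ⟨hr, fun t ht => by rw [← hu t ht]; exact hb t ht, by rw [← hu ω hωm]; exact hw1⟩
    · rintro ⟨hr, hb, h1⟩
      exact ⟨hr, Φ r, hΦs _ (fun t ht => (hb t ht).trans (by linarith)), hΦ0 _, h1⟩
  have hcont : ∀ t ∈ Icc 0 ω, Continuous (fun c => Φ c t) := by
    intro t ht
    refine (LipschitzWith.of_dist_le_mul (K := L.toNNReal) (fun x y => ?_)).continuous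
    rw [dist_eq_norm, dist_eq_norm, Real.coe_toNNReal _ hL]
    exact hΦL x y t ht
  have hclosed : IsClosed Per := by
    have : Per = {r : ℝ | 0 ≤ r} ∩ (⋂ t ∈ Icc 0 ω, {r : ℝ | ‖Φ r t‖ ≤ K}) ∩
        {r : ℝ | Φ r ω = r} := by
      ext r
      rw [hchar]
      simp only [mem_inter_iff, mem_iInter, mem_ofPred_eq, and_assoc]
    rw [this]
    refine ((isClosed_le continuous_const continuous_id).inter ?_).inter ?_
    · refine isClosed_biInter fun t ht => ?_
      exact isClosed_le ((hcont t ht).comp Complex.continuous_ofReal).norm continuous_const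
    · exact isClosed_eq ((hcont ω hωm).comp Complex.continuous_ofReal) Complex.continuous_ofReal
  have hsub : Per ⊆ Icc 0 K := by
    intro r hr
    obtain ⟨h0, hb, -⟩ := (hchar r).1 hr
    have := hb 0 h0m
    rw [hΦ0, Complex.norm_real, Real.norm_eq_abs, abs_of_nonneg h0] at this
    exact ⟨h0, this⟩
  -- differentiability of the return map
  have han : ∀ m ∈ Per, ∃ ε > 0, (∀ c ∈ Metric.ball (m:ℂ) ε, ∀ t ∈ Icc 0 ω, ‖Φ c t‖ ≤ K + 1) ∧
      AnalyticAt ℂ (fun c => Φ c ω) m := by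
    intro m hm
    obtain ⟨h0, hb, -⟩ := (hchar m).1 hm
    have hε : (0:ℝ) < 1 / (L + 1) := by positivity
    have hball : ∀ c ∈ Metric.ball (m:ℂ) (1 / (L + 1)), ∀ t ∈ Icc 0 ω, ‖Φ c t‖ ≤ K + 1 := by
      intro c hc t ht
      have h1 := hΦL c m t ht
      have h2 := hb t ht
      rw [mem_ball_iff_norm, lt_div_iff₀ (by positivity)] at hc
      have h3 : ‖Φ c t‖ ≤ ‖Φ c t - Φ m t‖ + ‖Φ m t‖ := by
        simpa using norm_add_le (Φ c t - Φ m t) (Φ m t)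
      nlinarith [norm_nonneg (c - m)]
    refine ⟨_, hε, hball, ?_⟩
    have hd : DifferentiableOn ℂ (fun c => Φ c ω) (Metric.ball (m:ℂ) (1 / (L + 1))) := by
      intro c hc
      apply DifferentiableAt.differentiableWithinAt
      have hgc : ∀ c', ContinuousOn (fun t => G t (Φ c' t) (Φ c t)) (Icc 0 ω) := fun c' =>
        hG.comp_continuousOn (continuousOn_id.prodMk ((hΦc c').prodMk (hΦc c)))
      have hform : ∀ c' ∈ Metric.ball (m:ℂ) (1 / (L + 1)), Φ c' ω - Φ c ω =
          (c' - c) * Complex.exp (∫ t in (0:ℝ)..ω, G t (Φ c' t) (Φ c t)) := by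
        intro c' hc'
        have := lin_aux ω (fun t => G t (Φ c' t) (Φ c t)) (fun t => Φ c' t - Φ c t) (hgc c')
          (fun t ht => by
            have := (hΦs c' (hball c' hc') t ht).sub (hΦs c (hball c hc) t ht)
            rw [hH] at this
            exact this) ω hωm
        simpa only [hΦ0] using this
      obtain ⟨C, hC⟩ := ((isCompact_Icc (a := (0:ℝ)) (b := ω)).prod
        ((isCompact_closedBall (0:ℂ) (K+1)).prod (isCompact_closedBall (0:ℂ) (K+1)))).exists_bound_of_continuousOn
          hG.continuousOn
      have hnb : Metric.ball (m:ℂ) (1 / (L + 1)) ∈ 𝓝 c := Metric.isOpen_ball.mem_nhds hc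
      have hIc : ContinuousAt (fun c' => ∫ t in (0:ℝ)..ω, G t (Φ c' t) (Φ c t)) c := by
        apply intervalIntegral.continuousAt_of_dominated_interval (bound := fun _ => C)
        · refine Eventually.of_forall fun c' => ?_
          rw [uIoc_of_le hω.le]
          exact ((hgc c').mono Ioc_subset_Icc_self).aestronglyMeasurable measurableSet_Ioc
        · filter_upwards [hnb] with c' hc'
          refine Eventually.of_forall fun t ht => ?_
          rw [uIoc_of_le hω.le] at ht
          have ht := Ioc_subset_Icc_self ht
          exact hC (t, Φ c' t, Φ c t) ⟨ht, by simpa using hball c' hc' t ht,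
            by simpa using hball c hc t ht⟩
        · exact intervalIntegrable_const
        · refine Eventually.of_forall fun t ht => ?_
          rw [uIoc_of_le hω.le] at ht
          have ht := Ioc_subset_Icc_self ht
          exact (hG.comp (continuous_const.prodMk ((hcont t ht).prodMk continuous_const))).continuousAt
      have hQ : ContinuousAt (fun c' => Complex.exp (∫ t in (0:ℝ)..ω, G t (Φ c' t) (Φ c t))) c :=
        hIc.cexp
      refine HasDerivAt.differentiableAt (f' := Complex.exp (∫ t in (0:ℝ)..ω, G t (Φ c t) (Φ c t))) ?_
      rw [hasDerivAt_iff_tendsto_slope]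
      refine (hQ.tendsto.mono_left nhdsWithin_le_nhds).congr' ?_
      filter_upwards [mem_nhdsWithin_of_mem_nhds hnb, self_mem_nhdsWithin] with c' hc' hne
      have hne' : c' - c ≠ 0 := sub_ne_zero.2 hne
      rw [slope_def_field, hform c' hc']
      field_simp
    exact hd.analyticAt (Metric.isOpen_ball.mem_nhds (Metric.mem_ball_self hε))
  by_contra hinf
  obtain ⟨x, hxK, hx⟩ := Set.Infinite.exists_accPt_of_subset_isCompact hinf isCompact_Icc hsub
  have hdP : derivedSet Per ⊆ Per := (isClosed_iff_derivedSet_subset _).1 hclosed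
  have hdc : IsCompact (derivedSet Per) :=
    isCompact_Icc.of_isClosed_subset (isClosed_derivedSet _) (hdP.trans hsub)
  obtain ⟨m, hm, hmax⟩ := hdc.exists_isGreatest ⟨x, hx⟩
  obtain ⟨ε, hε, hball, han⟩ := han m (hdP hm)
  have hfreq : ∃ᶠ c in 𝓝[≠] (m:ℂ), Φ c ω = c := by
    rw [mem_derivedSet, accPt_iff_frequently_nhdsNE] at hm
    have ht : Tendsto (fun r : ℝ => (r:ℂ)) (𝓝[≠] m) (𝓝[≠] (m:ℂ)) := by
      refine tendsto_nhdsWithin_of_tendsto_nhds_of_eventually_within _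
        (Complex.continuous_ofReal.continuousAt.tendsto.mono_left nhdsWithin_le_nhds) ?_
      filter_upwards [self_mem_nhdsWithin] with y hy
      simpa using hy
    exact ht.frequently (hm.mono fun y hy => ((hchar y).1 hy).2.2)
  have hev := (han.frequently_eq_iff_eventually_eq analyticAt_id).1 hfreq
  have hevR : ∀ᶠ y : ℝ in 𝓝 m, Φ y ω = y ∧ (y:ℂ) ∈ Metric.ball (m:ℂ) ε :=
    Complex.continuous_ofReal.continuousAt.eventually
      (hev.and (Metric.isOpen_ball.mem_nhds (Metric.mem_ball_self hε)))
  obtain ⟨δ, hδ, hδb⟩ := Metric.eventually_nhds_iff.1 hevR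
  have hm0 : 0 ≤ m := (hsub (hdP hm)).1
  have hIoo : Ioo m (m + δ) ⊆ Per := by
    intro y hy
    obtain ⟨h1, h2⟩ := hδb (y := y) (by
      rw [Real.dist_eq, abs_of_pos (by linarith [hy.1])]; linarith [hy.2])
    exact ⟨by linarith [hy.1], Φ y, hΦs _ (hball _ h2), hΦ0 _, h1⟩
  have hmem : m + δ / 2 ∈ derivedSet Per := by
    rw [mem_derivedSet, accPt_iff_frequently_nhdsNE]
    apply Eventually.frequently
    exact mem_nhdsWithin_of_mem_nhds (mem_of_superset (Ioo_mem_nhds (by linarith) (by linarith)) hIoo)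
  have := hmax hmem
  linarith

open Set Filter Topology MeasureTheory in
theorem growth_aux (M : ℕ) (ω : ℝ) (a : ℕ → ℝ → ℝ) (ha : ∀ j ≤ M, Continuous (a j)) (δ : ℝ)
    (hδ : 0 < δ) (haM : ∀ t ∈ Icc 0 ω, δ ≤ a M t) :
    ∃ K : ℝ, 0 ≤ K ∧ ∀ t ∈ Icc 0 ω, ∀ x : ℝ, K < x →
      0 < ∑ j ∈ Finset.range (M + 1), a j t * x ^ (j + 1) := by
  have hex : ∀ j, ∃ C : ℝ, 0 ≤ C ∧ (j ≤ M → ∀ t ∈ Icc 0 ω, |a j t| ≤ C) := by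
    intro j
    by_cases hj : j ≤ M
    · obtain ⟨C, hC⟩ := (isCompact_Icc (a := (0:ℝ)) (b := ω)).exists_bound_of_continuousOn
        (ha j hj).continuousOn
      exact ⟨max C 0, le_max_right _ _, fun _ t ht => (hC t ht).trans (le_max_left _ _)⟩
    · exact ⟨0, le_rfl, fun h => absurd h hj⟩
  choose C hC0 hC using hex
  set S := ∑ j ∈ Finset.range M, C j with hS
  have hS0 : 0 ≤ S := Finset.sum_nonneg fun j _ => hC0 j
  refine ⟨1 + S / δ, by positivity, ?_⟩
  intro t ht x hx
  have hSδ : 0 ≤ S / δ := by positivity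
  have hx1 : 1 ≤ x := by linarith
  have hxS : S < δ * x := by
    have : S / δ < x := by linarith
    rwa [div_lt_iff₀' hδ] at this
  rw [Finset.sum_range_succ]
  have h1 : -(S * x ^ M) ≤ ∑ j ∈ Finset.range M, a j t * x ^ (j + 1) := by
    rw [hS, Finset.sum_mul, ← Finset.sum_neg_distrib]
    apply Finset.sum_le_sum
    intro j hj
    have hj' := Finset.mem_range.1 hj
    have hb := hC j hj'.le t ht
    have hp : x ^ (j + 1) ≤ x ^ M := pow_le_pow_right₀ hx1 hj'
    have hp0 : 0 ≤ x ^ (j + 1) := by positivity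
    have h2 : C j * x ^ (j + 1) ≤ C j * x ^ M := mul_le_mul_of_nonneg_left hp (hC0 j)
    have h3 : -C j * x ^ (j + 1) ≤ a j t * x ^ (j + 1) :=
      mul_le_mul_of_nonneg_right (abs_le.1 hb).1 hp0
    linarith
  have h2 : δ * x ^ (M + 1) ≤ a M t * x ^ (M + 1) :=
    mul_le_mul_of_nonneg_right (haM t ht) (by positivity)
  have h3 : S * x ^ M < δ * x * x ^ M := mul_lt_mul_of_pos_right hxS (by positivity)
  have h4 : δ * x * x ^ M = δ * x ^ (M + 1) := by ring
  linarith

open Set Filter Topology MeasureTheory in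
theorem poly_finite_aux (M : ℕ) (ω : ℝ) (hω : 0 < ω) (a : ℕ → ℝ → ℝ)
    (ha : ∀ j ≤ M, Continuous (a j)) (δ : ℝ)
    (hδ : 0 < δ) (haM : ∀ t ∈ Icc 0 ω, δ ≤ a M t) :
    {r : ℝ | 0 ≤ r ∧ ∃ w : ℝ → ℂ, (∀ t ∈ Icc 0 ω, HasDerivWithinAt w
      (∑ j ∈ Finset.range (M + 1), (a j t : ℂ) * w t ^ (j + 1)) (Icc 0 ω) t) ∧
      w 0 = r ∧ w ω = r}.Finite := by
  obtain ⟨K, hK, hgr⟩ := growth_aux M ω a ha δ hδ haM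
  set H : ℝ → ℂ → ℂ := fun t x => ∑ j ∈ Finset.range (M + 1), (a j t : ℂ) * x ^ (j + 1) with hHd
  set G : ℝ → ℂ → ℂ → ℂ := fun t x y => ∑ j ∈ Finset.range (M + 1), (a j t : ℂ) *
    ∑ i ∈ Finset.range (j + 1), x ^ i * y ^ (j + 1 - 1 - i) with hGd
  have hH : ∀ t x y, H t x - H t y = G t x y * (x - y) := by
    intro t x y
    simp only [hHd, hGd]
    rw [← Finset.sum_sub_distrib, Finset.sum_mul]
    refine Finset.sum_congr rfl fun j _ => ?_
    rw [← mul_sub, ← (Commute.all x y).mul_geom_sum₂]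
    ring
  have hac : ∀ j ∈ Finset.range (M + 1), Continuous fun t => (a j t : ℂ) := fun j hj =>
    Complex.continuous_ofReal.comp (ha j (Nat.lt_succ_iff.1 (Finset.mem_range.1 hj)))
  have hG : Continuous fun p : ℝ × ℂ × ℂ => G p.1 p.2.1 p.2.2 := by
    refine continuous_finsetSum _ fun j hj => ?_
    exact ((hac j hj).comp continuous_fst).mul (by fun_prop)
  have hHc : Continuous fun p : ℝ × ℂ => H p.1 p.2 := by
    refine continuous_finsetSum _ fun j hj => ?_
    exact ((hac j hj).comp continuous_fst).mul (by fun_prop)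
  refine finite_aux ω hω H G hG hHc hH K hK ?_
  intro r hr w hw hw0 hw1
  have h0m : (0:ℝ) ∈ Icc 0 ω := left_mem_Icc.2 hω.le
  have hwc : ContinuousOn w (Icc 0 ω) := fun s hs => (hw s hs).continuousWithinAt
  -- `w` is real
  have hreal : ∀ t ∈ Icc 0 ω, w t = ((w t).re : ℂ) := by
    intro t ht
    have hcj : ∀ t ∈ Icc 0 ω, HasDerivWithinAt (fun s => (starRingEnd ℂ) (w s))
        (H t ((starRingEnd ℂ) (w t))) (Icc 0 ω) t := by
      intro t ht
      have h := (Complex.conjCLE : ℂ →L[ℝ] ℂ).hasFDerivAt.comp_hasDerivWithinAt t (hw t ht)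
      have e : H t ((starRingEnd ℂ) (w t)) = (Complex.conjCLE : ℂ →L[ℝ] ℂ) (H t (w t)) := by
        simp [hHd]
      rw [e]
      exact h
    have := lin_aux ω (fun t => G t (w t) ((starRingEnd ℂ) (w t)))
      (fun t => w t - (starRingEnd ℂ) (w t))
      (hG.comp_continuousOn (continuousOn_id.prodMk (hwc.prodMk
        (Complex.continuous_conj.comp_continuousOn hwc))))
      (fun t ht => by
        have := (hw t ht).sub (hcj t ht)
        rw [hH] at this
        exact this) t ht
    simp only [hw0, Complex.conj_ofReal, sub_self, zero_mul] at this
    exact (Complex.conj_eq_iff_re.1 (sub_eq_zero.1 this).symm).symm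
  set x : ℝ → ℝ := fun t => (w t).re with hx
  have hHreal : ∀ t ∈ Icc 0 ω, H t (w t) =
      ((∑ j ∈ Finset.range (M + 1), a j t * x t ^ (j + 1) : ℝ) : ℂ) := by
    intro t ht
    rw [hreal t ht]
    simp [hHd, hx]
  have hxc : ContinuousOn x (Icc 0 ω) := Complex.continuous_re.comp_continuousOn hwc
  have hxd : ∀ t ∈ Icc 0 ω, HasDerivWithinAt x
      (∑ j ∈ Finset.range (M + 1), a j t * x t ^ (j + 1)) (Icc 0 ω) t := by
    intro t ht
    have h := Complex.reCLM.hasFDerivAt.comp_hasDerivWithinAt t (hw t ht)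
    have hh := hHreal t ht
    rw [hh] at h
    exact h
  -- `x` is nonnegative
  have hx0 : ∀ t ∈ Icc 0 ω, 0 ≤ x t := by
    intro t ht
    set q : ℝ → ℝ := fun t => ∑ j ∈ Finset.range (M + 1), a j t * x t ^ j with hq
    have hqc : ContinuousOn q (Icc 0 ω) := by
      refine continuousOn_finsetSum _ fun j hj => ?_
      exact (ha j (Nat.lt_succ_iff.1 (Finset.mem_range.1 hj))).continuousOn.mul (hxc.pow j)
    have := lin_aux ω (fun t => (q t : ℂ)) w (Complex.continuous_ofReal.comp_continuousOn hqc)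
      (fun s hs => by
        have h := hw s hs
        have e : H s (w s) = (q s : ℂ) * w s := by
          rw [hHreal s hs]
          conv_rhs => rw [hreal s hs]
          rw [← Complex.ofReal_mul, hq]
          simp only [Finset.sum_mul]
          congr 1
          refine Finset.sum_congr rfl fun j _ => ?_
          simp only [hx]
          ring
        rw [e] at h
        exact h) t ht
    rw [intervalIntegral.integral_ofReal, hw0, ← Complex.ofReal_exp, ← Complex.ofReal_mul] at this
    simp only [hx]
    rw [this, Complex.ofReal_re]
    exact mul_nonneg hr (Real.exp_pos _).le
  -- maximum argument
  have hxω : x ω = x 0 := by simp [hx, hw0, hw1]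
  obtain ⟨tm, htm, hmax⟩ : ∃ tm ∈ Ico 0 ω, ∀ s ∈ Icc 0 ω, x s ≤ x tm := by
    obtain ⟨tm, htm, hmax⟩ := isCompact_Icc.exists_isMaxOn ⟨0, h0m⟩ hxc
    rcases htm.2.lt_or_eq with h | h
    · exact ⟨tm, ⟨htm.1, h⟩, fun s hs => hmax hs⟩
    · refine ⟨0, ⟨le_rfl, hω⟩, fun s hs => ?_⟩
      rw [← hxω, ← h]
      exact hmax hs
  have hxK : x tm ≤ K := by
    by_contra hlt
    push Not at hlt
    have htm' := Ico_subset_Icc_self htm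
    have hpos := hgr tm htm' (x tm) hlt
    have hd := (hxd tm htm').mono_of_mem_nhdsWithin (Icc_mem_nhdsGE_of_mem htm)
    have hd' := hd.mono (Ioi_subset_Ici_self)
    rw [hasDerivWithinAt_iff_tendsto_slope' (by simp)] at hd'
    have hev : ∀ᶠ s in 𝓝[>] tm, slope x tm s ≤ 0 := by
      filter_upwards [Ioo_mem_nhdsGT htm.2] with s hs
      rw [slope_def_field]
      exact div_nonpos_of_nonpos_of_nonneg
        (by linarith [hmax s ⟨htm.1.trans hs.1.le, hs.2.le⟩]) (by linarith [hs.1])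
    have := le_of_tendsto hd' hev
    linarith
  intro t ht
  rw [hreal t ht, Complex.norm_real, Real.norm_eq_abs]
  have := hx0 t ht
  simp only [hx] at this
  rw [abs_of_nonneg this]
  exact (hmax t ht).trans hxK

theorem stmt_0 (N : ℕ) (hN : 2 ≤ N) (ω : ℝ) (hω : 0 < ω)
    (AN : ℝ → ℝ) (hAN : Continuous AN)
    (A : ℕ → ℝ → ℂ) (hA : ∀ j, 1 ≤ j → j ≤ N - 1 → Continuous (A j))
    (α : ℝ)
    (F : ℝ → ℂ → ℂ)
    (hF : ∀ t z, F t z =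
      (AN t : ℂ) * z ^ N + ∑ j ∈ Finset.Icc 1 (N - 1), A j t * z ^ j)
    (hinv : ∀ t ∈ Set.Icc (0 : ℝ) ω, ∀ r : ℝ, 0 ≤ r →
      ∃ s : ℝ, F t ((r : ℂ) * Complex.exp (α * Complex.I))
        = (s : ℂ) * Complex.exp (α * Complex.I))
    (γ : ℝ) (hγ : γ * Real.cos (((N : ℝ) - 1) * α) > 0)
    (hbound : (0 < γ ∧ ∀ t ∈ Set.Icc (0 : ℝ) ω, γ < AN t) ∨
              (γ < 0 ∧ ∀ t ∈ Set.Icc (0 : ℝ) ω, AN t < γ)) :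
    {r : ℝ | 0 < r ∧ ∃ z : ℝ → ℂ, IsSolution ω F z ∧
        z 0 = (r : ℂ) * Complex.exp (α * Complex.I) ∧ z ω = z 0}.Finite ∧
    ¬ IsCenter ω F := by
  obtain ⟨M, rfl⟩ : ∃ M, N = M + 1 := ⟨N - 1, by omega⟩
  simp only [Nat.add_sub_cancel] at hA hF
  have hfin : {r : ℝ | 0 < r ∧ ∃ z : ℝ → ℂ, IsSolution ω F z ∧
        z 0 = (r : ℂ) * Complex.exp (α * Complex.I) ∧ z ω = z 0}.Finite := by
    set e : ℂ := Complex.exp (α * Complex.I) with he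
    have he0 : e ≠ 0 := Complex.exp_ne_zero _
    set c : ℕ → ℝ → ℂ := fun j t => (if j = M then (AN t : ℂ) else A (j + 1) t) * e ^ j with hc
    have hFc : ∀ t w, F t (w * e) = (∑ j ∈ Finset.range (M + 1), c j t * w ^ (j + 1)) * e := by
      intro t w
      rw [hF, Finset.sum_range_succ, add_mul, add_comm, Finset.sum_mul]
      congr 1
      · rw [show Finset.Icc 1 M = Finset.Ico 1 (M + 1) from rfl, Finset.sum_Ico_eq_sum_range]
        refine Finset.sum_congr (by simp) fun j hj => ?_
        have : j ≠ M := by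
          have := Finset.mem_range.1 hj
          omega
        simp only [hc, if_neg this]
        rw [add_comm 1 j]
        ring
      · simp only [hc, if_true]
        ring
    have him : ∀ t ∈ Set.Icc 0 ω, ∀ j ≤ M, c j t = ((c j t).re : ℂ) := by
      intro t ht
      set p : Polynomial ℝ := ∑ j ∈ Finset.range (M + 1),
        Polynomial.C (c j t).im * Polynomial.X ^ (j + 1) with hp
      have hroot : ∀ r ∈ Set.Ici (0:ℝ), p.IsRoot r := by
        intro r hr
        obtain ⟨s, hs⟩ := hinv t ht r hr
        rw [hFc] at hs
        have hs := mul_right_cancel₀ he0 hs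
        have := congrArg Complex.im hs
        rw [Complex.ofReal_im, Complex.im_sum] at this
        rw [Polynomial.IsRoot, hp, Polynomial.eval_finsetSum, ← this]
        refine Finset.sum_congr rfl fun j _ => ?_
        rw [← Complex.ofReal_pow, Complex.im_mul_ofReal]
        simp
      have hp0 : p = 0 := Polynomial.eq_zero_of_infinite_isRoot p
        ((Set.Ici_infinite (0:ℝ)).mono hroot)
      intro j hj
      have hcoef : p.coeff (j + 1) = (c j t).im := by
        rw [hp, Polynomial.finsetSum_coeff]
        simp only [Polynomial.coeff_C_mul, Polynomial.coeff_X_pow]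
        rw [Finset.sum_eq_single j]
        · simp
        · intro b _ hb
          simp [hb.symm]
        · intro h
          exact absurd (Finset.mem_range.2 (Nat.lt_succ_of_le hj)) h
      rw [hp0, Polynomial.coeff_zero] at hcoef
      apply Complex.ext
      · simp
      · simp [← hcoef]
    have hcM : ∀ t, (c M t).re = AN t * Real.cos (((M + 1 : ℕ) : ℝ) * α - α) := by
      intro t
      simp only [hc, if_true]
      rw [Complex.re_ofReal_mul, he, ← Complex.exp_nat_mul]
      rw [show (M : ℂ) * (α * Complex.I) = (((M + 1 : ℕ) : ℝ) * α - α : ℝ) * Complex.I by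
        push_cast; ring]
      rw [Complex.exp_ofReal_mul_I_re]
    have hcos : Real.cos (((M + 1 : ℕ) : ℝ) * α - α) = Real.cos ((((M + 1 : ℕ) : ℝ) - 1) * α) := by
      congr 1; ring
    have hfin' := poly_finite_aux M ω hω (fun j t => (c j t).re) (by
      intro j hj
      apply Complex.continuous_re.comp
      simp only [hc]
      by_cases h : j = M
      · simp only [h, if_true]
        fun_prop
      · simp only [h, if_false]
        exact (hA (j + 1) (by omega) (by omega)).mul continuous_const)
      _ hγ (by
        intro t ht
        rw [hcM, hcos]
        rcases hbound with ⟨h1, h2⟩ | ⟨h1, h2⟩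
        · have := h2 t ht
          have hcp : 0 < Real.cos ((((M + 1 : ℕ) : ℝ) - 1) * α) := (pos_iff_pos_of_mul_pos hγ).1 h1
          exact mul_le_mul_of_nonneg_right this.le hcp.le
        · have := h2 t ht
          have hcp : Real.cos ((((M + 1 : ℕ) : ℝ) - 1) * α) < 0 := (neg_iff_neg_of_mul_pos hγ).1 h1
          exact mul_le_mul_of_nonpos_right this.le hcp.le)
    refine hfin'.subset ?_
    rintro r ⟨hr, z, hz, hz0, hz1⟩
    refine ⟨hr.le, fun t => z t / e, ?_, ?_, ?_⟩
    · intro t ht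
      have h := ((hz t ht).div_const e).hasDerivWithinAt (s := Set.Icc 0 ω)
      have h2 := hFc t (z t / e)
      rw [div_mul_cancel₀ _ he0] at h2
      rw [h2, mul_div_cancel_right₀ _ he0] at h
      have h3 : ∑ j ∈ Finset.range (M + 1), c j t * (z t / e) ^ (j + 1) =
          ∑ j ∈ Finset.range (M + 1), ((c j t).re : ℂ) * (z t / e) ^ (j + 1) := by
        refine Finset.sum_congr rfl fun j hj => ?_
        rw [← him t ht j (Nat.lt_succ_iff.1 (Finset.mem_range.1 hj))]
      rw [h3] at h
      exact h
    · simp only [hz0]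
      exact mul_div_cancel_right₀ _ he0
    · simp only [hz1, hz0]
      exact mul_div_cancel_right₀ _ he0
  refine ⟨hfin, ?_⟩
  rintro ⟨ε, hε, hcen⟩
  refine (Set.Ioo_infinite hε) (hfin.subset ?_)
  intro r hr
  obtain ⟨z, hz, hz0, hz1⟩ := hcen ((r : ℂ) * Complex.exp (α * Complex.I)) (by
    rw [norm_mul, Complex.norm_exp_ofReal_mul_I, mul_one, Complex.norm_real, Real.norm_eq_abs,
      abs_of_pos hr.1]
    exact hr.2)
  exact ⟨hr.1, z, hz, hz0, by rw [hz1, hz0]⟩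
end

section
/- Let N ≥ 2 be an integer, ω > 0, γ > 0, and let A_N : ℝ → ℝ be continuous with A_N(t) > γ for all t ∈ [0,ω]. If the coefficients A_j : ℝ → ℝ, 1 ≤ j ≤ N−1, are continuous real-valued functions, then z = 0 is not a center for the complex equation ż = A_N(t)z^N + A_{N−1}(t)z^{N−1} + … + A_1(t)z (z ∈ ℂ). -/
open Set Filter Topology Complex

namespace CenterAux

def SolW (ω : ℝ) (F : ℝ → ℂ → ℂ) (z : ℝ → ℂ) : Prop :=
  ∀ t ∈ Icc (0 : ℝ) ω, HasDerivWithinAt z (F t (z t)) (Icc 0 ω) t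

def clampT (ω s : ℝ) : ℝ := max 0 (min s ω)

lemma clampT_cont (ω : ℝ) : Continuous (clampT ω) := by unfold clampT; fun_prop

lemma clampT_mem {ω : ℝ} (hω : 0 < ω) (s : ℝ) : clampT ω s ∈ Icc (0:ℝ) ω := by
  unfold clampT
  exact ⟨le_max_left _ _, max_le hω.le (min_le_right _ _)⟩

lemma clampT_eq {ω s : ℝ} (hs : s ∈ Icc (0:ℝ) ω) : clampT ω s = s := by
  unfold clampT
  rw [min_eq_left hs.2, max_eq_right hs.1]

lemma SolW.continuousOn {ω : ℝ} {F : ℝ → ℂ → ℂ} {z : ℝ → ℂ} (h : SolW ω F z) :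
    ContinuousOn z (Icc 0 ω) := fun t ht => (h t ht).continuousWithinAt

lemma right_deriv {ω : ℝ} {z : ℝ → ℂ} {d : ℂ} {t : ℝ} (ht : t ∈ Ico (0:ℝ) ω)
    (h : HasDerivWithinAt z d (Icc 0 ω) t) : HasDerivWithinAt z d (Ici t) t := by
  have h2 : HasDerivWithinAt z d (Icc t ω) t := h.mono (Icc_subset_Icc_left ht.1)
  exact h2.mono_of_mem_nhdsWithin (Icc_mem_nhdsGE ht.2)

lemma linear_sol {ω : ℝ} {g w : ℝ → ℂ} (hg : Continuous g)
    (hw : ∀ t ∈ Icc (0 : ℝ) ω, HasDerivWithinAt w (g t * w t) (Icc 0 ω) t) :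
    ∀ t ∈ Icc (0 : ℝ) ω, w t = w 0 * Complex.exp (∫ s in (0:ℝ)..t, g s) := by
  have hI : ∀ t, HasDerivAt (fun t => ∫ s in (0:ℝ)..t, g s) (g t) t := fun t =>
    intervalIntegral.integral_hasDerivAt_right (hg.intervalIntegrable _ _)
      (hg.stronglyMeasurableAtFilter _ _) hg.continuousAt
  have hu : ∀ t ∈ Icc (0 : ℝ) ω, HasDerivWithinAt
      (fun t => w t * Complex.exp (-∫ s in (0:ℝ)..t, g s)) 0 (Icc 0 ω) t := by
    intro t ht
    have h1 := (hw t ht).mul ((hI t).neg.cexp.hasDerivWithinAt (s := Icc 0 ω))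
    refine h1.congr_deriv ?_
    simp only [Pi.neg_apply]
    ring
  have hc := constant_of_has_deriv_right_zero (a := 0) (b := ω)
    (fun t ht => (hu t ht).continuousWithinAt)
    (fun t ht => right_deriv ht (hu t ⟨ht.1, ht.2.le⟩))
  intro t ht
  have := hc t ht
  simp only [intervalIntegral.integral_same, neg_zero, Complex.exp_zero, mul_one] at this
  rw [← this, mul_assoc, ← Complex.exp_add]
  simp

lemma diff_formula {ω : ℝ} (hω : 0 < ω) {F : ℝ → ℂ → ℂ} {G : ℝ → ℂ → ℂ → ℂ}
    (hG : Continuous fun p : ℝ × ℂ × ℂ => G p.1 p.2.1 p.2.2)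
    (hFG : ∀ t z w, F t z - F t w = G t z w * (z - w))
    {z w : ℝ → ℂ} (hz : SolW ω F z) (hw : SolW ω F w) :
    ∀ t ∈ Icc (0 : ℝ) ω, z t - w t = (z 0 - w 0) *
      Complex.exp (∫ s in (0:ℝ)..t, G (clampT ω s) (z (clampT ω s)) (w (clampT ω s))) := by
  have hzc : Continuous fun s => z (clampT ω s) :=
    hz.continuousOn.comp_continuous (clampT_cont ω) (clampT_mem hω)
  have hwc : Continuous fun s => w (clampT ω s) :=
    hw.continuousOn.comp_continuous (clampT_cont ω) (clampT_mem hω)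
  have hg : Continuous fun s => G (clampT ω s) (z (clampT ω s)) (w (clampT ω s)) :=
    hG.comp ((clampT_cont ω).prodMk (hzc.prodMk hwc))
  refine linear_sol (w := fun t => z t - w t) hg ?_
  intro t ht
  have := (hz t ht).sub (hw t ht)
  rw [hFG] at this
  simpa only [clampT_eq ht] using! this

lemma per_bound {ω : ℝ} (hω : 0 < ω) {F : ℝ → ℂ → ℂ} {G : ℝ → ℂ → ℂ → ℂ}
    (hG : Continuous fun p : ℝ × ℂ × ℂ => G p.1 p.2.1 p.2.2)
    (hFG : ∀ t z w, F t z - F t w = G t z w * (z - w))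
    (hF0 : ∀ t, F t 0 = 0)
    (hFc : ∀ t z, F t (starRingEnd ℂ z) = starRingEnd ℂ (F t z))
    {R : ℝ} (hR : ∀ t ∈ Icc (0:ℝ) ω, ∀ x : ℝ, R < x → 0 < (F t x).re)
    {z : ℝ → ℂ} (hz : SolW ω F z) {c : ℝ} (hc : 0 ≤ c) (h0 : z 0 = c) (h1 : z ω = c) :
    ∀ t ∈ Icc (0 : ℝ) ω, ‖z t‖ ≤ R := by
  have hreal : ∀ t ∈ Icc (0 : ℝ) ω, z t = ((z t).re : ℂ) := by
    intro t ht
    have hzb : SolW ω F (fun t => starRingEnd ℂ (z t)) := by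
      intro t ht
      have := (hz t ht).star
      rw [hFc]
      exact this
    have := diff_formula hω hG hFG hz hzb t ht
    simp only [h0, Complex.conj_ofReal, sub_self, zero_mul] at this
    exact (Complex.conj_eq_iff_re.mp (sub_eq_zero.mp this).symm).symm
  have h0S : SolW ω F (fun _ => 0) := by
    intro t ht
    rw [hF0]
    exact hasDerivWithinAt_const _ _ _
  have hexp := diff_formula hω hG hFG hz h0S
  simp only [sub_zero] at hexp
  have hcont : ContinuousOn (fun t => (z t).re) (Icc 0 ω) :=
    Complex.continuous_re.comp_continuousOn hz.continuousOn
  have hnonneg : ∀ t ∈ Icc (0 : ℝ) ω, 0 ≤ (z t).re := by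
    intro t ht
    by_contra! hlt
    have hiv := intermediate_value_Icc' ht.1 (hcont.mono (Icc_subset_Icc_right ht.2))
    have : (0:ℝ) ∈ Icc (z t).re (z 0).re := ⟨hlt.le, by simp [h0, hc]⟩
    obtain ⟨s, hs, hs0⟩ := hiv this
    have hsm : s ∈ Icc (0:ℝ) ω := ⟨hs.1, hs.2.trans ht.2⟩
    have e1 := hexp s hsm
    have hs0' : (z s).re = 0 := hs0
    rw [hreal s hsm, hs0'] at e1
    have e2 : z 0 = 0 := by
      have := e1.symm
      simpa [Complex.exp_ne_zero] using this
    have e3 := hexp t ht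
    rw [e2, zero_mul] at e3
    rw [e3] at hlt
    simp at hlt
  -- maximum
  have hmax : ∃ t ∈ Ico (0:ℝ) ω, ∀ s ∈ Icc (0:ℝ) ω, (z s).re ≤ (z t).re := by
    obtain ⟨t, ht, hm⟩ := isCompact_Icc.exists_isMaxOn (nonempty_Icc.mpr hω.le) hcont
    by_cases h : t = ω
    · refine ⟨0, ⟨le_rfl, hω⟩, fun s hs => ?_⟩
      have := hm hs
      simp only [mem_ofPred_eq, h, h1] at this
      simpa [h0] using this
    · exact ⟨t, ⟨ht.1, lt_of_le_of_ne ht.2 h⟩, fun s hs => hm hs⟩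
  obtain ⟨t0, ht0, hm⟩ := hmax
  have hle : (z t0).re ≤ R := by
    by_contra! hlt
    have ht0' : t0 ∈ Icc (0:ℝ) ω := ⟨ht0.1, ht0.2.le⟩
    have hpos := hR t0 ht0' _ hlt
    rw [← hreal t0 ht0'] at hpos
    have hd := right_deriv ht0 (hz t0 ht0')
    have hd2 : HasDerivWithinAt (fun t => (z t).re) (F t0 (z t0)).re (Ioi t0) t0 :=
      (Complex.reCLM.hasFDerivAt.comp_hasDerivWithinAt t0 hd).mono Ioi_subset_Ici_self
    rw [hasDerivWithinAt_iff_tendsto_slope' (by simp)] at hd2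
    have hev := hd2.eventually (eventually_gt_nhds hpos)
    have hev2 : ∀ᶠ s in 𝓝[>] t0, s ∈ Ioo t0 ω := Ioo_mem_nhdsGT ht0.2
    obtain ⟨s, hs1, hs2⟩ := (hev.and hev2).exists
    rw [slope_def_field] at hs1
    have := hm s ⟨ht0.1.trans hs2.1.le, hs2.2.le⟩
    have h3 : ((z s).re - (z t0).re) / (s - t0) ≤ 0 :=
      div_nonpos_of_nonpos_of_nonneg (by linarith) (by linarith [hs2.1])
    linarith
  intro t ht
  rw [hreal t ht, Complex.norm_real, Real.norm_eq_abs, abs_of_nonneg (hnonneg t ht)]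
  exact (hm t ht).trans hle

def rho (M : ℝ) (z : ℂ) : ℂ := ⟨max (min z.re M) (-M), max (min z.im M) (-M)⟩

lemma rho_eq {M : ℝ} {z : ℂ} (h : ‖z‖ ≤ M) : rho M z = z := by
  have h1 := abs_le.mp ((Complex.abs_re_le_norm z).trans h)
  have h2 := abs_le.mp ((Complex.abs_im_le_norm z).trans h)
  apply Complex.ext
  · simp [rho, h1.1, h1.2]
  · simp [rho, h2.1, h2.2]

lemma clamp_lip (M a b : ℝ) : |max (min a M) (-M) - max (min b M) (-M)| ≤ |a - b| := by
  refine (abs_max_sub_max_le_abs _ _ _).trans ((abs_min_sub_min_le_max _ _ _ _).trans ?_)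
  simp

lemma rho_lip (M : ℝ) (z w : ℂ) : ‖rho M z - rho M w‖ ≤ 2 * ‖z - w‖ := by
  refine (Complex.norm_le_abs_re_add_abs_im _).trans ?_
  have h1 := clamp_lip M z.re w.re
  have h2 := clamp_lip M z.im w.im
  have h3 := Complex.abs_re_le_norm (z - w)
  have h4 := Complex.abs_im_le_norm (z - w)
  simp only [Complex.sub_re, Complex.sub_im, rho] at *
  linarith

lemma rho_norm {M : ℝ} (hM : 0 ≤ M) (z : ℂ) : ‖rho M z‖ ≤ 2 * M := by
  refine (Complex.norm_le_abs_re_add_abs_im _).trans ?_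
  have h : ∀ a : ℝ, |max (min a M) (-M)| ≤ M := fun a =>
    abs_le.mpr ⟨le_max_right _ _, max_le (min_le_right _ _) (by linarith)⟩
  have h1 := h z.re
  have h2 := h z.im
  simp only [rho]
  linarith

lemma flow_exists {ω : ℝ} (hω : 0 < ω) {F : ℝ → ℂ → ℂ} {G : ℝ → ℂ → ℂ → ℂ}
    (hG : Continuous fun p : ℝ × ℂ × ℂ => G p.1 p.2.1 p.2.2)
    (hFG : ∀ t z w, F t z - F t w = G t z w * (z - w))
    (hF0 : ∀ t, F t 0 = 0) {M : ℝ} (hM : 0 ≤ M) :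
    ∃ φ : ℂ → ℝ → ℂ, ∃ L : ℝ, 0 ≤ L ∧ (∀ c, φ c 0 = c) ∧
      (∀ c, ∀ t ∈ Icc (0:ℝ) ω, HasDerivWithinAt (φ c) (F t (rho M (φ c t))) (Icc 0 ω) t) ∧
      (∀ c c', ∀ t ∈ Icc (0:ℝ) ω, ‖φ c t - φ c' t‖ ≤ ‖c - c'‖ * L) ∧
      (∀ z, SolW ω F z → (∀ t ∈ Icc (0:ℝ) ω, ‖z t‖ ≤ M) →
        ∀ t ∈ Icc (0:ℝ) ω, z t = φ (z 0) t) := by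
  obtain ⟨K, hK⟩ : ∃ K : ℝ, ∀ t ∈ Icc (0:ℝ) ω, ∀ z w : ℂ, ‖z‖ ≤ 2 * M → ‖w‖ ≤ 2 * M →
      ‖G t z w‖ ≤ K := by
    have hcomp : IsCompact (Icc (0:ℝ) ω ×ˢ (Metric.closedBall (0:ℂ) (2*M) ×ˢ
        Metric.closedBall (0:ℂ) (2*M))) :=
      isCompact_Icc.prod ((isCompact_closedBall _ _).prod (isCompact_closedBall _ _))
    obtain ⟨K, hK⟩ := hcomp.exists_bound_of_continuousOn hG.continuousOn
    exact ⟨K, fun t ht z w hz hw => hK (t, z, w) ⟨ht, by simpa using hz, by simpa using hw⟩⟩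
  have hK0 : 0 ≤ K := (norm_nonneg _).trans
    (hK 0 ⟨le_rfl, hω.le⟩ 0 0 (by simpa using hM) (by simpa using hM))
  set v : ℝ → ℂ → ℂ := fun t z => F (clampT ω t) (rho M z) with hv
  have hFmul : ∀ t z, F t z = G t z 0 * z := fun t z => by
    have := hFG t z 0
    simpa [hF0] using this
  have hlip : ∀ t, LipschitzWith (2 * K).toNNReal (v t) := by
    intro t
    refine LipschitzWith.of_dist_le_mul fun z w => ?_
    rw [dist_eq_norm, dist_eq_norm, Real.coe_toNNReal _ (by positivity)]
    simp only [hv]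
    rw [hFG, norm_mul]
    have h1 := hK _ (clampT_mem hω t) (rho M z) (rho M w) (rho_norm hM z) (rho_norm hM w)
    calc _ ≤ K * (2 * ‖z - w‖) := mul_le_mul h1 (rho_lip M z w) (norm_nonneg _) hK0
      _ = _ := by ring
  have hbd : ∀ t z, ‖v t z‖ ≤ K * (2 * M) := by
    intro t z
    simp only [hv]
    rw [hFmul, norm_mul]
    have h1 := hK _ (clampT_mem hω t) (rho M z) 0 (rho_norm hM z) (by simpa using hM)
    exact mul_le_mul h1 (rho_norm hM z) (norm_nonneg _) hK0
  have hex : ∀ c : ℂ, ∃ α : ℝ → ℂ, α 0 = c ∧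
      ∀ t ∈ Icc (0:ℝ) ω, HasDerivWithinAt α (v t (α t)) (Icc 0 ω) t := by
    intro c
    have hPL : IsPicardLindelof v (tmin := 0) (tmax := ω) ⟨0, le_rfl, hω.le⟩ c
        (K * (2 * M) * ω).toNNReal 0 (K * (2 * M)).toNNReal (2 * K).toNNReal :=
      { lipschitzOnWith := fun t _ => (hlip t).lipschitzOnWith
        continuousOn := fun x _ => by
          have : Continuous fun t => G (clampT ω t) (rho M x) 0 * rho M x :=
            Continuous.mul (hG.comp ((clampT_cont ω).prodMk
              (continuous_const (y := (rho M x, (0:ℂ)))))) continuous_const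
          simp only [hv, hFmul]
          exact this.continuousOn
        norm_le := fun t _ x _ => (hbd t x).trans (Real.le_coe_toNNReal _)
        mul_max_le := by
          rw [Real.coe_toNNReal _ (by positivity), Real.coe_toNNReal _ (by positivity)]
          simp [hω.le] }
    exact hPL.exists_eq_forall_mem_Icc_hasDerivWithinAt₀
  choose φ hφ0 hφ using hex
  have hφ' : ∀ c, ∀ t ∈ Ico (0:ℝ) ω, HasDerivWithinAt (φ c) (v t (φ c t)) (Ici t) t :=
    fun c t ht => right_deriv ht (hφ c t ⟨ht.1, ht.2.le⟩)
  have hφc : ∀ c, ContinuousOn (φ c) (Icc 0 ω) := fun c t ht => (hφ c t ht).continuousWithinAt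
  refine ⟨φ, Real.exp ((2 * K).toNNReal * ω), (Real.exp_pos _).le, hφ0, ?_, ?_, ?_⟩
  · intro c t ht
    have := hφ c t ht
    simpa only [hv, clampT_eq ht] using this
  · intro c c' t ht
    have := dist_le_of_trajectories_ODE hlip (hφc c) (hφ' c) (hφc c') (hφ' c')
      (δ := ‖c - c'‖) (by rw [hφ0, hφ0, dist_eq_norm]) t ht
    rw [dist_eq_norm] at this
    refine this.trans ?_
    gcongr
    linarith [ht.2]
  · intro z hz hzM
    refine ODE_solution_unique hlip hz.continuousOn ?_ (hφc _) (hφ' _) (hφ0 _).symm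
    intro t ht
    have ht' : t ∈ Icc (0:ℝ) ω := ⟨ht.1, ht.2.le⟩
    simp only [hv, clampT_eq ht', rho_eq (hzM t ht')]
    exact right_deriv ht (hz t ht')


lemma return_diff {ω : ℝ} (hω : 0 < ω) {F : ℝ → ℂ → ℂ} {G : ℝ → ℂ → ℂ → ℂ}
    (hG : Continuous fun p : ℝ × ℂ × ℂ => G p.1 p.2.1 p.2.2)
    (hFG : ∀ t z w, F t z - F t w = G t z w * (z - w))
    {φ : ℂ → ℝ → ℂ} {L M : ℝ} {U : Set ℂ} (hU : IsOpen U)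
    (hφ0 : ∀ c, φ c 0 = c)
    (hsol : ∀ c ∈ U, SolW ω F (φ c))
    (hM : ∀ c ∈ U, ∀ t ∈ Icc (0:ℝ) ω, ‖φ c t‖ ≤ M)
    (hL : ∀ c c', ∀ t ∈ Icc (0:ℝ) ω, ‖φ c t - φ c' t‖ ≤ ‖c - c'‖ * L) :
    DifferentiableOn ℂ (fun c => φ c ω) U := by
  intro c hc
  have hωm : ω ∈ Icc (0:ℝ) ω := ⟨hω.le, le_rfl⟩
  set E : ℂ → ℂ := fun c' => ∫ s in (0:ℝ)..ω,
    G (clampT ω s) (φ c' (clampT ω s)) (φ c (clampT ω s)) with hE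
  obtain ⟨K, hK⟩ : ∃ K : ℝ, ∀ t ∈ Icc (0:ℝ) ω, ∀ z w : ℂ, ‖z‖ ≤ M → ‖w‖ ≤ M →
      ‖G t z w‖ ≤ K := by
    have hcomp : IsCompact (Icc (0:ℝ) ω ×ˢ (Metric.closedBall (0:ℂ) M ×ˢ
        Metric.closedBall (0:ℂ) M)) :=
      isCompact_Icc.prod ((isCompact_closedBall _ _).prod (isCompact_closedBall _ _))
    obtain ⟨K, hK⟩ := hcomp.exists_bound_of_continuousOn hG.continuousOn
    exact ⟨K, fun t ht z w hz hw => hK (t, z, w) ⟨ht, by simpa using hz, by simpa using hw⟩⟩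
  have hcc : ∀ c' ∈ U, Continuous fun s => φ c' (clampT ω s) := fun c' hc' =>
    (hsol c' hc').continuousOn.comp_continuous (clampT_cont ω) (clampT_mem hω)
  have hEc : ContinuousAt E c := by
    refine intervalIntegral.continuousAt_of_dominated_interval (bound := fun _ => K) ?_ ?_
      intervalIntegrable_const ?_
    · filter_upwards [hU.mem_nhds hc] with c' hc'
      exact (hG.comp ((clampT_cont ω).prodMk
        ((hcc c' hc').prodMk (hcc c hc)))).aestronglyMeasurable
    · filter_upwards [hU.mem_nhds hc] with c' hc'
      refine Eventually.of_forall fun s _ => ?_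
      exact hK _ (clampT_mem hω s) _ _ (hM c' hc' _ (clampT_mem hω s))
        (hM c hc _ (clampT_mem hω s))
    · refine Eventually.of_forall fun s _ => ?_
      have h1 : ContinuousAt (fun c' => φ c' (clampT ω s)) c := by
        rw [ContinuousAt, tendsto_iff_norm_sub_tendsto_zero]
        refine squeeze_zero (fun _ => norm_nonneg _)
          (fun c' => hL c' c _ (clampT_mem hω s)) ?_
        have : Continuous fun c' : ℂ => ‖c' - c‖ * L := by fun_prop
        simpa using this.tendsto c
      have h2 : ContinuousAt (fun c' => (clampT ω s, φ c' (clampT ω s), φ c (clampT ω s))) c :=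
        continuousAt_const.prodMk (h1.prodMk continuousAt_const)
      exact hG.continuousAt.comp h2
  have hd : HasDerivAt (fun c => φ c ω) (Complex.exp (E c)) c := by
    rw [hasDerivAt_iff_tendsto_slope]
    have ht : Tendsto (fun c' => Complex.exp (E c')) (𝓝[≠] c) (𝓝 (Complex.exp (E c))) :=
      (hEc.cexp).tendsto.mono_left nhdsWithin_le_nhds
    refine ht.congr' ?_
    filter_upwards [self_mem_nhdsWithin, mem_nhdsWithin_of_mem_nhds (hU.mem_nhds hc)] with c' h1 h2
    have := diff_formula hω hG hFG (hsol c' h2) (hsol c hc) ω hωm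
    rw [hφ0, hφ0] at this
    rw [slope_def_field, this, mul_div_cancel_left₀]
    exact sub_ne_zero.mpr h1
  exact hd.differentiableAt.differentiableWithinAt

theorem not_center {ω : ℝ} (hω : 0 < ω) {F : ℝ → ℂ → ℂ} {G : ℝ → ℂ → ℂ → ℂ}
    (hG : Continuous fun p : ℝ × ℂ × ℂ => G p.1 p.2.1 p.2.2)
    (hFG : ∀ t z w, F t z - F t w = G t z w * (z - w))
    (hF0 : ∀ t, F t 0 = 0)
    (hFc : ∀ t z, F t (starRingEnd ℂ z) = starRingEnd ℂ (F t z))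
    {R : ℝ} (hR0 : 0 ≤ R)
    (hR : ∀ t ∈ Icc (0:ℝ) ω, ∀ x : ℝ, R < x → 0 < (F t x).re) :
    ¬ IsCenter ω F := by
  rintro ⟨ε, hε, hcen⟩
  have h0m : (0:ℝ) ∈ Icc (0:ℝ) ω := ⟨le_rfl, hω.le⟩
  have hωm : ω ∈ Icc (0:ℝ) ω := ⟨hω.le, le_rfl⟩
  let Per : ℝ → Prop := fun c => ∃ z, SolW ω F z ∧ z 0 = (c:ℂ) ∧ z ω = (c:ℂ)
  have hper0 : ∀ c : ℝ, 0 ≤ c → c < ε → Per c := by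
    intro c h0 h1
    obtain ⟨z, hz, e0, e1⟩ := hcen c (by simpa [abs_of_nonneg h0] using h1)
    exact ⟨z, fun t ht => (hz t ht).hasDerivWithinAt, e0, e1⟩
  let S : Set ℝ := {c | 0 ≤ c ∧ ∀ c' ∈ Icc (0:ℝ) c, Per c'}
  have hSbd : BddAbove S := by
    refine ⟨R, ?_⟩
    rintro c ⟨h0, h⟩
    obtain ⟨z, hz, e0, e1⟩ := h c ⟨h0, le_rfl⟩
    have := per_bound hω hG hFG hF0 hFc hR hz h0 e0 e1 0 h0m
    rw [e0, Complex.norm_real, Real.norm_eq_abs] at this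
    exact (le_abs_self c).trans this
  have hεS : ε / 2 ∈ S := ⟨by positivity, fun c' hc' => hper0 c' hc'.1 (by linarith [hc'.2])⟩
  set cs := sSup S with hcs
  have hcsε : ε / 2 ≤ cs := le_csSup hSbd hεS
  have hperlt : ∀ c : ℝ, 0 ≤ c → c < cs → Per c := by
    intro c h0 h1
    obtain ⟨s, hs, hlt⟩ := exists_lt_of_lt_csSup ⟨_, hεS⟩ h1
    exact hs.2 c ⟨h0, hlt.le⟩
  obtain ⟨φ, L, hL0, hφ0, hφ, hL, huniq⟩ :=
    flow_exists hω hG hFG hF0 (M := R + 1) (by linarith)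
  have hφper : ∀ c : ℝ, 0 ≤ c → c < cs → φ c ω = c ∧ ∀ t ∈ Icc (0:ℝ) ω, ‖φ c t‖ ≤ R := by
    intro c h0 h1
    obtain ⟨z, hz, e0, e1⟩ := hperlt c h0 h1
    have hb := per_bound hω hG hFG hF0 hFc hR hz h0 e0 e1
    have hu := huniq z hz (fun t ht => (hb t ht).trans (by linarith))
    rw [e0] at hu
    refine ⟨by rw [← hu ω hωm, e1], fun t ht => ?_⟩
    rw [← hu t ht]
    exact hb t ht
  set r : ℝ := 1 / (2 * (L + 1)) with hr
  have hrpos : 0 < r := by positivity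
  set U := Metric.ball (cs : ℂ) r with hU
  have hUM : ∀ c ∈ U, ∀ t ∈ Icc (0:ℝ) ω, ‖φ c t‖ ≤ R + 1 := by
    intro c hc t ht
    set d := min r (ε / 2) with hd
    have hd0 : 0 < d := lt_min hrpos (by positivity)
    have hd1 : d ≤ r := min_le_left _ _
    have hd2 : d ≤ ε / 2 := min_le_right _ _
    have h1 := (hφper (cs - d) (by linarith) (by linarith)).2 t ht
    have h2 := hL c ((cs - d : ℝ) : ℂ) t ht
    have h3 : ‖c - ((cs - d : ℝ) : ℂ)‖ ≤ 2 * r := by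
      have e : c - ((cs - d : ℝ) : ℂ) = (c - cs) + (d : ℂ) := by push_cast; ring
      rw [e]
      have h4 : ‖c - cs‖ < r := by simpa [hU, dist_eq_norm] using hc
      have h5 : ‖(d : ℂ)‖ = d := by
        rw [Complex.norm_real, Real.norm_eq_abs, abs_of_pos hd0]
      linarith [norm_add_le (c - cs) (d : ℂ)]
    have h6 : 2 * r * L ≤ 1 := by
      rw [hr]
      field_simp
      linarith
    have h7 := mul_le_mul_of_nonneg_right h3 hL0
    have h8 := norm_sub_norm_le (φ c t) (φ ((cs - d : ℝ) : ℂ) t)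
    linarith
  have hUsol : ∀ c ∈ U, SolW ω F (φ c) := by
    intro c hc t ht
    have := hφ c t ht
    rwa [rho_eq (hUM c hc t ht)] at this
  have hdiff := return_diff hω hG hFG (Metric.isOpen_ball : IsOpen U) hφ0 hUsol hUM hL
  have hcsU : (cs : ℂ) ∈ U := Metric.mem_ball_self hrpos
  have hfreq : ∃ᶠ z in 𝓝[≠] (cs : ℂ), φ z ω = z := by
    have ht : Tendsto (fun x : ℝ => (x : ℂ)) (𝓝[<] cs) (𝓝[≠] (cs : ℂ)) := by
      refine tendsto_nhdsWithin_iff.mpr ⟨?_, ?_⟩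
      · exact (Complex.continuous_ofReal.tendsto cs).mono_left nhdsWithin_le_nhds
      · filter_upwards [self_mem_nhdsWithin] with x hx
        have : x ≠ cs := ne_of_lt hx
        simpa using this
    refine ht.frequently (Eventually.frequently ?_)
    have : Ioo 0 cs ∈ 𝓝[<] cs := Ioo_mem_nhdsLT (by linarith)
    filter_upwards [this] with x hx
    exact (hφper x hx.1.le hx.2).1
  have heq := (hdiff.analyticOnNhd Metric.isOpen_ball).eqOn_of_preconnected_of_frequently_eq
    (analyticOnNhd_id) (convex_ball _ _).isPreconnected hcsU hfreq
  have hmem : cs + r / 2 ∈ S := by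
    refine ⟨by linarith, fun c hc => ?_⟩
    rcases lt_or_ge c cs with h | h
    · exact hperlt c hc.1 h
    · have hcU : (c : ℂ) ∈ U := by
        rw [hU, Metric.mem_ball, dist_eq_norm, ← Complex.ofReal_sub, Complex.norm_real,
          Real.norm_eq_abs, abs_of_nonneg (by linarith)]
        linarith [hc.2]
      exact ⟨φ c, hUsol c hcU, hφ0 c, heq hcU⟩
  have := le_csSup hSbd hmem
  linarith

end CenterAux

open CenterAux in
theorem stmt_2 (N : ℕ) (hN : 2 ≤ N) (ω : ℝ) (hω : 0 < ω)
    (γ : ℝ) (hγ : 0 < γ)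
    (AN : ℝ → ℝ) (hAN : Continuous AN)
    (hANγ : ∀ t ∈ Set.Icc (0 : ℝ) ω, γ < AN t)
    (A : ℕ → ℝ → ℝ)
    (hA : ∀ j, 1 ≤ j → j ≤ N - 1 → Continuous (A j)) :
    ¬ IsCenter ω (fun t z => (AN t : ℂ) * z ^ N +
        ∑ j ∈ Finset.Icc 1 (N - 1), (A j t : ℂ) * z ^ j) := by
  have hAs : ∀ j ∈ Finset.Icc 1 (N - 1), Continuous (A j) := fun j hj =>
    hA j (Finset.mem_Icc.mp hj).1 (Finset.mem_Icc.mp hj).2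
  have hB : ∃ K : ℝ, 0 ≤ K ∧ ∀ t ∈ Icc (0:ℝ) ω, ∑ j ∈ Finset.Icc 1 (N - 1), |A j t| ≤ K := by
    have hc : Continuous fun t => ∑ j ∈ Finset.Icc 1 (N - 1), |A j t| :=
      continuous_finsetSum _ fun j hj => (hAs j hj).abs
    obtain ⟨K, hK⟩ := (isCompact_Icc (a := (0:ℝ)) (b := ω)).exists_bound_of_continuousOn
      hc.continuousOn
    exact ⟨K, (norm_nonneg _).trans (hK 0 ⟨le_rfl, hω.le⟩),
      fun t ht => (le_abs_self _).trans (hK t ht)⟩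
  obtain ⟨K, hK0, hK⟩ := hB
  refine not_center hω (R := max 1 (K / γ))
    (G := fun t z w => (AN t : ℂ) * (∑ i ∈ Finset.range N, z ^ i * w ^ (N - 1 - i)) +
      ∑ j ∈ Finset.Icc 1 (N - 1), (A j t : ℂ) * (∑ i ∈ Finset.range j, z ^ i * w ^ (j - 1 - i)))
    ?_ ?_ ?_ ?_ (le_max_of_le_left zero_le_one) ?_
  · refine Continuous.add (by fun_prop) (continuous_finsetSum _ fun j hj => ?_)
    have := hAs j hj
    fun_prop
  · intro t z w
    simp only [add_mul, Finset.sum_mul (Finset.Icc 1 (N - 1)), mul_assoc,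
      (Commute.all z w).geom_sum₂_mul]
    simp only [mul_sub, Finset.sum_sub_distrib]
    ring
  · intro t
    have h1 : (0:ℂ) ^ N = 0 := zero_pow (by omega)
    rw [h1, mul_zero, zero_add]
    refine Finset.sum_eq_zero fun j hj => ?_
    rw [zero_pow (by have := (Finset.mem_Icc.mp hj).1; omega), mul_zero]
  · intro t z
    simp [map_sum]
  · intro t ht x hx
    have hx1 : 1 < x := (le_max_left _ _).trans_lt hx
    have hx2 : K / γ < x := (le_max_right _ _).trans_lt hx
    have e : ((AN t : ℂ) * (x : ℂ) ^ N +
        ∑ j ∈ Finset.Icc 1 (N - 1), (A j t : ℂ) * (x : ℂ) ^ j) =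
        ((AN t * x ^ N + ∑ j ∈ Finset.Icc 1 (N - 1), A j t * x ^ j : ℝ) : ℂ) := by
      push_cast; rfl
    rw [e, Complex.ofReal_re]
    have hpow : 0 < x ^ (N - 1) := by positivity
    have hs : -(K * x ^ (N - 1)) ≤ ∑ j ∈ Finset.Icc 1 (N - 1), A j t * x ^ j := by
      have h1 : ∑ j ∈ Finset.Icc 1 (N - 1), -(|A j t| * x ^ (N - 1)) ≤
          ∑ j ∈ Finset.Icc 1 (N - 1), A j t * x ^ j := by
        refine Finset.sum_le_sum fun j hj => ?_
        have h2 : x ^ j ≤ x ^ (N - 1) := pow_le_pow_right₀ hx1.le (Finset.mem_Icc.mp hj).2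
        have h3 : 0 ≤ x ^ j := by positivity
        have h4 := mul_le_mul_of_nonneg_left h2 (abs_nonneg (A j t))
        have h5 := mul_le_mul_of_nonneg_right (neg_abs_le (A j t)) h3
        linarith
      rw [Finset.sum_neg_distrib, ← Finset.sum_mul] at h1
      have := mul_le_mul_of_nonneg_right (hK t ht) hpow.le
      linarith
    have hN' : x ^ N = x ^ (N - 1) * x := by
      rw [← pow_succ]; congr 1; omega
    have h6 : K < γ * x := by
      rw [div_lt_iff₀ hγ] at hx2
      linarith
    have h7 : γ * x < AN t * x := mul_lt_mul_of_pos_right (hANγ t ht) (by linarith)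
    have h8 : 0 < x ^ (N - 1) * (AN t * x - K) := mul_pos hpow (by linarith)
    rw [hN']
    nlinarith
end

section
/- Let ω > 0, let L, M, N be integers with 1 < L < M < N = L + M − 1, and let A, B, C : ℝ → ℂ be continuous. Set λ₁ = ∫₀^ω C(t) dt. Suppose z : ℂ → ℝ → ℂ is a family such that for some ε > 0 and every c with |c| < ε, t ↦ z(c,t) is a solution of ż = A(t)z^N + B(t)z^M + C(t)z^L on [0,ω] with z(c,0) = c, and suppose the displacement map q(c) = z(c,ω) − c is analytic at c = 0. Then q has a zero of order exactly L at c = 0 (i.e. the multiplicity of z = 0 is L) if and only if λ₁ ≠ 0. -/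
/-- The analytic function `q` has a zero of order exactly `k` at `0`. -/
def HasZeroOfOrderExactly (q : ℂ → ℂ) (k : ℕ) : Prop :=
  ∃ g : ℂ → ℂ, AnalyticAt ℂ g 0 ∧ g 0 ≠ 0 ∧ ∀ᶠ c in nhds (0 : ℂ), q c = c ^ k * g c

lemma aux_pow (n : ℕ) (x y : ℂ) (R : ℝ) (hx : ‖x‖ ≤ R) (hy : ‖y‖ ≤ R) :
    ‖x ^ (n+1) - y ^ (n+1)‖ ≤ (n+1) * R ^ n * ‖x - y‖ := by
  have hR : 0 ≤ R := (norm_nonneg x).trans hx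
  induction n with
  | zero => simp
  | succ n ih =>
    have e : x ^ (n+1+1) - y ^ (n+1+1) = x * (x^(n+1) - y^(n+1)) + (x - y) * y^(n+1) := by ring
    rw [e]
    calc _ ≤ ‖x‖ * ‖x^(n+1) - y^(n+1)‖ + ‖x-y‖ * ‖y‖^(n+1) := by
            refine (norm_add_le _ _).trans ?_
            rw [norm_mul, norm_mul, norm_pow]
      _ ≤ R * ((n+1) * R ^ n * ‖x - y‖) + ‖x-y‖ * R^(n+1) := by gcongr
      _ = _ := by push_cast; ring

lemma aux_F (a b d w : ℂ) (K R : ℝ) (L M N : ℕ) (ha : ‖a‖ ≤ K) (hb : ‖b‖ ≤ K) (hd : ‖d‖ ≤ K)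
    (hw : ‖w‖ ≤ R) (hR1 : R ≤ 1) (P : ℕ) (hL : P ≤ L) (hM : P ≤ M) (hN : P ≤ N) :
    ‖a * w ^ N + b * w ^ M + d * w ^ L‖ ≤ 3 * K * R ^ P := by
  have hR : 0 ≤ R := (norm_nonneg w).trans hw
  have hK : 0 ≤ K := (norm_nonneg a).trans ha
  have key : ∀ (x : ℂ) (n : ℕ), ‖x‖ ≤ K → P ≤ n → ‖x * w ^ n‖ ≤ K * R ^ P := by
    intro x n hx hn
    rw [norm_mul, norm_pow]
    calc _ ≤ K * R ^ n := by gcongr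
      _ ≤ K * R ^ P := by
        gcongr K * ?_
        exact pow_le_pow_of_le_one hR hR1 hn
  have h1 := key a N ha hN
  have h2 := key b M hb hM
  have h3 := key d L hd hL
  have := norm_add₃_le (a := a * w ^ N) (b := b * w ^ M) (c := d * w ^ L)
  linarith

lemma aux_main (ω : ℝ) (hω : 0 < ω)
    (L M N : ℕ) (hL : 1 < L) (hLM : L < M) (hMN : M < N)
    (A B C : ℝ → ℂ) (hC : Continuous C) (K : ℝ) (hK : 0 < K)
    (kA : ∀ t ∈ Set.Icc 0 ω, ‖A t‖ ≤ K) (kB : ∀ t ∈ Set.Icc 0 ω, ‖B t‖ ≤ K)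
    (kC : ∀ t ∈ Set.Icc 0 ω, ‖C t‖ ≤ K)
    (c : ℂ) (hc : c ≠ 0) (hc1 : 2 * ‖c‖ ≤ 1) (hc2 : 12 * K * ω * ‖c‖ < 1)
    (z : ℝ → ℂ)
    (hs : IsSolution ω (fun t w => A t * w ^ N + B t * w ^ M + C t * w ^ L) z) (h0 : z 0 = c) :
    ‖z ω - c - c ^ L * (∫ t in (0:ℝ)..ω, C t)‖ ≤
      ((2 * K + K * L * (3 * K * ω)) * ω * 2 ^ (L+1)) * ‖c‖ ^ (L+1) := by
  have hr : 0 < ‖c‖ := norm_pos_iff.mpr hc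
  have hcont : ContinuousOn z (Set.Icc 0 ω) := fun t ht => (hs t ht).continuousAt.continuousWithinAt
  set R := 2 * ‖c‖ with hRdef
  have hR0 : 0 ≤ R := by positivity
  have bd : ∀ t ∈ Set.Icc 0 ω, ‖z t‖ ≤ ‖c‖ + ‖c‖ / ω * t := by
    intro t ht
    refine image_norm_le_of_norm_deriv_right_lt_deriv_boundary' (a := 0) (b := ω)
      (f' := fun t => A t * z t ^ N + B t * z t ^ M + C t * z t ^ L)
      (B := fun t => ‖c‖ + ‖c‖ / ω * t) (B' := fun _ => ‖c‖ / ω)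
      hcont ?_ ?_ ?_ ?_ ?_ ht
    · intro x hx
      exact (hs x ⟨hx.1, hx.2.le⟩).hasDerivWithinAt
    · simp [h0]
    · fun_prop
    · intro x hx
      have := ((hasDerivAt_id x).const_mul (‖c‖ / ω)).const_add ‖c‖
      simpa using this.hasDerivWithinAt
    · intro x hx he
      have hx' : x ∈ Set.Icc 0 ω := ⟨hx.1, hx.2.le⟩
      have hz : ‖z x‖ ≤ R := by
        rw [he]
        have : ‖c‖ / ω * x ≤ ‖c‖ / ω * ω := by gcongr; exact hx.2.le
        rw [div_mul_cancel₀ _ hω.ne'] at this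
        linarith
      refine (aux_F _ _ _ _ K R L M N (kA x hx') (kB x hx') (kC x hx') hz hc1 2
        (by omega) (by omega) (by omega)).trans_lt ?_
      rw [lt_div_iff₀ hω, hRdef]
      nlinarith
  have bd2 : ∀ t ∈ Set.Icc 0 ω, ‖z t‖ ≤ R := by
    intro t ht
    refine (bd t ht).trans ?_
    have : ‖c‖ / ω * t ≤ ‖c‖ / ω * ω := by gcongr; exact ht.2
    rw [div_mul_cancel₀ _ hω.ne'] at this
    linarith
  have bd3 : ∀ t ∈ Set.Icc 0 ω, ‖z t - c‖ ≤ 3 * K * R ^ L * ω := by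
    intro t ht
    have := norm_image_sub_le_of_norm_deriv_le_segment' (f := z) (a := 0) (b := ω)
      (C := 3 * K * R ^ L)
      (fun x hx => (hs x hx).hasDerivWithinAt)
      (fun x hx => aux_F _ _ _ _ K R L M N (kA x ⟨hx.1, hx.2.le⟩) (kB x ⟨hx.1, hx.2.le⟩)
        (kC x ⟨hx.1, hx.2.le⟩) (bd2 x ⟨hx.1, hx.2.le⟩) hc1 L
        (by omega) (by omega) (by omega)) t ht
    rw [h0, sub_zero] at this
    refine this.trans ?_
    gcongr
    exact ht.2
  have hΓ : ∀ x : ℝ, HasDerivAt (fun t => ∫ s in (0:ℝ)..t, C s) (C x) x := fun x =>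
    intervalIntegral.integral_hasDerivAt_right (hC.intervalIntegrable _ _)
      hC.stronglyMeasurable.stronglyMeasurableAtFilter hC.continuousAt
  have fin := norm_image_sub_le_of_norm_deriv_le_segment'
      (f := fun t => z t - c ^ L * ∫ s in (0:ℝ)..t, C s) (a := 0) (b := ω)
      (C := (2 * K + K * L * (3 * K * ω)) * R ^ (L+1))
      (fun x hx => ((hs x hx).sub ((hΓ x).const_mul (c ^ L))).hasDerivWithinAt) ?_ ω
      ⟨hω.le, le_rfl⟩
  · simp only [intervalIntegral.integral_same, mul_zero, sub_zero, h0] at fin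
    calc _ = ‖z ω - c ^ L * (∫ t in (0:ℝ)..ω, C t) - c‖ := by congr 1; ring
      _ ≤ _ := fin
      _ = _ := by rw [hRdef, mul_pow]; ring
  · intro x hx
    have hx' : x ∈ Set.Icc 0 ω := ⟨hx.1, hx.2.le⟩
    obtain ⟨l, rfl⟩ : ∃ l, L = l + 1 := ⟨L - 1, by omega⟩
    have e : A x * z x ^ N + B x * z x ^ M + C x * z x ^ (l+1) - c ^ (l+1) * C x
      = A x * z x ^ N + B x * z x ^ M + C x * (z x ^ (l+1) - c ^ (l+1)) := by ring
    show ‖A x * z x ^ N + B x * z x ^ M + C x * z x ^ (l+1) - c ^ (l+1) * C x‖ ≤ _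
    rw [e]
    have key : ∀ (y : ℂ) (n : ℕ), ‖y‖ ≤ K → l+1+1 ≤ n → ‖y * z x ^ n‖ ≤ K * R ^ (l+1+1) := by
      intro y n hy hn
      rw [norm_mul, norm_pow]
      calc _ ≤ K * R ^ n := by gcongr; exact bd2 x hx'
        _ ≤ _ := by
          gcongr K * ?_
          exact pow_le_pow_of_le_one hR0 hc1 hn
    have h1 := key (A x) N (kA x hx') (by omega)
    have h2 := key (B x) M (kB x hx') (by omega)
    have h3 : ‖C x * (z x ^ (l+1) - c ^ (l+1))‖ ≤
        K * ((l+1 : ℕ) : ℝ) * (3 * K * ω) * R ^ (l+1+1) := by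
      rw [norm_mul]
      calc _ ≤ K * ((l+1) * R ^ l * (3 * K * R ^ (l+1) * ω)) := by
            gcongr
            · exact kC x hx'
            · refine (aux_pow l _ _ R (bd2 x hx') (by linarith)).trans ?_
              gcongr
              exact bd3 x hx'
        _ = K * (l+1) * (3 * K * ω) * R ^ (l + (l+1)) := by ring
        _ ≤ K * (l+1) * (3 * K * ω) * R ^ (l+1+1) := by
            gcongr _ * ?_
            exact pow_le_pow_of_le_one hR0 hc1 (by omega)
        _ = _ := by push_cast; ring
    have := norm_add₃_le (a := A x * z x ^ N) (b := B x * z x ^ M)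
      (c := C x * (z x ^ (l+1) - c ^ (l+1)))
    linarith

open Filter Topology in
lemma aux_order (q : ℂ → ℂ) (hqa : AnalyticAt ℂ q 0) (L : ℕ) (lam : ℂ)
    (h : Tendsto (fun c => q c / c ^ L) (𝓝[≠] 0) (𝓝 lam)) :
    HasZeroOfOrderExactly q L ↔ lam ≠ 0 := by
  have tp : ∀ n : ℕ, n ≠ 0 → Tendsto (fun c : ℂ => c ^ n) (𝓝[≠] 0) (𝓝 0) := by
    intro n hn
    have : Tendsto (fun c : ℂ => c ^ n) (𝓝 0) (𝓝 (0 ^ n)) := (continuous_pow n).tendsto 0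
    rw [zero_pow hn] at this
    exact this.mono_left nhdsWithin_le_nhds
  have tg : ∀ g : ℂ → ℂ, AnalyticAt ℂ g 0 → Tendsto g (𝓝[≠] 0) (𝓝 (g 0)) :=
    fun g hg => hg.continuousAt.tendsto.mono_left nhdsWithin_le_nhds
  constructor
  · rintro ⟨g, hg, hg0, he⟩
    have h2 : Tendsto (fun c => q c / c ^ L) (𝓝[≠] 0) (𝓝 (g 0)) := by
      refine (tg g hg).congr' ?_
      filter_upwards [he.filter_mono nhdsWithin_le_nhds, self_mem_nhdsWithin] with c hc hc0
      have : c ≠ 0 := hc0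
      rw [hc]; field_simp
    rw [tendsto_nhds_unique h h2]; exact hg0
  · intro hl
    by_cases ht : ∀ᶠ c in 𝓝 (0:ℂ), q c = 0
    · exfalso
      apply hl
      refine tendsto_nhds_unique h (tendsto_const_nhds.congr' ?_)
      filter_upwards [ht.filter_mono nhdsWithin_le_nhds] with c hc
      simp [hc]
    · obtain ⟨n, g, hg, hg0, he⟩ := hqa.exists_eventuallyEq_pow_smul_nonzero_iff.mpr ht
      simp only [sub_zero, smul_eq_mul] at he
      rcases lt_trichotomy n L with hn | hn | hn
      · exfalso
        apply hg0
        have h2 : Tendsto g (𝓝[≠] 0) (𝓝 (lam * 0)) := by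
          refine (h.mul (tp (L - n) (by omega))).congr' ?_
          filter_upwards [he.filter_mono nhdsWithin_le_nhds, self_mem_nhdsWithin] with c hc hc0
          have : c ≠ 0 := hc0
          obtain ⟨k, rfl⟩ := Nat.exists_eq_add_of_lt hn
          rw [hc, show n + k + 1 - n = k + 1 by omega]; field_simp; ring
        simpa using tendsto_nhds_unique (tg g hg) h2
      · subst hn; exact ⟨g, hg, hg0, he⟩
      · exfalso
        apply hl
        have h2 : Tendsto (fun c => q c / c ^ L) (𝓝[≠] 0) (𝓝 (0 * g 0)) := by
          refine ((tp (n - L) (by omega)).mul (tg g hg)).congr' ?_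
          filter_upwards [he.filter_mono nhdsWithin_le_nhds, self_mem_nhdsWithin] with c hc hc0
          have : c ≠ 0 := hc0
          obtain ⟨k, rfl⟩ := Nat.exists_eq_add_of_lt hn
          rw [hc, show L + k + 1 - L = k + 1 by omega]; field_simp; ring
        simpa using tendsto_nhds_unique h h2

theorem stmt_4 (ω : ℝ) (hω : 0 < ω)
    (L M N : ℕ) (hL : 1 < L) (hLM : L < M) (hMN : M < N) (hN : N = L + M - 1)
    (A B C : ℝ → ℂ) (hA : Continuous A) (hB : Continuous B) (hC : Continuous C)
    (z : ℂ → ℝ → ℂ) (ε : ℝ) (hε : 0 < ε)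
    (hsol : ∀ c : ℂ, ‖c‖ < ε →
      IsSolution ω (fun t w => A t * w ^ N + B t * w ^ M + C t * w ^ L) (z c) ∧ z c 0 = c)
    (q : ℂ → ℂ) (hq : ∀ c : ℂ, q c = z c ω - c)
    (hqa : AnalyticAt ℂ q 0) :
    HasZeroOfOrderExactly q L ↔ (∫ t in (0:ℝ)..ω, C t) ≠ 0 := by
  obtain ⟨KA, hKA⟩ := isCompact_Icc.exists_bound_of_continuousOn (s := Set.Icc 0 ω) hA.continuousOn
  obtain ⟨KB, hKB⟩ := isCompact_Icc.exists_bound_of_continuousOn (s := Set.Icc 0 ω) hB.continuousOn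
  obtain ⟨KC, hKC⟩ := isCompact_Icc.exists_bound_of_continuousOn (s := Set.Icc 0 ω) hC.continuousOn
  obtain ⟨K, hK0, hK1, hK2, hK3⟩ : ∃ K : ℝ, 0 < K ∧ KA ≤ K ∧ KB ≤ K ∧ KC ≤ K :=
    ⟨|KA| + |KB| + |KC| + 1, by positivity,
      by linarith [le_abs_self KA, abs_nonneg KB, abs_nonneg KC],
      by linarith [le_abs_self KB, abs_nonneg KA, abs_nonneg KC],
      by linarith [le_abs_self KC, abs_nonneg KB, abs_nonneg KA]⟩
  apply aux_order q hqa
  rw [tendsto_iff_norm_sub_tendsto_zero]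
  have tn : ∀ D : ℝ, Filter.Tendsto (fun c : ℂ => D * ‖c‖) (nhdsWithin 0 {0}ᶜ) (nhds 0) := by
    intro D
    have : Filter.Tendsto (fun c : ℂ => D * ‖c‖) (nhds 0) (nhds (D * ‖(0:ℂ)‖)) :=
      (by fun_prop : Continuous (fun c : ℂ => D * ‖c‖)).tendsto 0
    rw [norm_zero, mul_zero] at this
    exact this.mono_left nhdsWithin_le_nhds
  refine squeeze_zero' (Filter.Eventually.of_forall fun _ => norm_nonneg _) ?_
    (tn ((2 * K + K * L * (3 * K * ω)) * ω * 2 ^ (L+1)))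
  filter_upwards [(tn 1).eventually_lt_const hε, (tn 2).eventually_lt_const one_pos,
    (tn (12 * K * ω)).eventually_lt_const one_pos, self_mem_nhdsWithin] with c h1 h2 h3 h4
  have hc : c ≠ 0 := h4
  rw [one_mul] at h1
  obtain ⟨hs, h0⟩ := hsol c h1
  have := aux_main ω hω L M N hL hLM hMN A B C hC K hK0 (fun t ht => (hKA t ht).trans hK1)
    (fun t ht => (hKB t ht).trans hK2) (fun t ht => (hKC t ht).trans hK3) c hc h2.le h3 (z c) hs h0
  rw [← hq c] at this
  have hp : 0 < ‖c‖ ^ L := by positivity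
  have e : q c / c ^ L - (∫ t in (0:ℝ)..ω, C t) =
      (q c - c ^ L * ∫ t in (0:ℝ)..ω, C t) / c ^ L := by field_simp
  rw [e, norm_div, norm_pow, div_le_iff₀ hp]
  calc _ ≤ _ := this
    _ = _ := by ring
end

section
/- Let ω > 0, let L, M, N be integers with 1 < L < M < N = L + M − 1, and let A, B, C : ℝ → ℂ be continuous. Set λ₁ = ∫₀^ω C(t) dt, λ₂ = ∫₀^ω B(t) dt, and λ₃ = ∫₀^ω [A(t) + (M−L)·B(t)·(∫₀^t C(s) ds)] dt. Suppose z : ℂ → ℝ → ℂ is a family such that for some ε > 0 and every c with |c| < ε, t ↦ z(c,t) is a solution of ż = A(t)z^N + B(t)z^M + C(t)z^L on [0,ω] with z(c,0) = c, and suppose the displacement map q(c) = z(c,ω) − c is analytic at c = 0. Then q has a zero of order exactly M at c = 0 if and only if λ₁ = 0 and λ₂ ≠ 0; and q has a zero of order exactly N at c = 0 if and only if λ₁ = λ₂ = 0 and λ₃ ≠ 0. -/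
open Filter Topology in
lemma zero_cmp {q : ℂ → ℂ} {n k : ℕ} {l : ℂ} (h : HasZeroOfOrderExactly q n)
    (hl : Tendsto (fun c => q c / c ^ k) (𝓝[≠] 0) (𝓝 l)) : l ≠ 0 ↔ n = k := by
  obtain ⟨g, hg, hg0, hq⟩ := h
  have hgt : Tendsto g (𝓝[≠] 0) (𝓝 (g 0)) := hg.continuousAt.tendsto.mono_left nhdsWithin_le_nhds
  have hq' : ∀ᶠ c in 𝓝[≠] (0:ℂ), q c = c ^ n * g c := hq.filter_mono nhdsWithin_le_nhds
  have hne : ∀ᶠ c in 𝓝[≠] (0:ℂ), c ≠ 0 := eventually_mem_nhdsWithin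
  have hid : Tendsto (fun c : ℂ => c) (𝓝[≠] 0) (𝓝 0) := tendsto_id.mono_left nhdsWithin_le_nhds
  have hpow : ∀ d : ℕ, 0 < d → Tendsto (fun c : ℂ => c ^ d) (𝓝[≠] 0) (𝓝 0) := by
    intro d hd
    have := hid.pow d
    rwa [zero_pow hd.ne'] at this
  rcases lt_trichotomy n k with hnk | hnk | hnk
  · exfalso
    obtain ⟨d, rfl⟩ := Nat.exists_eq_add_of_lt hnk
    have h1 : Tendsto g (𝓝[≠] 0) (𝓝 (l * 0)) := by
      refine (hl.mul (hpow (d+1) (by omega))).congr' ?_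
      filter_upwards [hq', hne] with c h1 h2
      rw [h1]; field_simp; ring
    rw [mul_zero] at h1
    exact hg0 (tendsto_nhds_unique hgt h1)
  · subst hnk
    have h1 : Tendsto g (𝓝[≠] 0) (𝓝 l) := by
      refine hl.congr' ?_
      filter_upwards [hq', hne] with c h1 h2
      rw [h1]; field_simp
    rw [← tendsto_nhds_unique hgt h1]
    simp [hg0]
  · obtain ⟨d, rfl⟩ := Nat.exists_eq_add_of_lt hnk
    have h1 : Tendsto (fun c => q c / c ^ k) (𝓝[≠] 0) (𝓝 (0 * g 0)) := by
      refine ((hpow (d+1) (by omega)).mul hgt).congr' ?_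
      filter_upwards [hq', hne] with c h1 h2
      rw [h1]; field_simp; ring
    rw [tendsto_nhds_unique hl h1]
    simp; omega

open Filter Topology in
lemma zero_of_lim {q : ℂ → ℂ} {k : ℕ} {l : ℂ} (hqa : AnalyticAt ℂ q 0) (h0 : l ≠ 0)
    (hl : Tendsto (fun c => q c / c ^ k) (𝓝[≠] 0) (𝓝 l)) : HasZeroOfOrderExactly q k := by
  have hn : ¬ ∀ᶠ c in 𝓝 (0:ℂ), q c = 0 := by
    intro h
    have h1 : Tendsto (fun c => q c / c ^ k) (𝓝[≠] 0) (𝓝 0) := by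
      refine tendsto_const_nhds.congr' ?_
      filter_upwards [h.filter_mono nhdsWithin_le_nhds] with c hc
      simp [hc]
    exact h0 (tendsto_nhds_unique hl h1)
  obtain ⟨n, g, hg, hg0, hq⟩ := hqa.exists_eventuallyEq_pow_smul_nonzero_iff.2 hn
  have hz : HasZeroOfOrderExactly q n := ⟨g, hg, hg0, by simpa using hq⟩
  have := (zero_cmp hz hl).1 h0
  rwa [← this]

lemma apriori (ω : ℝ) (hω : 0 < ω)
    (L M N : ℕ) (hL : 1 < L) (hLM : L < M) (hMN : M < N)
    (A B C : ℝ → ℂ) (hA : Continuous A) (hB : Continuous B) (hC : Continuous C)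
    (z : ℂ → ℝ → ℂ) (ε : ℝ) (hε : 0 < ε)
    (hsol : ∀ c : ℂ, ‖c‖ < ε →
      IsSolution ω (fun t w => A t * w ^ N + B t * w ^ M + C t * w ^ L) (z c) ∧ z c 0 = c) :
    ∃ K > 0, ∃ δ > 0, ∀ c : ℂ, c ≠ 0 → ‖c‖ < δ → ‖c‖ < ε ∧ ∀ t ∈ Set.Icc 0 ω,
      ‖z c t‖ ≤ 2 * ‖c‖ ∧ ‖z c t - c‖ ≤ K * ‖c‖ ^ L := by
  obtain ⟨K0, hK0⟩ : ∃ K0, ∀ t ∈ Set.Icc 0 ω, ‖‖A t‖ + ‖B t‖ + ‖C t‖‖ ≤ K0 :=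
    isCompact_Icc.exists_bound_of_continuousOn
      (by fun_prop : Continuous fun t => ‖A t‖ + ‖B t‖ + ‖C t‖).continuousOn
  have hK00 : 0 ≤ K0 := (norm_nonneg _).trans (hK0 0 ⟨le_rfl, hω.le⟩)
  have hF : ∀ t ∈ Set.Icc 0 ω, ∀ w : ℂ, ‖w‖ ≤ 1 →
      ‖A t * w ^ N + B t * w ^ M + C t * w ^ L‖ ≤ K0 * ‖w‖ ^ L := by
    intro t ht w hw
    have h1 : ‖w‖ ^ N ≤ ‖w‖ ^ L := pow_le_pow_of_le_one (norm_nonneg _) hw (by omega)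
    have h2 : ‖w‖ ^ M ≤ ‖w‖ ^ L := pow_le_pow_of_le_one (norm_nonneg _) hw (by omega)
    have h3 := (le_abs_self _).trans (hK0 t ht)
    calc _ ≤ ‖A t * w ^ N‖ + ‖B t * w ^ M‖ + ‖C t * w ^ L‖ := norm_add₃_le
      _ = ‖A t‖ * ‖w‖ ^ N + ‖B t‖ * ‖w‖ ^ M + ‖C t‖ * ‖w‖ ^ L := by simp [norm_pow]
      _ ≤ ‖A t‖ * ‖w‖ ^ L + ‖B t‖ * ‖w‖ ^ L + ‖C t‖ * ‖w‖ ^ L := by gcongr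
      _ = (‖A t‖ + ‖B t‖ + ‖C t‖) * ‖w‖ ^ L := by ring
      _ ≤ K0 * ‖w‖ ^ L := by gcongr
  refine ⟨K0 * 2 ^ L * ω + 1, by positivity, min ε (min (1/2) (1 / (4 * K0 * ω + 1))),
    by positivity, ?_⟩
  intro c hc hcδ
  simp only [lt_min_iff] at hcδ
  obtain ⟨h1, h2, h3⟩ := hcδ
  have hcp : 0 < ‖c‖ := norm_pos_iff.2 hc
  rw [lt_div_iff₀ (by positivity)] at h3
  obtain ⟨hs, h0⟩ := hsol c h1
  have hz2 : ∀ t ∈ Set.Icc 0 ω, ‖z c t‖ ≤ ‖c‖ * (1 + t / ω) := by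
    intro t ht
    refine image_norm_le_of_norm_deriv_right_lt_deriv_boundary (a := 0) (b := ω) (f := z c)
      (f' := fun t => A t * z c t ^ N + B t * z c t ^ M + C t * z c t ^ L)
      (B := fun t => ‖c‖ * (1 + t / ω)) (B' := fun _ => ‖c‖ * (1 / ω))
      (fun x hx => (hs x hx).continuousAt.continuousWithinAt)
      (fun x hx => (hs x ⟨hx.1, hx.2.le⟩).hasDerivWithinAt) (by simp [h0]) ?_ ?_ ht
    · intro x
      exact (((hasDerivAt_id x).div_const ω).const_add 1).const_mul ‖c‖
    · intro x hx hxe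
      have hx1 : x / ω ≤ 1 := by rw [div_le_one hω]; exact hx.2.le
      have hle : ‖z c x‖ ≤ 2 * ‖c‖ := by rw [hxe]; nlinarith
      have hle1 : ‖z c x‖ ≤ 1 := by linarith
      calc _ ≤ K0 * ‖z c x‖ ^ L := hF x ⟨hx.1, hx.2.le⟩ _ hle1
        _ ≤ K0 * ‖z c x‖ ^ 2 := by
          gcongr K0 * ?_
          exact pow_le_pow_of_le_one (norm_nonneg _) hle1 (by omega)
        _ ≤ K0 * (2 * ‖c‖) ^ 2 := by gcongr
        _ < ‖c‖ * (1 / ω) := by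
          rw [mul_one_div, lt_div_iff₀ hω]
          nlinarith
  have hz3 : ∀ t ∈ Set.Icc 0 ω, ‖z c t‖ ≤ 2 * ‖c‖ := by
    intro t ht
    have hx1 : t / ω ≤ 1 := by rw [div_le_one hω]; exact ht.2
    have := hz2 t ht
    nlinarith
  refine ⟨h1, fun t ht => ⟨hz3 t ht, ?_⟩⟩
  have := norm_image_sub_le_of_norm_deriv_le_segment' (a := 0) (b := ω) (f := z c)
    (f' := fun t => A t * z c t ^ N + B t * z c t ^ M + C t * z c t ^ L) (C := K0 * (2 * ‖c‖) ^ L)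
    (fun x hx => (hs x hx).hasDerivWithinAt) (fun x hx => ?_) t ht
  · rw [h0] at this
    refine this.trans ?_
    have h4 := ht.2
    have h5 := ht.1
    calc K0 * (2 * ‖c‖) ^ L * (t - 0) ≤ K0 * (2 * ‖c‖) ^ L * ω := by gcongr; linarith
      _ = (K0 * 2 ^ L * ω) * ‖c‖ ^ L := by rw [mul_pow]; ring
      _ ≤ _ := by gcongr; linarith
  · have hx' : x ∈ Set.Icc 0 ω := ⟨hx.1, hx.2.le⟩
    refine (hF x hx' _ ?_).trans ?_
    · have := hz3 x hx'; linarith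
    · gcongr; exact hz3 x hx'

lemma yfacts (ω : ℝ) (hω : 0 < ω) (p m : ℕ) (hp : 0 < p) (hm : 0 < m)
    (A B C : ℝ → ℂ) (hA : Continuous A) (hB : Continuous B) (hC : Continuous C)
    (z : ℂ → ℝ → ℂ) (ε : ℝ) (hε : 0 < ε)
    (hsol : ∀ c : ℂ, ‖c‖ < ε →
      IsSolution ω (fun t w => A t * w ^ (2*p+m+1) + B t * w ^ (p+m+1) + C t * w ^ (p+1)) (z c)
        ∧ z c 0 = c) :
    ∃ K : ℝ, ∀ᶠ c in nhdsWithin (0:ℂ) {0}ᶜ, c ≠ 0 ∧ z c 0 / c = 1 ∧ ∀ t ∈ Set.Icc 0 ω,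
      ‖z c t / c‖ ≤ 2 ∧ ‖z c t / c - 1‖ ≤ K * ‖c‖ ^ p ∧ z c t / c ≠ 0 ∧
      HasDerivAt (fun t => z c t / c) (c ^ p * (A t * c ^ (p+m) * (z c t / c) ^ (2*p+m+1)
        + B t * c ^ m * (z c t / c) ^ (p+m+1) + C t * (z c t / c) ^ (p+1))) t := by
  obtain ⟨K, hK, δ, hδ, h⟩ := apriori ω hω (p+1) (p+m+1) (2*p+m+1) (by omega) (by omega)
    (by omega) A B C hA hB hC z ε hε hsol
  refine ⟨K, ?_⟩
  have hne : ∀ᶠ c in nhdsWithin (0:ℂ) {0}ᶜ, c ≠ 0 := eventually_mem_nhdsWithin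
  have hball : ∀ᶠ c in nhdsWithin (0:ℂ) {0}ᶜ, c ∈ Metric.ball (0:ℂ) (min δ (min 1 (1 / (K+1)))) :=
    nhdsWithin_le_nhds (Metric.ball_mem_nhds _ (by positivity))
  filter_upwards [hne, hball] with c hc hb
  simp only [Metric.mem_ball, dist_zero_right, lt_min_iff] at hb
  obtain ⟨hb1, hb2, hb3⟩ := hb
  rw [lt_div_iff₀ (by positivity)] at hb3
  obtain ⟨h1, h2⟩ := h c hc hb1
  obtain ⟨hs, h0⟩ := hsol c h1
  have hcp : 0 < ‖c‖ := norm_pos_iff.2 hc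
  refine ⟨hc, by rw [h0]; field_simp, fun t ht => ?_⟩
  obtain ⟨h3, h4⟩ := h2 t ht
  have h5 : ‖z c t / c - 1‖ ≤ K * ‖c‖ ^ p := by
    have : z c t / c - 1 = (z c t - c) / c := by field_simp
    rw [this, norm_div, div_le_iff₀ hcp]
    refine h4.trans (le_of_eq (by ring))
  refine ⟨?_, h5, ?_, ?_⟩
  · rw [norm_div, div_le_iff₀ hcp]; exact h3
  · intro h6
    rw [h6] at h5
    simp only [zero_sub, norm_neg, norm_one] at h5
    have : ‖c‖ ^ p ≤ ‖c‖ ^ 1 := pow_le_pow_of_le_one hcp.le hb2.le (by omega)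
    nlinarith
  · refine ((hs t ht).div_const c).congr_deriv ?_
    obtain ⟨w, hw⟩ : ∃ w, z c t = c * w := ⟨z c t / c, by field_simp⟩
    have hw' : z c t / c = w := by rw [hw]; field_simp
    rw [hw', div_eq_iff hc, hw]
    ring

set_option maxHeartbeats 1000000 in
open Filter Topology in
lemma limits (ω : ℝ) (hω : 0 < ω) (p m : ℕ) (hp : 0 < p) (hm : 0 < m)
    (A B C : ℝ → ℂ) (hA : Continuous A) (hB : Continuous B) (hC : Continuous C)
    (y : ℂ → ℝ → ℂ) (K : ℝ)
    (hy : ∀ᶠ c in 𝓝[≠] (0:ℂ), c ≠ 0 ∧ y c 0 = 1 ∧ ∀ t ∈ Set.Icc 0 ω,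
      ‖y c t‖ ≤ 2 ∧ ‖y c t - 1‖ ≤ K * ‖c‖ ^ p ∧ y c t ≠ 0 ∧
      HasDerivAt (y c) (c ^ p * (A t * c ^ (p+m) * (y c t) ^ (2*p+m+1)
        + B t * c ^ m * (y c t) ^ (p+m+1) + C t * (y c t) ^ (p+1))) t)
    (q : ℂ → ℂ) (hq : ∀ c, c ≠ 0 → q c = c * (y c ω - 1)) :
    Tendsto (fun c => q c / c ^ (p+1)) (𝓝[≠] 0) (𝓝 (∫ t in (0:ℝ)..ω, C t)) ∧
    ((∫ t in (0:ℝ)..ω, C t) = 0 →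
      Tendsto (fun c => q c / c ^ (p+m+1)) (𝓝[≠] 0) (𝓝 (∫ t in (0:ℝ)..ω, B t))) ∧
    ((∫ t in (0:ℝ)..ω, C t) = 0 → (∫ t in (0:ℝ)..ω, B t) = 0 →
      Tendsto (fun c => q c / c ^ (2*p+m+1)) (𝓝[≠] 0)
        (𝓝 (∫ t in (0:ℝ)..ω, (A t + (m:ℂ) * B t * ∫ s in (0:ℝ)..t, C s)))) := by
  have hne : ∀ᶠ c in 𝓝[≠] (0:ℂ), c ≠ 0 := eventually_mem_nhdsWithin
  have hid : Tendsto (fun c : ℂ => c) (𝓝[≠] 0) (𝓝 0) := tendsto_id.mono_left nhdsWithin_le_nhds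
  have hpow : ∀ d : ℕ, 0 < d → Tendsto (fun c : ℂ => c ^ d) (𝓝[≠] 0) (𝓝 0) := by
    intro d hd
    have := hid.pow d
    rwa [zero_pow hd.ne'] at this
  have hpB : ∀ᶠ c in 𝓝[≠] (0:ℂ), ‖c‖ ≤ 1 := by
    have : ∀ᶠ c in 𝓝[≠] (0:ℂ), c ∈ Metric.closedBall (0:ℂ) 1 :=
      nhdsWithin_le_nhds (Metric.closedBall_mem_nhds _ one_pos)
    simpa using this
  have hycont : ∀ᶠ c in 𝓝[≠] (0:ℂ), ContinuousOn (y c) (Set.Icc 0 ω) := by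
    filter_upwards [hy] with c hc t ht
    exact (hc.2.2 t ht).2.2.2.continuousAt.continuousWithinAt
  have hylim : ∀ t ∈ Set.Icc 0 ω, Tendsto (fun c => y c t) (𝓝[≠] 0) (𝓝 1) := by
    intro t ht
    rw [tendsto_iff_norm_sub_tendsto_zero]
    have h1 : Tendsto (fun c : ℂ => K * ‖c ^ p‖) (𝓝[≠] 0) (𝓝 0) := by
      simpa using ((hpow p hp).norm).const_mul K
    refine squeeze_zero' (Eventually.of_forall fun _ => norm_nonneg _) ?_ h1
    filter_upwards [hy] with c hc
    rw [norm_pow]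
    exact (hc.2.2 t ht).2.1
  -- dominated convergence
  have hdom : ∀ (t : ℝ), t ∈ Set.Icc 0 ω → ∀ (F : ℂ → ℝ → ℂ) (f : ℝ → ℂ) (b : ℝ → ℝ),
      Continuous b → (∀ᶠ c in 𝓝[≠] (0:ℂ), ContinuousOn (F c) (Set.Icc 0 ω)) →
      (∀ᶠ c in 𝓝[≠] (0:ℂ), ∀ s ∈ Set.Icc 0 ω, ‖F c s‖ ≤ b s) →
      (∀ s ∈ Set.Icc 0 ω, Tendsto (fun c => F c s) (𝓝[≠] 0) (𝓝 (f s))) →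
      Tendsto (fun c => ∫ s in (0:ℝ)..t, F c s) (𝓝[≠] 0) (𝓝 (∫ s in (0:ℝ)..t, f s)) := by
    intro t ht F f b hb hFc hFb hFl
    have hsub : Set.uIoc 0 t ⊆ Set.Icc 0 ω := by
      rw [Set.uIoc_of_le ht.1]
      exact fun s hs => ⟨hs.1.le, hs.2.trans ht.2⟩
    refine intervalIntegral.tendsto_integral_filter_of_dominated_convergence b ?_ ?_
      (hb.intervalIntegrable _ _) ?_
    · filter_upwards [hFc] with c hc
      exact (hc.mono hsub).aestronglyMeasurable measurableSet_uIoc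
    · filter_upwards [hFb] with c hc
      exact Eventually.of_forall fun s hs => hc s (hsub hs)
    · exact Eventually.of_forall fun s hs => hFl s (hsub hs)
  -- general integrals of G * y^k
  have hGy : ∀ (G : ℝ → ℂ), Continuous G → ∀ k : ℕ, ∀ t ∈ Set.Icc 0 ω,
      Tendsto (fun c => ∫ s in (0:ℝ)..t, G s * y c s ^ k) (𝓝[≠] 0)
        (𝓝 (∫ s in (0:ℝ)..t, G s)) := by
    intro G hG k t ht
    refine hdom t ht _ _ (fun s => ‖G s‖ * 2 ^ k) (by fun_prop) ?_ ?_ ?_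
    · filter_upwards [hycont] with c hc
      exact hG.continuousOn.mul (hc.pow k)
    · filter_upwards [hy] with c hc s hs
      rw [norm_mul, norm_pow]
      gcongr
      exact (hc.2.2 s hs).1
    · intro s hs
      simpa using ((hylim s hs).pow k).const_mul (G s)
  have hint : ∀ (G : ℝ → ℂ), Continuous G → ∀ k : ℕ, ∀ t ∈ Set.Icc 0 ω, ∀ c,
      ContinuousOn (y c) (Set.Icc 0 ω) →
      IntervalIntegrable (fun s => G s * y c s ^ k) MeasureTheory.volume 0 t := by
    intro G hG k t ht c hc
    apply ContinuousOn.intervalIntegrable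
    rw [Set.uIcc_of_le ht.1]
    exact (hG.continuousOn.mul (hc.pow k)).mono (Set.Icc_subset_Icc le_rfl ht.2)
  -- first-order expansion of y
  have hy1 : ∀ t ∈ Set.Icc 0 ω, Tendsto (fun c => (y c t - 1) / c ^ p) (𝓝[≠] 0)
      (𝓝 (∫ s in (0:ℝ)..t, C s)) := by
    intro t ht
    have h1 := (((hpow (p+m) (by omega)).mul (hGy A hA (2*p+m+1) t ht)).add
      ((hpow m hm).mul (hGy B hB (p+m+1) t ht))).add (hGy C hC (p+1) t ht)
    simp only [zero_mul, zero_add] at h1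
    refine h1.congr' ?_
    filter_upwards [hy, hycont] with c hc hcc
    have hft := intervalIntegral.integral_eq_sub_of_hasDerivAt (a := 0) (b := t) (f := y c)
      (f' := fun t => c ^ p * (c ^ (p+m) * (A t * (y c t) ^ (2*p+m+1))
        + c ^ m * (B t * (y c t) ^ (p+m+1)) + C t * (y c t) ^ (p+1))) (fun s hs => by
          rw [Set.uIcc_of_le ht.1] at hs
          refine (hc.2.2 s ⟨hs.1, hs.2.trans ht.2⟩).2.2.2.congr_deriv ?_
          ring)
        (((((hint A hA _ t ht c hcc).const_mul _).add ((hint B hB _ t ht c hcc).const_mul _)).add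
          (hint C hC _ t ht c hcc)).const_mul _)
    rw [hc.2.1] at hft
    rw [← hft, intervalIntegral.integral_const_mul, intervalIntegral.integral_add
      (((hint A hA _ t ht c hcc).const_mul _).add ((hint B hB _ t ht c hcc).const_mul _))
          (hint C hC _ t ht c hcc), intervalIntegral.integral_add
      ((hint A hA _ t ht c hcc).const_mul _) ((hint B hB _ t ht c hcc).const_mul _),
      intervalIntegral.integral_const_mul, intervalIntegral.integral_const_mul]
    have := hc.1
    field_simp
  have hω' : ω ∈ Set.Icc 0 ω := ⟨hω.le, le_rfl⟩
  -- exact identity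
  set I : ℂ → ℂ := fun c => (∫ t in (0:ℝ)..ω, C t) + c ^ m * (∫ t in (0:ℝ)..ω, B t * y c t ^ m)
    + c ^ (p+m) * (∫ t in (0:ℝ)..ω, A t * y c t ^ (p+m)) with hI
  set h : ℂ → ℂ := fun c => (p : ℂ) * y c ω ^ p / ∑ i ∈ Finset.range p, y c ω ^ i with hh
  have hp0 : (p:ℂ) ≠ 0 := by exact_mod_cast hp.ne'
  have hsl : Tendsto (fun c => ∑ i ∈ Finset.range p, y c ω ^ i) (𝓝[≠] 0) (𝓝 (p:ℂ)) := by
    have := tendsto_finsetSum (Finset.range p) (fun i _ => (hylim ω hω').pow i)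
    simpa using this
  have hhl : Tendsto h (𝓝[≠] 0) (𝓝 1) := by
    have := (((hylim ω hω').pow p).const_mul (p:ℂ)).div hsl hp0
    rw [one_pow, mul_one, div_self hp0] at this
    exact this
  have hident : ∀ᶠ c in 𝓝[≠] (0:ℂ), q c = c ^ (p+1) * I c * h c := by
    filter_upwards [hy, hycont, hsl.eventually_ne hp0] with c hc hcc hs0
    have hd : ∀ t ∈ Set.uIcc 0 ω, HasDerivAt (fun t => (y c t ^ p)⁻¹)
        (-(p:ℂ) * c ^ p * (C t * y c t ^ 0 + c ^ m * (B t * y c t ^ m)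
          + c ^ (p+m) * (A t * y c t ^ (p+m)))) t := by
      intro t ht
      rw [Set.uIcc_of_le hω.le] at ht
      obtain ⟨-, -, h0, hd⟩ := hc.2.2 t ht
      refine ((hd.pow p).inv (pow_ne_zero p h0)).congr_deriv ?_
      obtain ⟨r, rfl⟩ : ∃ r, p = r + 1 := ⟨p - 1, by omega⟩
      simp only [Nat.add_sub_cancel, Pi.pow_apply]
      field_simp
      ring
    have i1 := hint C hC 0 ω hω' c hcc
    have i2 := (hint B hB m ω hω' c hcc).const_mul (c ^ m)
    have i3 := (hint A hA (p+m) ω hω' c hcc).const_mul (c ^ (p+m))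
    have hft := intervalIntegral.integral_eq_sub_of_hasDerivAt hd
      (((i1.add i2).add i3).const_mul _)
    rw [intervalIntegral.integral_const_mul, intervalIntegral.integral_add (i1.add i2) i3,
      intervalIntegral.integral_add i1 i2,
      intervalIntegral.integral_const_mul, intervalIntegral.integral_const_mul] at hft
    simp only [pow_zero, mul_one, hc.2.1, one_pow, inv_one] at hft
    have hft' : -(p:ℂ) * c ^ p * I c = (y c ω ^ p)⁻¹ - 1 := hft
    have h0 := (hc.2.2 ω hω').2.2.1
    have hg := geom_sum_mul (y c ω) p
    have e : (p:ℂ) * y c ω ^ p * (c ^ p * I c) = y c ω ^ p - 1 := by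
      have : (y c ω ^ p) * (y c ω ^ p)⁻¹ = 1 := mul_inv_cancel₀ (pow_ne_zero _ h0)
      linear_combination (-(y c ω ^ p)) * hft' - this
    rw [hq c hc.1, hh]
    field_simp
    rw [← sub_eq_zero]
    linear_combination c * hg - c * e
  refine ⟨?_, ?_, ?_⟩
  · have h1 : Tendsto (fun c => I c * h c) (𝓝[≠] 0) (𝓝 (∫ t in (0:ℝ)..ω, C t)) := by
      have := ((((hpow m hm).mul (hGy B hB m ω hω')).const_add (∫ t in (0:ℝ)..ω, C t)).add
        ((hpow (p+m) (by omega)).mul (hGy A hA (p+m) ω hω'))).mul hhl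
      simpa using this
    refine h1.congr' ?_
    filter_upwards [hident, hne] with c hc h0
    rw [hc]; field_simp
  · intro hC0
    have h1 := ((hGy B hB m ω hω').add ((hpow p hp).mul (hGy A hA (p+m) ω hω'))).mul hhl
    simp only [zero_mul, add_zero, mul_one] at h1
    refine h1.congr' ?_
    filter_upwards [hident, hne] with c hc h0
    rw [hc, hI]
    simp only [hC0]
    field_simp
    ring
  · intro hC0 hB0
    have hBB : Tendsto (fun c => ∫ t in (0:ℝ)..ω, B t * ((y c t ^ m - 1) / c ^ p)) (𝓝[≠] 0)
        (𝓝 (∫ t in (0:ℝ)..ω, (m:ℂ) * B t * ∫ s in (0:ℝ)..t, C s)) := by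
      refine hdom ω hω' _ _ (fun s => ‖B s‖ * ((∑ i ∈ Finset.range m, 2 ^ i) * K)) (by fun_prop)
        ?_ ?_ ?_
      · filter_upwards [hycont] with c hc
        exact hB.continuousOn.mul (((hc.pow m).sub continuousOn_const).div_const _)
      · filter_upwards [hy] with c hc s hs
        obtain ⟨h1, h2, -, -⟩ := hc.2.2 s hs
        have hcp : 0 < ‖c‖ := norm_pos_iff.2 hc.1
        rw [norm_mul, norm_div, norm_pow, ← geom_sum_mul, norm_mul]
        refine mul_le_mul_of_nonneg_left ?_ (norm_nonneg _)
        rw [div_le_iff₀ (by positivity), mul_assoc]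
        refine mul_le_mul ?_ h2 (norm_nonneg _) (by positivity)
        refine (norm_sum_le _ _).trans (Finset.sum_le_sum fun i _ => ?_)
        rw [norm_pow]
        gcongr
      · intro s hs
        have hsm : Tendsto (fun c => ∑ i ∈ Finset.range m, y c s ^ i) (𝓝[≠] 0) (𝓝 (m:ℂ)) := by
          have := tendsto_finsetSum (Finset.range m) (fun i _ => (hylim s hs).pow i)
          simpa using this
        have := (hsm.mul (hy1 s hs)).const_mul (B s)
        rw [show (m:ℂ) * B s * ∫ s in (0:ℝ)..s, C s = B s * (m * ∫ s in (0:ℝ)..s, C s) by ring]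
        refine this.congr fun c => ?_
        rw [← geom_sum_mul]; ring
    have h1 := ((hGy A hA (p+m) ω hω').add hBB).mul hhl
    have hΓ : Continuous fun t => ∫ s in (0:ℝ)..t, C s :=
      intervalIntegral.continuous_primitive (fun a b => hC.intervalIntegrable a b) 0
    rw [mul_one, ← intervalIntegral.integral_add (hA.intervalIntegrable _ _)
      ((by fun_prop : Continuous fun t => (m:ℂ) * B t * ∫ s in (0:ℝ)..t, C s).intervalIntegrable
        _ _)] at h1
    refine h1.congr' ?_
    filter_upwards [hident, hne, hycont] with c hc h0 hcc
    have e : ∫ t in (0:ℝ)..ω, B t * ((y c t ^ m - 1) / c ^ p)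
        = (∫ t in (0:ℝ)..ω, B t * y c t ^ m) / c ^ p := by
      have : ∀ t, B t * ((y c t ^ m - 1) / c ^ p) = (B t * y c t ^ m - B t) / c ^ p := by
        intro t; ring
      simp only [this]
      rw [intervalIntegral.integral_div, intervalIntegral.integral_sub
        (hint B hB m ω hω' c hcc) (hB.intervalIntegrable _ _), hB0, sub_zero]
    rw [hc, hI, e]
    simp only [hC0]
    field_simp
    ring

theorem stmt_5 (ω : ℝ) (hω : 0 < ω)
    (L M N : ℕ) (hL : 1 < L) (hLM : L < M) (hMN : M < N) (hN : N = L + M - 1)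
    (A B C : ℝ → ℂ) (hA : Continuous A) (hB : Continuous B) (hC : Continuous C)
    (z : ℂ → ℝ → ℂ) (ε : ℝ) (hε : 0 < ε)
    (hsol : ∀ c : ℂ, ‖c‖ < ε →
      IsSolution ω (fun t w => A t * w ^ N + B t * w ^ M + C t * w ^ L) (z c) ∧ z c 0 = c)
    (q : ℂ → ℂ) (hq : ∀ c : ℂ, q c = z c ω - c)
    (hqa : AnalyticAt ℂ q 0) :
    (HasZeroOfOrderExactly q M ↔
      (∫ t in (0:ℝ)..ω, C t) = 0 ∧ (∫ t in (0:ℝ)..ω, B t) ≠ 0) ∧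
    (HasZeroOfOrderExactly q N ↔
      (∫ t in (0:ℝ)..ω, C t) = 0 ∧ (∫ t in (0:ℝ)..ω, B t) = 0 ∧
      (∫ t in (0:ℝ)..ω, (A t + ((M : ℂ) - (L : ℂ)) * B t * ∫ s in (0:ℝ)..t, C s)) ≠ 0) := by
  obtain ⟨p, rfl⟩ : ∃ p, L = p + 1 := ⟨L - 1, by omega⟩
  obtain ⟨m, rfl⟩ : ∃ m, M = p + m + 1 := ⟨M - (p + 1), by omega⟩
  obtain rfl : N = 2 * p + m + 1 := by omega
  have hp : 0 < p := by omega
  have hm : 0 < m := by omega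
  obtain ⟨K, hK⟩ := yfacts ω hω p m hp hm A B C hA hB hC z ε hε hsol
  obtain ⟨t1, t2, t3⟩ := limits ω hω p m hp hm A B C hA hB hC (fun c t => z c t / c) K hK q
    (fun c hc => by rw [hq c]; field_simp)
  have hcast : (((p + m + 1 : ℕ) : ℂ) - ((p + 1 : ℕ) : ℂ)) = (m : ℂ) := by push_cast; ring
  rw [hcast]
  refine ⟨⟨fun h => ?_, fun h => zero_of_lim hqa h.2 (t2 h.1)⟩,
    ⟨fun h => ?_, fun h => zero_of_lim hqa h.2.2 (t3 h.1 h.2.1)⟩⟩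
  · have h1 := zero_cmp h t1
    have hC0 : (∫ t in (0:ℝ)..ω, C t) = 0 := by
      by_contra h2
      have := h1.1 h2
      omega
    exact ⟨hC0, (zero_cmp h (t2 hC0)).2 rfl⟩
  · have h1 := zero_cmp h t1
    have hC0 : (∫ t in (0:ℝ)..ω, C t) = 0 := by
      by_contra h2
      have := h1.1 h2
      omega
    have hB0 : (∫ t in (0:ℝ)..ω, B t) = 0 := by
      by_contra h2
      have := (zero_cmp h (t2 hC0)).1 h2
      omega
    exact ⟨hC0, hB0, (zero_cmp h (t3 hC0 hB0)).2 rfl⟩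
end

section
/- Let ω > 0, let L, M, N be integers with 1 < L < M < N = L + M − 1, and let A, B, C : ℝ → ℂ be continuous. If z = 0 is a center for the equation ż = A(t)z^N + B(t)z^M + C(t)z^L, then ∫₀^ω C(t) dt = 0, ∫₀^ω B(t) dt = 0, and ∫₀^ω [A(t) + (M−L)·B(t)·(∫₀^t C(s) ds)] dt = 0. -/
open Set Filter Topology MeasureTheory

lemma aux_cont {ω : ℝ} {u : ℝ → ℂ} (hu : ContinuousOn u (Icc 0 ω)) {G : ℝ → ℂ}
    (hG : Continuous G) (k : ℕ) {t : ℝ} (ht : t ∈ Icc 0 ω) :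
    IntervalIntegrable (fun s => G s * u s ^ k) volume 0 t := by
  apply ContinuousOn.intervalIntegrable
  rw [uIcc_of_le ht.1]
  exact hG.continuousOn.mul ((hu.mono (Icc_subset_Icc_right ht.2)).pow k)

lemma aux_bound {ω : ℝ} {G : ℝ → ℂ} (hG : Continuous G) :
    ∃ K : ℝ, 0 < K ∧ ∀ t ∈ Icc 0 ω, ‖G t‖ ≤ K := by
  obtain ⟨K, hK⟩ := (isCompact_Icc (a := (0:ℝ)) (b := ω)).exists_bound_of_continuousOn
    hG.continuousOn
  exact ⟨max K 1, by positivity, fun t ht => (hK t ht).trans (le_max_left _ _)⟩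

lemma aux_T {ω : ℝ} {U : ℝ → ℝ → ℂ}
    (hc : ∀ᶠ c in 𝓝[>] (0:ℝ), ContinuousOn (U c) (Icc 0 ω))
    (hb : ∀ᶠ c in 𝓝[>] (0:ℝ), ∀ t ∈ Icc 0 ω, ‖U c t‖ ≤ 2)
    (hl : ∀ t ∈ Icc 0 ω, Tendsto (fun c => U c t) (𝓝[>] (0:ℝ)) (𝓝 1))
    {G : ℝ → ℂ} (hG : Continuous G) (k : ℕ) {t : ℝ} (ht : t ∈ Icc 0 ω) :
    Tendsto (fun c => ∫ s in (0:ℝ)..t, G s * U c s ^ k) (𝓝[>] (0:ℝ))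
      (𝓝 (∫ s in (0:ℝ)..t, G s)) := by
  obtain ⟨K, hK0, hK⟩ := aux_bound (ω := ω) hG
  have hsub : ∀ s, s ∈ uIoc 0 t → s ∈ Icc 0 ω := by
    intro s hs
    rw [uIoc_of_le ht.1] at hs
    exact ⟨hs.1.le, hs.2.trans ht.2⟩
  apply intervalIntegral.tendsto_integral_filter_of_dominated_convergence (fun _ => K * 2 ^ k)
  · filter_upwards [hc] with c hc
    have := (aux_cont hc hG k ht)
    exact this.def'.aestronglyMeasurable
  · filter_upwards [hb] with c hb
    refine Eventually.of_forall fun s hs => ?_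
    rw [norm_mul, norm_pow]
    gcongr
    · exact hK s (hsub s hs)
    · exact hb s (hsub s hs)
  · exact intervalIntegrable_const
  · refine Eventually.of_forall fun s hs => ?_
    simpa using ((hl s (hsub s hs)).pow k).const_mul (G s)

lemma aux_Tb {ω : ℝ} {u : ℝ → ℂ} (hb : ∀ t ∈ Icc 0 ω, ‖u t‖ ≤ 2)
    {G : ℝ → ℂ} {K : ℝ} (hK0 : 0 < K) (hK : ∀ t ∈ Icc 0 ω, ‖G t‖ ≤ K) (k : ℕ)
    {t : ℝ} (ht : t ∈ Icc 0 ω) :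
    ‖∫ s in (0:ℝ)..t, G s * u s ^ k‖ ≤ K * 2 ^ k * ω := by
  have h := intervalIntegral.norm_integral_le_of_norm_le_const (a := 0) (b := t)
    (f := fun s => G s * u s ^ k) (C := K * 2 ^ k) ?_
  · refine h.trans ?_
    rw [sub_zero, abs_of_nonneg ht.1]
    gcongr
    exact ht.2
  · intro s hs
    rw [uIoc_of_le ht.1] at hs
    have hs' : s ∈ Icc 0 ω := ⟨hs.1.le, hs.2.trans ht.2⟩
    rw [norm_mul, norm_pow]
    gcongr
    · exact hK s hs'
    · exact hb s hs'

lemma aux_core {ω : ℝ} (hω : 0 < ω) {l m : ℕ} (hl : 0 < l) (hm : 0 < m)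
    {A B C : ℝ → ℂ} (hA : Continuous A) (hB : Continuous B) (hC : Continuous C)
    (U : ℝ → ℝ → ℂ)
    (hd : ∀ᶠ c in 𝓝[>] (0:ℝ), ∀ t ∈ Icc 0 ω, HasDerivAt (U c)
      ((c:ℂ) ^ l * (C t * U c t ^ (l+1) + (c:ℂ)^m * (B t * U c t ^ (l+m+1))
        + (c:ℂ)^(l+m) * (A t * U c t ^ (2*l+m+1)))) t)
    (h0 : ∀ᶠ c in 𝓝[>] (0:ℝ), U c 0 = 1)
    (h1 : ∀ᶠ c in 𝓝[>] (0:ℝ), U c ω = 1)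
    (Q : ℝ) (hQ : ∀ᶠ c in 𝓝[>] (0:ℝ), ∀ t ∈ Icc 0 ω, ‖U c t - 1‖ ≤ c * Q ∧ ‖U c t - 1‖ ≤ 1 / 2) :
    (∫ t in (0:ℝ)..ω, C t) = 0 ∧ (∫ t in (0:ℝ)..ω, B t) = 0 ∧
    (∫ t in (0:ℝ)..ω, (A t + (m : ℂ) * B t * ∫ s in (0:ℝ)..t, C s)) = 0 := by
  have hpos : ∀ᶠ c in 𝓝[>] (0:ℝ), 0 < c := eventually_mem_nhdsWithin
  have hle1 : ∀ᶠ c in 𝓝[>] (0:ℝ), c ≤ 1 :=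
    nhdsWithin_le_nhds (Iic_mem_nhds one_pos)
  have hc : ∀ᶠ c in 𝓝[>] (0:ℝ), ContinuousOn (U c) (Icc 0 ω) := by
    filter_upwards [hd] with c hd t ht
    exact (hd t ht).continuousAt.continuousWithinAt
  have hb : ∀ᶠ c in 𝓝[>] (0:ℝ), ∀ t ∈ Icc 0 ω, ‖U c t‖ ≤ 2 := by
    filter_upwards [hQ] with c hQ t ht
    have := (hQ t ht).2
    have h2 := norm_sub_norm_le (U c t) 1
    simp only [norm_one] at h2
    linarith
  have hne : ∀ᶠ c in 𝓝[>] (0:ℝ), ∀ t ∈ Icc 0 ω, U c t ≠ 0 := by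
    filter_upwards [hQ] with c hQ t ht h
    have := (hQ t ht).2
    rw [h] at this
    norm_num at this
  have hlim : ∀ t ∈ Icc 0 ω, Tendsto (fun c => U c t) (𝓝[>] (0:ℝ)) (𝓝 1) := by
    intro t ht
    rw [tendsto_iff_norm_sub_tendsto_zero]
    have hz : Tendsto (fun c : ℝ => c * Q) (𝓝[>] (0:ℝ)) (𝓝 0) := by
      have : Tendsto (fun c : ℝ => c * Q) (𝓝 0) (𝓝 (0 * Q)) := by
        exact (continuous_id.mul continuous_const).tendsto 0
      rw [zero_mul] at this
      exact this.mono_left nhdsWithin_le_nhds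
    refine squeeze_zero' (Eventually.of_forall fun _ => norm_nonneg _) ?_ hz
    filter_upwards [hQ] with c hQ
    exact (hQ t ht).1
  have hωm : ω ∈ Icc 0 ω := ⟨hω.le, le_rfl⟩
  have hcp : ∀ k : ℕ, 0 < k → Tendsto (fun c : ℝ => (c:ℂ)^k) (𝓝[>] (0:ℝ)) (𝓝 0) := by
    intro k hk
    have : Tendsto (fun c : ℝ => (c:ℂ)^k) (𝓝 0) (𝓝 (((0:ℝ):ℂ)^k)) :=
      (Complex.continuous_ofReal.pow k).tendsto 0
    simp only [Complex.ofReal_zero, zero_pow hk.ne'] at this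
    exact this.mono_left nhdsWithin_le_nhds
  have T := fun {G : ℝ → ℂ} (hG : Continuous G) (k : ℕ) {t : ℝ} (ht : t ∈ Icc 0 ω) =>
    aux_T hc hb hlim hG k ht
  -- identity 1
  have id1 : ∀ᶠ c : ℝ in 𝓝[>] (0:ℝ), (∫ t in (0:ℝ)..ω, C t)
      + (c:ℂ)^m * (∫ t in (0:ℝ)..ω, B t * U c t ^ m)
      + (c:ℂ)^(l+m) * (∫ t in (0:ℝ)..ω, A t * U c t ^ (l+m)) = 0 := by
    filter_upwards [hd, h0, h1, hc, hne, hpos] with c hd h0 h1 hc hne hpos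
    have hcne : (c:ℂ) ≠ 0 := by exact_mod_cast hpos.ne'
    have iC := hC.intervalIntegrable (μ := volume) 0 ω
    have iB := (aux_cont hc hB m hωm).const_mul ((c:ℂ)^m)
    have iA := (aux_cont hc hA (l+m) hωm).const_mul ((c:ℂ)^(l+m))
    have hint := (((iC.add iB).add iA).const_mul (-(l:ℂ) * (c:ℂ)^l))
    have key := intervalIntegral.integral_eq_sub_of_hasDerivAt
      (f := fun t => (U c t ^ l)⁻¹) (a := 0) (b := ω)
      (f' := fun t => -(l:ℂ) * (c:ℂ)^l * (C t + (c:ℂ)^m * (B t * U c t ^ m)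
        + (c:ℂ)^(l+m) * (A t * U c t ^ (l+m)))) ?_ hint
    · rw [intervalIntegral.integral_const_mul, intervalIntegral.integral_add (iC.add iB) iA,
        intervalIntegral.integral_add iC iB, intervalIntegral.integral_const_mul,
        intervalIntegral.integral_const_mul] at key
      simp only [h0, h1, sub_self] at key
      refine (mul_eq_zero.1 key).resolve_left ?_
      refine mul_ne_zero (neg_ne_zero.2 ?_) (pow_ne_zero _ hcne)
      exact_mod_cast hl.ne'
    · intro t ht
      rw [uIcc_of_le hω.le] at ht
      have hu := hne t ht
      have := ((hd t ht).fun_pow l).fun_inv (pow_ne_zero _ hu)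
      refine HasDerivAt.congr_deriv this ?_
      obtain ⟨n, rfl⟩ : ∃ n, l = n + 1 := ⟨l - 1, by omega⟩
      simp only [Nat.add_sub_cancel]
      field_simp
      ring
  have id2 : ∀ᶠ c in 𝓝[>] (0:ℝ), ∀ t ∈ Icc 0 ω, (U c t ^ m - 1) / (c:ℂ)^l =
      m * ((∫ s in (0:ℝ)..t, C s * U c s ^ (l+m))
      + (c:ℂ)^m * (∫ s in (0:ℝ)..t, B s * U c s ^ (l+2*m))
      + (c:ℂ)^(l+m) * (∫ s in (0:ℝ)..t, A s * U c s ^ (2*l+2*m))) := by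
    filter_upwards [hd, h0, hc, hpos] with c hd h0 hc hpos t ht
    have hcne : (c:ℂ) ≠ 0 := by exact_mod_cast hpos.ne'
    have iC := (aux_cont hc hC (l+m) ht)
    have iB := (aux_cont hc hB (l+2*m) ht).const_mul ((c:ℂ)^m)
    have iA := (aux_cont hc hA (2*l+2*m) ht).const_mul ((c:ℂ)^(l+m))
    have hint := (((iC.add iB).add iA).const_mul ((c:ℂ)^l * m))
    have key := intervalIntegral.integral_eq_sub_of_hasDerivAt
      (f := fun t => (U c t ^ m)) (a := 0) (b := t)
      (f' := fun t => (c:ℂ)^l * m * (C t * U c t ^ (l+m) + (c:ℂ)^m * (B t * U c t ^ (l+2*m))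
        + (c:ℂ)^(l+m) * (A t * U c t ^ (2*l+2*m)))) ?_ hint
    · rw [intervalIntegral.integral_const_mul, intervalIntegral.integral_add (iC.add iB) iA,
        intervalIntegral.integral_add iC iB, intervalIntegral.integral_const_mul,
        intervalIntegral.integral_const_mul] at key
      simp only [h0, one_pow] at key
      rw [← key]
      field_simp
    · intro s hs
      rw [uIcc_of_le ht.1] at hs
      have := ((hd s ⟨hs.1, hs.2.trans ht.2⟩).fun_pow m)
      refine HasDerivAt.congr_deriv this ?_
      obtain ⟨n, rfl⟩ : ∃ n, m = n + 1 := ⟨m - 1, by omega⟩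
      simp only [Nat.add_sub_cancel]
      ring
  have hC0 : (∫ t in (0:ℝ)..ω, C t) = 0 := by
    have h := ((tendsto_const_nhds (x := ∫ t in (0:ℝ)..ω, C t)).add
      ((hcp m hm).mul (T hB m hωm))).add ((hcp (l+m) (by omega)).mul (T hA (l+m) hωm))
    have := tendsto_nhds_unique (h.congr' id1) tendsto_const_nhds
    simpa using this
  have id3 : ∀ᶠ c : ℝ in 𝓝[>] (0:ℝ), (∫ t in (0:ℝ)..ω, B t * U c t ^ m)
      + (c:ℂ)^l * (∫ t in (0:ℝ)..ω, A t * U c t ^ (l+m)) = 0 := by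
    filter_upwards [id1, hpos] with c h hpos
    have hcne : (c:ℂ) ≠ 0 := by exact_mod_cast hpos.ne'
    rw [hC0] at h
    refine mul_left_cancel₀ (pow_ne_zero m hcne) ?_
    rw [mul_zero]
    rw [← h]; ring
  have hB0 : (∫ t in (0:ℝ)..ω, B t) = 0 := by
    have h := (T hB m hωm).add ((hcp l hl).mul (T hA (l+m) hωm))
    have := tendsto_nhds_unique (h.congr' id3) tendsto_const_nhds
    simpa using this
  refine ⟨hC0, hB0, ?_⟩
  have cD : ∀ᶠ c in 𝓝[>] (0:ℝ), IntervalIntegrable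
      (fun t => B t * ((U c t ^ m - 1) / (c:ℂ)^l)) volume 0 ω := by
    filter_upwards [hc] with c hc
    apply ContinuousOn.intervalIntegrable
    rw [uIcc_of_le hω.le]
    exact hB.continuousOn.mul (((hc.pow m).sub continuousOn_const).div_const _)
  have id4 : ∀ᶠ c : ℝ in 𝓝[>] (0:ℝ), (∫ t in (0:ℝ)..ω, A t * U c t ^ (l+m)) +
      (∫ t in (0:ℝ)..ω, B t * ((U c t ^ m - 1) / (c:ℂ)^l)) = 0 := by
    filter_upwards [id3, hpos, hc] with c h hpos hc
    have hcne : (c:ℂ) ≠ 0 := by exact_mod_cast hpos.ne'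
    have e : (∫ t in (0:ℝ)..ω, B t * ((U c t ^ m - 1) / (c:ℂ)^l)) =
        ((∫ t in (0:ℝ)..ω, B t * U c t ^ m) - ∫ t in (0:ℝ)..ω, B t) / (c:ℂ)^l := by
      rw [← intervalIntegral.integral_sub (aux_cont hc hB m hωm) (hB.intervalIntegrable _ _),
        ← intervalIntegral.integral_div]
      congr 1; ext t; ring
    have hcl := pow_ne_zero l hcne
    rw [e, hB0, eq_neg_of_add_eq_zero_left h, sub_zero, neg_div, mul_div_cancel_left₀ _ hcl,
      add_neg_cancel]
  obtain ⟨KA, hKA0, hKA⟩ := aux_bound (ω := ω) hA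
  obtain ⟨KB, hKB0, hKB⟩ := aux_bound (ω := ω) hB
  obtain ⟨KC, hKC0, hKC⟩ := aux_bound (ω := ω) hC
  have hlimD : Tendsto (fun c => ∫ t in (0:ℝ)..ω, B t * ((U c t ^ m - 1) / (c:ℂ)^l))
      (𝓝[>] (0:ℝ)) (𝓝 (∫ t in (0:ℝ)..ω, B t * (m * ∫ s in (0:ℝ)..t, C s))) := by
    apply intervalIntegral.tendsto_integral_filter_of_dominated_convergence
      (fun _ => KB * (m * (KC * 2^(l+m) * ω + 1 * (KB * 2^(l+2*m) * ω)
        + 1 * (KA * 2^(2*l+2*m)*ω))))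
    · filter_upwards [cD] with c h
      exact h.def'.aestronglyMeasurable
    · filter_upwards [id2, hb, hpos, hle1] with c id2 hb hpos hle1
      refine Eventually.of_forall fun t ht => ?_
      rw [uIoc_of_le hω.le] at ht
      have ht' : t ∈ Icc 0 ω := ⟨ht.1.le, ht.2⟩
      have hp : ∀ k : ℕ, ‖(c:ℂ)^k‖ ≤ 1 := by
        intro k
        rw [norm_pow, Complex.norm_real, Real.norm_of_nonneg hpos.le]
        exact pow_le_one₀ hpos.le hle1
      rw [norm_mul, id2 t ht', norm_mul, Complex.norm_natCast]
      refine mul_le_mul (hKB t ht') ?_ (by positivity) hKB0.le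
      refine mul_le_mul_of_nonneg_left ?_ (by positivity)
      refine norm_add₃_le.trans ?_
      rw [norm_mul, norm_mul]
      refine add_le_add (add_le_add (aux_Tb hb hKC0 hKC _ ht') ?_) ?_
      · exact mul_le_mul (hp _) (aux_Tb hb hKB0 hKB _ ht') (norm_nonneg _) zero_le_one
      · exact mul_le_mul (hp _) (aux_Tb hb hKA0 hKA _ ht') (norm_nonneg _) zero_le_one
    · exact intervalIntegrable_const
    · refine Eventually.of_forall fun t ht => ?_
      rw [uIoc_of_le hω.le] at ht
      have ht' : t ∈ Icc 0 ω := ⟨ht.1.le, ht.2⟩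
      refine Tendsto.const_mul _ ?_
      have h := (((T hC (l+m) ht').add ((hcp m hm).mul (T hB (l+2*m) ht'))).add
        ((hcp (l+m) (by omega)).mul (T hA (2*l+2*m) ht'))).const_mul (m:ℂ)
      simp only [zero_mul, add_zero] at h
      refine h.congr' ?_
      filter_upwards [id2] with c id2
      exact (id2 t ht').symm
  have h := (T hA (l+m) hωm).add hlimD
  have fin := tendsto_nhds_unique (h.congr' id4) tendsto_const_nhds
  have cI : Continuous (fun t : ℝ => ∫ s in (0:ℝ)..t, C s) :=
    intervalIntegral.continuous_primitive (fun a b => hC.intervalIntegrable a b) 0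
  have cBI : Continuous (fun t : ℝ => B t * (m * ∫ s in (0:ℝ)..t, C s)) :=
    hB.mul (continuous_const.mul cI)
  rw [← intervalIntegral.integral_add (hA.intervalIntegrable _ _)
    (cBI.intervalIntegrable _ _)] at fin
  rw [← fin]
  congr 1; ext t; ring

lemma aux_apriori {ω : ℝ} {l m : ℕ} (hl : 0 < l)
    {A B C : ℝ → ℂ} {KA KB KC : ℝ} (hKA0 : 0 < KA) (hKB0 : 0 < KB) (hKC0 : 0 < KC)
    (hA : ∀ t ∈ Icc 0 ω, ‖A t‖ ≤ KA) (hB : ∀ t ∈ Icc 0 ω, ‖B t‖ ≤ KB)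
    (hC : ∀ t ∈ Icc 0 ω, ‖C t‖ ≤ KC) {u : ℝ → ℂ} {c : ℝ} (hc : 0 < c) (hc1 : c ≤ 1)
    (hd : ∀ t ∈ Icc 0 ω, HasDerivAt u
      ((c:ℂ) ^ l * (C t * u t ^ (l+1) + (c:ℂ)^m * (B t * u t ^ (l+m+1))
        + (c:ℂ)^(l+m) * (A t * u t ^ (2*l+m+1)))) t)
    (h0 : u 0 = 1) {Q : ℝ}
    (hQ : Q = KC * 2^(l+1) + 1 * (KB * 2^(l+m+1)) + 1 * (KA * 2^(2*l+m+1)) + 1)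
    (hcQ : c * (Q * ω) ≤ 1/2) :
    ∀ t ∈ Icc 0 ω, ‖u t - 1‖ ≤ c * (Q * ω) ∧ ‖u t - 1‖ ≤ 1/2 := by
  have hQ0 : 0 < Q := by rw [hQ]; positivity
  have hp : ∀ k : ℕ, ‖(c:ℂ)^k‖ ≤ 1 := by
    intro k
    rw [norm_pow, Complex.norm_real, Real.norm_of_nonneg hc.le]
    exact pow_le_one₀ hc.le hc1
  have hpl : ‖(c:ℂ)^l‖ ≤ c := by
    rw [norm_pow, Complex.norm_real, Real.norm_of_nonneg hc.le]
    exact pow_le_of_le_one hc.le hc1 hl.ne'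
  have hlin : ∀ t ∈ Icc 0 ω, c * Q * t ≤ c * (Q * ω) := by
    intro t ht
    rw [mul_assoc]
    have := ht.2
    gcongr
  have key : ∀ ⦃t⦄, t ∈ Icc 0 ω → ‖u t - 1‖ ≤ c * Q * t := by
    refine image_norm_le_of_norm_deriv_right_lt_deriv_boundary' (f := fun t => u t - 1)
      (B := fun t => c * Q * t) (B' := fun _ => c * Q)
      (f' := fun t => ((c:ℂ) ^ l * (C t * u t ^ (l+1) + (c:ℂ)^m * (B t * u t ^ (l+m+1))
        + (c:ℂ)^(l+m) * (A t * u t ^ (2*l+m+1))))) ?_ ?_ ?_ ?_ ?_ ?_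
    · exact fun t ht => ((hd t ht).sub_const 1).continuousAt.continuousWithinAt
    · intro t ht
      exact ((hd t ⟨ht.1, ht.2.le⟩).sub_const 1).hasDerivWithinAt
    · simp [h0]
    · fun_prop
    · intro t ht
      simpa using ((hasDerivAt_id t).const_mul (c * Q)).hasDerivWithinAt
    · intro t ht he
      have ht' : t ∈ Icc 0 ω := ⟨ht.1, ht.2.le⟩
      have hu : ‖u t‖ ≤ 2 := by
        have h1 := hlin t ht'
        have h2 := norm_sub_norm_le (u t) 1
        simp only [norm_one] at h2
        linarith
      have hG : ∀ (G : ℂ) (K : ℝ) (k : ℕ), ‖G‖ ≤ K → ‖G * u t ^ k‖ ≤ K * 2 ^ k := by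
        intro G K k h
        rw [norm_mul, norm_pow]
        gcongr
        exact (norm_nonneg _).trans h
      have hlt : ‖C t * u t ^ (l+1) + (c:ℂ)^m * (B t * u t ^ (l+m+1))
        + (c:ℂ)^(l+m) * (A t * u t ^ (2*l+m+1))‖ < Q := by
        rw [hQ]
        refine lt_of_le_of_lt ?_ (lt_add_one _)
        refine norm_add₃_le.trans ?_
        rw [norm_mul ((c:ℂ)^m), norm_mul ((c:ℂ)^(l+m))]
        refine add_le_add (add_le_add (hG _ _ _ (hC t ht')) ?_) ?_
        · exact mul_le_mul (hp _) (hG _ _ _ (hB t ht')) (norm_nonneg _) zero_le_one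
        · exact mul_le_mul (hp _) (hG _ _ _ (hA t ht')) (norm_nonneg _) zero_le_one
      rw [norm_mul]
      exact (mul_le_mul_of_nonneg_right hpl (norm_nonneg _)).trans_lt
        (mul_lt_mul_of_pos_left hlt hc)
  intro t ht
  have := (key ht).trans (hlin t ht)
  exact ⟨this, this.trans hcQ⟩

theorem stmt_6 (ω : ℝ) (hω : 0 < ω)
    (L M N : ℕ) (hL : 1 < L) (hLM : L < M) (hMN : M < N) (hN : N = L + M - 1)
    (A B C : ℝ → ℂ) (hA : Continuous A) (hB : Continuous B) (hC : Continuous C)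
    (hcenter : IsCenter ω (fun t z => A t * z ^ N + B t * z ^ M + C t * z ^ L)) :
    (∫ t in (0:ℝ)..ω, C t) = 0 ∧ (∫ t in (0:ℝ)..ω, B t) = 0 ∧
    (∫ t in (0:ℝ)..ω, (A t + ((M : ℂ) - (L : ℂ)) * B t * ∫ s in (0:ℝ)..t, C s)) = 0 := by
  obtain ⟨l, rfl⟩ : ∃ l, L = l + 1 := ⟨L - 1, by omega⟩
  obtain ⟨m, rfl⟩ : ∃ m, M = l + m + 1 := ⟨M - (l + 1), by omega⟩
  obtain rfl : N = 2*l+m+1 := by omega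
  have hl : 0 < l := by omega
  have hm : 0 < m := by omega
  obtain ⟨ε, hε, hz⟩ := hcenter
  choose! Z hZ using hz
  have hpos : ∀ᶠ c in 𝓝[>] (0:ℝ), 0 < c := eventually_mem_nhdsWithin
  have hle1 : ∀ᶠ c in 𝓝[>] (0:ℝ), c ≤ 1 := nhdsWithin_le_nhds (Iic_mem_nhds one_pos)
  have hlt : ∀ᶠ c in 𝓝[>] (0:ℝ), c < ε := nhdsWithin_le_nhds (Iio_mem_nhds hε)
  obtain ⟨KA, hKA0, hKA⟩ := aux_bound (ω := ω) hA
  obtain ⟨KB, hKB0, hKB⟩ := aux_bound (ω := ω) hB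
  obtain ⟨KC, hKC0, hKC⟩ := aux_bound (ω := ω) hC
  obtain ⟨Q, hQ⟩ : ∃ Q, Q = KC * 2^(l+1) + 1 * (KB * 2^(l+m+1)) + 1 * (KA * 2^(2*l+m+1)) + 1 :=
    ⟨_, rfl⟩
  have hQ0 : 0 < Q := by rw [hQ]; positivity
  have hcQ : ∀ᶠ c in 𝓝[>] (0:ℝ), c * (Q * ω) ≤ 1/2 := by
    have hp : 0 < 1/2/(Q*ω) := by positivity
    filter_upwards [nhdsWithin_le_nhds (Iic_mem_nhds hp)] with c h
    exact (le_div_iff₀ (by positivity)).1 h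
  have hsol : ∀ᶠ c : ℝ in 𝓝[>] (0:ℝ), IsSolution ω
      (fun t z => A t * z ^ (2*l+m+1) + B t * z ^ (l+m+1) + C t * z ^ (l+1)) (Z (c:ℂ)) ∧
      Z (c:ℂ) 0 = c ∧ Z (c:ℂ) ω = c := by
    filter_upwards [hpos, hlt] with c hpos hlt
    apply hZ
    rwa [Complex.norm_real, Real.norm_of_nonneg hpos.le]
  have hd : ∀ᶠ c : ℝ in 𝓝[>] (0:ℝ), ∀ t ∈ Icc 0 ω, HasDerivAt (fun t => Z (c:ℂ) t / c)
      ((c:ℂ) ^ l * (C t * (Z (c:ℂ) t / c) ^ (l+1) + (c:ℂ)^m * (B t * (Z (c:ℂ) t / c) ^ (l+m+1))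
        + (c:ℂ)^(l+m) * (A t * (Z (c:ℂ) t / c) ^ (2*l+m+1)))) t := by
    filter_upwards [hpos, hsol] with c hpos hsol t ht
    have hcne : (c:ℂ) ≠ 0 := by exact_mod_cast hpos.ne'
    refine HasDerivAt.congr_deriv ((hsol.1 t ht).div_const (c:ℂ)) ?_
    simp only [div_pow]
    field_simp
    ring
  have h0 : ∀ᶠ c : ℝ in 𝓝[>] (0:ℝ), Z (c:ℂ) 0 / c = 1 := by
    filter_upwards [hpos, hsol] with c hpos hsol
    have hcne : (c:ℂ) ≠ 0 := by exact_mod_cast hpos.ne'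
    rw [hsol.2.1, div_self hcne]
  have h1 : ∀ᶠ c : ℝ in 𝓝[>] (0:ℝ), Z (c:ℂ) ω / c = 1 := by
    filter_upwards [hpos, hsol] with c hpos hsol
    have hcne : (c:ℂ) ≠ 0 := by exact_mod_cast hpos.ne'
    rw [hsol.2.2, div_self hcne]
  have main := aux_core hω hl hm hA hB hC (fun c t => Z (c:ℂ) t / c) hd h0 h1 (Q * ω) (by
    filter_upwards [hpos, hle1, hcQ, hd, h0] with c hpos hle1 hcQ hd h0
    exact aux_apriori hl hKA0 hKB0 hKC0 hKA hKB hKC hpos hle1 hd h0 hQ hcQ)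
  have e : (((l + m + 1 : ℕ) : ℂ) - ((l + 1 : ℕ) : ℂ)) = m := by push_cast; ring
  rw [e]
  exact main
end

section
/- Let ω > 0, let M, N be integers with 1 < M < N, and let A, B : ℝ → ℂ be continuous with ∫₀^ω A(t) dt ≠ 0. Then z = 0 is not a center for the equation ż = A(t)z^N + B(t)z^M. -/
open Set Filter Topology MeasureTheory

/-- A priori estimate for small solutions. -/
lemma aux_bound_s7 (ω : ℝ) (M N : ℕ) (hM : 1 < M) (hMN : M < N)
    (A B : ℝ → ℂ) (K : ℝ) (hK : 0 ≤ K)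
    (hAK : ∀ t ∈ Icc (0:ℝ) ω, ‖A t‖ ≤ K) (hBK : ∀ t ∈ Icc (0:ℝ) ω, ‖B t‖ ≤ K)
    (c : ℂ) (hc : c ≠ 0) (hc1 : 2 * ‖c‖ ≤ 1) (hc2 : (8 * K + 1) * ω * ‖c‖ ≤ 1 / 2)
    (z : ℝ → ℂ) (hz : IsSolution ω (fun t z => A t * z ^ N + B t * z ^ M) z) (hz0 : z 0 = c) :
    ∀ t ∈ Icc (0:ℝ) ω, ‖z t - c‖ ≤ (8 * K + 1) * ω * ‖c‖ * ‖c‖ := by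
  have hcpos : 0 < ‖c‖ := norm_pos_iff.mpr hc
  have key : ∀ ⦃t⦄, t ∈ Icc (0:ℝ) ω → ‖z t - c‖ ≤ (8 * K + 1) * ‖c‖ ^ 2 * t := by
    refine image_norm_le_of_norm_deriv_right_lt_deriv_boundary
      (f := fun t => z t - c) (f' := fun t => A t * z t ^ N + B t * z t ^ M)
      (B' := fun _ => (8 * K + 1) * ‖c‖ ^ 2)
      (B := fun t => (8 * K + 1) * ‖c‖ ^ 2 * t) ?_ ?_ ?_ ?_ ?_
    · intro t ht
      exact ((hz t ht).sub_const c).continuousAt.continuousWithinAt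
    · intro t ht
      exact ((hz t ⟨ht.1, ht.2.le⟩).sub_const c).hasDerivWithinAt
    · simp [hz0]
    · intro t
      simpa using (hasDerivAt_id t).const_mul ((8 * K + 1) * ‖c‖ ^ 2)
    · intro t ht heq
      have ht' : t ∈ Icc (0:ℝ) ω := ⟨ht.1, ht.2.le⟩
      have h1 : (8 * K + 1) * ‖c‖ ^ 2 * t ≤ ‖c‖ := by
        have : (8 * K + 1) * ‖c‖ ^ 2 * t ≤ (8 * K + 1) * ‖c‖ ^ 2 * ω := by
          apply mul_le_mul_of_nonneg_left ht.2.le; positivity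
        nlinarith
      have h2 : ‖z t‖ ≤ 2 * ‖c‖ := by
        have := norm_add_le (z t - c) c
        rw [sub_add_cancel] at this
        linarith
      have h3 : ∀ n : ℕ, 2 ≤ n → ‖z t‖ ^ n ≤ 4 * ‖c‖ ^ 2 := by
        intro n hn
        calc ‖z t‖ ^ n ≤ ‖z t‖ ^ 2 :=
              pow_le_pow_of_le_one (norm_nonneg _) (h2.trans hc1) hn
          _ ≤ (2 * ‖c‖) ^ 2 := by gcongr
          _ = _ := by ring
      calc ‖A t * z t ^ N + B t * z t ^ M‖ ≤ ‖A t‖ * ‖z t‖ ^ N + ‖B t‖ * ‖z t‖ ^ M := by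
            refine (norm_add_le _ _).trans ?_
            simp
        _ ≤ K * (4 * ‖c‖ ^ 2) + K * (4 * ‖c‖ ^ 2) := by
            gcongr
            · exact hAK t ht'
            · exact h3 N (by omega)
            · exact hBK t ht'
            · exact h3 M (by omega)
        _ < (8 * K + 1) * ‖c‖ ^ 2 := by nlinarith [sq_pos_of_pos hcpos]
  intro t ht
  refine (key ht).trans ?_
  have : (8 * K + 1) * ‖c‖ ^ 2 * t ≤ (8 * K + 1) * ‖c‖ ^ 2 * ω := by
    apply mul_le_mul_of_nonneg_left ht.2; positivity
  linarith

lemma aux_int (ω : ℝ) (hω : 0 < ω) (M N : ℕ) (hM : 1 < M) (hMN : M < N)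
    (A B : ℝ → ℂ) (hA : Continuous A) (hB : Continuous B)
    (c : ℂ) (z : ℝ → ℂ) (hz : IsSolution ω (fun t z => A t * z ^ N + B t * z ^ M) z)
    (hz0 : z 0 = c) (hz1 : z ω = c) (hne : ∀ t ∈ Icc (0:ℝ) ω, z t ≠ 0) :
    (∫ t in (0:ℝ)..ω, A t * z t ^ (N - M)) + ∫ t in (0:ℝ)..ω, B t = 0 := by
  obtain ⟨m, rfl⟩ : ∃ m, M = m + 2 := ⟨M - 2, by omega⟩
  obtain ⟨k, rfl⟩ : ∃ k, N = m + 2 + k := ⟨N - (m + 2), by omega⟩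
  have hzc : ContinuousOn z (uIcc 0 ω) := by
    rw [uIcc_of_le hω.le]
    exact fun t ht => (hz t ht).continuousAt.continuousWithinAt
  have hc1 : ContinuousOn (fun t => A t * z t ^ k) (uIcc 0 ω) := hA.continuousOn.mul (hzc.pow k)
  have hd : ∀ t ∈ uIcc 0 ω, HasDerivAt (fun t => (z t ^ (m + 1))⁻¹)
      (-((m:ℂ) + 1) * (A t * z t ^ k + B t)) t := by
    intro t ht
    rw [uIcc_of_le hω.le] at ht
    have h0 := hne t ht
    have := ((hz t ht).pow (m + 1)).inv (pow_ne_zero _ h0)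
    refine HasDerivAt.congr_deriv (f := fun t => (z t ^ (m + 1))⁻¹) this ?_
    simp only [Nat.add_sub_cancel, Pi.pow_apply]
    push_cast
    field_simp
    ring
  have hi := intervalIntegral.integral_eq_sub_of_hasDerivAt hd
    ((continuousOn_const.mul (hc1.add hB.continuousOn)).intervalIntegrable)
  rw [hz0, hz1, sub_self, intervalIntegral.integral_const_mul,
    intervalIntegral.integral_add hc1.intervalIntegrable (hB.intervalIntegrable _ _)] at hi
  have hm : -((m:ℂ) + 1) ≠ 0 := neg_ne_zero.mpr (Nat.cast_add_one_ne_zero m)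
  simpa using (mul_eq_zero.mp hi).resolve_left hm

theorem stmt_7 (ω : ℝ) (hω : 0 < ω)
    (M N : ℕ) (hM : 1 < M) (hMN : M < N)
    (A B : ℝ → ℂ) (hA : Continuous A) (hB : Continuous B)
    (hAint : (∫ t in (0:ℝ)..ω, A t) ≠ 0) :
    ¬ IsCenter ω (fun t z => A t * z ^ N + B t * z ^ M) := by
  rintro ⟨ε, hε, H⟩
  have H' : ∀ c : ℂ, ∃ z : ℝ → ℂ, ‖c‖ < ε →
      IsSolution ω (fun t z => A t * z ^ N + B t * z ^ M) z ∧ z 0 = c ∧ z ω = c := by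
    intro c
    by_cases h : ‖c‖ < ε
    · obtain ⟨z, hz⟩ := H c h
      exact ⟨z, fun _ => hz⟩
    · exact ⟨0, fun h' => absurd h' h⟩
  choose z hz using H'
  obtain ⟨K1, hK1⟩ := (isCompact_Icc (a := (0:ℝ)) (b := ω)).exists_bound_of_continuousOn
    hA.continuousOn
  obtain ⟨K2, hK2⟩ := (isCompact_Icc (a := (0:ℝ)) (b := ω)).exists_bound_of_continuousOn
    hB.continuousOn
  set K := max 0 (max K1 K2) with hKdef
  have hK : 0 ≤ K := le_max_left _ _
  have hAK : ∀ t ∈ Icc (0:ℝ) ω, ‖A t‖ ≤ K := fun t ht =>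
    (hK1 t ht).trans ((le_max_left _ _).trans (le_max_right _ _))
  have hBK : ∀ t ∈ Icc (0:ℝ) ω, ‖B t‖ ≤ K := fun t ht =>
    (hK2 t ht).trans ((le_max_right _ _).trans (le_max_right _ _))
  set L := (8 * K + 1) * ω with hL
  have hLt : Tendsto (fun c : ℂ => L * ‖c‖) (𝓝[≠] 0) (𝓝 0) := by
    have : Continuous (fun c : ℂ => L * ‖c‖) := by fun_prop
    have h := this.tendsto 0
    simp only [norm_zero, mul_zero] at h
    exact h.mono_left nhdsWithin_le_nhds
  have hnt : Tendsto (fun c : ℂ => ‖c‖) (𝓝[≠] 0) (𝓝 0) := by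
    have h := (continuous_norm (E := ℂ)).tendsto 0
    rw [norm_zero] at h
    exact h.mono_left nhdsWithin_le_nhds
  have ev : ∀ᶠ c : ℂ in 𝓝[≠] 0, c ≠ 0 ∧ ‖c‖ < ε ∧ L * ‖c‖ ≤ 1 / 2 ∧
      ∀ t ∈ Icc (0:ℝ) ω, ‖z c t - c‖ ≤ L * ‖c‖ * ‖c‖ := by
    filter_upwards [self_mem_nhdsWithin, hnt.eventually_lt_const hε,
      hnt.eventually_lt_const (show (0:ℝ) < 1 / 2 by norm_num),
      hLt.eventually_lt_const (show (0:ℝ) < 1 / 2 by norm_num)] with c h0 h1 h2 h3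
    exact ⟨h0, h1, h3.le, aux_bound_s7 ω M N hM hMN A B K hK hAK hBK c h0 (by linarith) h3.le
      (z c) (hz c h1).1 (hz c h1).2.1⟩
  have ev2 : ∀ᶠ c : ℂ in 𝓝[≠] 0, ∀ t ∈ Icc (0:ℝ) ω, ‖z c t / c - 1‖ ≤ L * ‖c‖ := by
    filter_upwards [ev] with c ⟨h0, h1, h2, h3⟩ t ht
    have : z c t / c - 1 = (z c t - c) / c := by field_simp
    rw [this, norm_div, div_le_iff₀ (norm_pos_iff.mpr h0)]
    exact h3 t ht
  set k := N - M with hk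
  have hid : ∀ᶠ c : ℂ in 𝓝[≠] 0,
      c ^ k * (∫ t in (0:ℝ)..ω, A t * (z c t / c) ^ k) + ∫ t in (0:ℝ)..ω, B t = 0 := by
    filter_upwards [ev] with c ⟨h0, h1, h2, h3⟩
    have hp := norm_pos_iff.mpr h0
    rw [← aux_int ω hω M N hM hMN A B hA hB c (z c) (hz c h1).1 (hz c h1).2.1 (hz c h1).2.2 ?_,
      ← intervalIntegral.integral_const_mul]
    · congr 2
      ext t
      rw [div_pow]
      field_simp
      rw [hk]
    · intro t ht hzt
      have := h3 t ht
      rw [hzt, zero_sub, norm_neg] at this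
      nlinarith
  have hlim : Tendsto (fun c : ℂ => ∫ t in (0:ℝ)..ω, A t * (z c t / c) ^ k) (𝓝[≠] 0)
      (𝓝 (∫ t in (0:ℝ)..ω, A t)) := by
    apply intervalIntegral.tendsto_integral_filter_of_dominated_convergence
      (fun _ => K * 2 ^ k)
    · filter_upwards [ev] with c ⟨h0, h1, h2, h3⟩
      have hzc : ContinuousOn (z c) (uIoc 0 ω) := by
        rw [uIoc_of_le hω.le]
        exact fun t ht => ((hz c h1).1 t ⟨ht.1.le, ht.2⟩).continuousAt.continuousWithinAt
      exact (hA.continuousOn.mul ((hzc.div_const c).pow k)).aestronglyMeasurable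
        measurableSet_uIoc
    · filter_upwards [ev, ev2] with c ⟨h0, h1, h2, h3⟩ h4
      refine Eventually.of_forall fun t ht => ?_
      rw [uIoc_of_le hω.le] at ht
      have ht' : t ∈ Icc (0:ℝ) ω := ⟨ht.1.le, ht.2⟩
      rw [norm_mul, norm_pow]
      have : ‖z c t / c‖ ≤ 2 := by
        have h5 := norm_add_le (z c t / c - 1) 1
        rw [sub_add_cancel, norm_one] at h5
        linarith [h4 t ht']
      gcongr
      exact hAK t ht'
    · exact intervalIntegrable_const
    · refine Eventually.of_forall fun t ht => ?_
      rw [uIoc_of_le hω.le] at ht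
      have ht' : t ∈ Icc (0:ℝ) ω := ⟨ht.1.le, ht.2⟩
      have h1 : Tendsto (fun c : ℂ => z c t / c) (𝓝[≠] 0) (𝓝 1) := by
        rw [tendsto_iff_norm_sub_tendsto_zero]
        exact squeeze_zero' (Eventually.of_forall fun _ => norm_nonneg _)
          (ev2.mono fun c h => h t ht') hLt
      simpa using (h1.pow k).const_mul (A t)
  have hck : Tendsto (fun c : ℂ => c ^ k) (𝓝[≠] 0) (𝓝 0) := by
    have h := (continuous_pow (M := ℂ) k).tendsto 0
    rw [zero_pow (by omega)] at h
    exact h.mono_left nhdsWithin_le_nhds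
  have hB0 : (∫ t in (0:ℝ)..ω, B t) = 0 := by
    have h1 := (hck.mul hlim).add_const (∫ t in (0:ℝ)..ω, B t)
    have h2 := tendsto_nhds_unique h1 (tendsto_const_nhds.congr' (hid.mono fun c h => h.symm))
    simpa using h2
  apply hAint
  refine tendsto_nhds_unique hlim (tendsto_const_nhds.congr' ?_)
  filter_upwards [hid, ev] with c h1 h2
  rw [hB0, add_zero] at h1
  exact ((mul_eq_zero.mp h1).resolve_left (pow_ne_zero _ h2.1)).symm
end

section
/- Let ω > 0, let N ≥ 2 be an integer, and let A : ℝ → ℂ be continuous. Then z = 0 is a center for the equation ż = z^N + A(t)z if and only if e^{∫₀^ω A(t)dt} = 1 and ∫₀^ω e^{(N−1)∫₀^t A(s)ds} dt = 0. -/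
open Set Filter Topology in
lemma aux_exists (ω : ℝ) (n : ℕ) (hn : 1 ≤ n) (A : ℝ → ℂ) (hA : Continuous A) :
    ∃ δ > (0:ℝ), ∀ c : ℂ, ‖c‖ < δ →
      IsSolution ω (fun t z => z ^ (n+1) + A t * z) (fun t => c * Complex.exp (∫ s in (0:ℝ)..t, A s) *
        Complex.exp (-(Complex.log (1 - n * c ^ n *
          ∫ s in (0:ℝ)..t, Complex.exp (n * ∫ r in (0:ℝ)..s, A r))) / n)) ∧
      1 - n * c ^ n * (∫ s in (0:ℝ)..ω, Complex.exp (n * ∫ r in (0:ℝ)..s, A r)) ∈ Complex.slitPlane ∨ ω < 0 := by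
  rcases lt_or_ge ω 0 with hω | hω
  · exact ⟨1, one_pos, fun c _ => Or.inr hω⟩
  have ha : ∀ t, HasDerivAt (fun t => ∫ s in (0:ℝ)..t, A s) (A t) t := fun t =>
    (hA.integral_hasStrictDerivAt 0 t).hasDerivAt
  have hac : Continuous (fun t => ∫ s in (0:ℝ)..t, A s) :=
    continuous_iff_continuousAt.2 fun t => (ha t).continuousAt
  set a : ℝ → ℂ := fun t => ∫ s in (0:ℝ)..t, A s with hadef
  have hB : Continuous (fun t => Complex.exp (n * a t)) := by fun_prop
  have hI : ∀ t, HasDerivAt (fun t => ∫ s in (0:ℝ)..t, Complex.exp (n * a s)) (Complex.exp (n * a t)) t := fun t =>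
    (hB.integral_hasStrictDerivAt 0 t).hasDerivAt
  have hIc : Continuous (fun t => ∫ s in (0:ℝ)..t, Complex.exp (n * a s)) :=
    continuous_iff_continuousAt.2 fun t => (hI t).continuousAt
  change ∃ δ > (0:ℝ), ∀ c : ℂ, ‖c‖ < δ →
      IsSolution ω (fun t z => z ^ (n+1) + A t * z) (fun t => c * Complex.exp (a t) *
        Complex.exp (-(Complex.log (1 - n * c ^ n *
          ∫ s in (0:ℝ)..t, Complex.exp (n * a s))) / n)) ∧
      1 - n * c ^ n * (∫ s in (0:ℝ)..ω, Complex.exp (n * a s)) ∈ Complex.slitPlane ∨ ω < 0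
  set I : ℝ → ℂ := fun t => ∫ s in (0:ℝ)..t, Complex.exp (n * a s) with hIdef
  have hn0 : (n:ℂ) ≠ 0 := by exact_mod_cast (by omega : n ≠ 0)
  obtain ⟨M, hM⟩ := (isCompact_Icc (a := (0:ℝ)) (b := ω)).exists_bound_of_continuousOn
    (f := fun t => (n:ℂ) * I t) (by fun_prop)
  have hM0 : 0 ≤ M := (norm_nonneg _).trans (hM 0 ⟨le_rfl, hω⟩)
  refine ⟨min 1 (1/(M+1)), by positivity, fun c hc => Or.inl ?_⟩
  have hc1 : ‖c‖ < 1 := hc.trans_le (min_le_left _ _)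
  have hc2 : ‖c‖ < 1/(M+1) := hc.trans_le (min_le_right _ _)
  have hs : ∀ t ∈ Icc 0 ω, 1 - n * c ^ n * I t ∈ Complex.slitPlane := by
    intro t ht
    have h1 : ‖n * c ^ n * I t‖ < 1 := by
      have : n * c ^ n * I t = c ^ n * (n * I t) := by ring
      rw [this, norm_mul, norm_pow]
      have h2 : ‖c‖ ^ n ≤ ‖c‖ := pow_le_of_le_one (norm_nonneg _) hc1.le (by omega)
      have h3 := hM t ht
      rw [lt_div_iff₀ (by positivity)] at hc2
      have := mul_le_mul h2 h3 (norm_nonneg _) (norm_nonneg _)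
      nlinarith [norm_nonneg c]
    left
    have := (Complex.abs_re_le_norm (n * c ^ n * I t)).trans_lt h1
    rw [Complex.sub_re, Complex.one_re]
    linarith [(abs_lt.1 this).2]
  refine ⟨?_, hs ω ⟨hω, le_rfl⟩⟩
  intro t ht
  have hw := hs t ht
  have hw0 := Complex.slitPlane_ne_zero hw
  have hd := ((ha t).cexp.const_mul c).mul
    (((((hI t).const_mul (n * c ^ n)).const_sub 1).clog_real hw).neg.div_const (n:ℂ)).cexp
  refine hd.congr_deriv ?_
  have key : (c * Complex.exp (a t) * Complex.exp (-(Complex.log (1 - n * c ^ n * I t)) / n)) ^ n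
      = c ^ n * Complex.exp (n * a t) / (1 - n * c ^ n * I t) := by
    rw [mul_pow, mul_pow, ← Complex.exp_nat_mul, ← Complex.exp_nat_mul, mul_div_cancel₀ _ hn0,
      Complex.exp_neg, Complex.exp_log hw0]
    rfl
  change c * (Complex.exp (a t) * A t) * Complex.exp (-(Complex.log (1 - n * c ^ n * I t)) / n) +
      c * Complex.exp (a t) * (Complex.exp (-(Complex.log (1 - n * c ^ n * I t)) / n) *
        (-(-(n * c ^ n * Complex.exp (n * a t)) / (1 - n * c ^ n * I t)) / n)) =
    (c * Complex.exp (a t) * Complex.exp (-(Complex.log (1 - n * c ^ n * I t)) / n)) ^ (n+1)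
      + A t * (c * Complex.exp (a t) * Complex.exp (-(Complex.log (1 - n * c ^ n * I t)) / n))
  rw [pow_succ, key]
  generalize Complex.exp (-(Complex.log (1 - n * c ^ n * I t)) / n) = E
  generalize 1 - n * c ^ n * I t = w at *
  field_simp
  ring

open Set in
lemma aux_unique (ω : ℝ) (hω : 0 < ω) (N : ℕ) (A : ℝ → ℂ) (hA : Continuous A) (y z : ℝ → ℂ)
    (hy : IsSolution ω (fun t z => z ^ N + A t * z) y)
    (hz : IsSolution ω (fun t z => z ^ N + A t * z) z) (h0 : y 0 = z 0) : y ω = z ω := by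
  have hyc : ContinuousOn y (Icc 0 ω) := fun t ht => (hy t ht).continuousAt.continuousWithinAt
  have hzc : ContinuousOn z (Icc 0 ω) := fun t ht => (hz t ht).continuousAt.continuousWithinAt
  obtain ⟨K, hK⟩ := (isCompact_Icc (a := (0:ℝ)) (b := ω)).exists_bound_of_continuousOn
    (f := fun t => (∑ i ∈ Finset.range N, y t ^ i * z t ^ (N - 1 - i)) + A t) (by fun_prop)
  have := norm_le_gronwallBound_of_norm_deriv_right_le (f := fun t => y t - z t)
    (f' := fun t => (y t ^ N + A t * y t) - (z t ^ N + A t * z t)) (δ := 0) (K := K) (ε := 0)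
    (a := 0) (b := ω) (hyc.sub hzc)
    (fun t ht => ((hy t (Ico_subset_Icc_self ht)).sub (hz t (Ico_subset_Icc_self ht))).hasDerivWithinAt)
    (by simp [h0]) (fun t ht => by
      have e : (y t ^ N + A t * y t) - (z t ^ N + A t * z t) =
        ((∑ i ∈ Finset.range N, y t ^ i * z t ^ (N - 1 - i)) + A t) * (y t - z t) := by
        rw [add_mul, (Commute.all (y t) (z t)).geom_sum₂_mul]; ring
      rw [e, norm_mul, add_zero]
      exact mul_le_mul_of_nonneg_right (hK t (Ico_subset_Icc_self ht)) (norm_nonneg _))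
    ω ⟨hω.le, le_rfl⟩
  simp only [gronwallBound_ε0, zero_mul] at this
  exact sub_eq_zero.1 (norm_le_zero_iff.1 this)

open Set Filter Topology in
theorem stmt_10 (ω : ℝ) (hω : 0 < ω)
    (N : ℕ) (hN : 2 ≤ N)
    (A : ℝ → ℂ) (hA : Continuous A) :
    IsCenter ω (fun t z => z ^ N + A t * z) ↔
      Complex.exp (∫ t in (0:ℝ)..ω, A t) = 1 ∧
      (∫ t in (0:ℝ)..ω, Complex.exp (((N : ℂ) - 1) * ∫ s in (0:ℝ)..t, A s)) = 0 := by
  obtain ⟨n, rfl⟩ : ∃ n, N = n + 1 := ⟨N - 1, by omega⟩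
  have hn : 1 ≤ n := by omega
  have hn0 : (n:ℂ) ≠ 0 := by exact_mod_cast (by omega : n ≠ 0)
  obtain ⟨δ, hδ, H⟩ := aux_exists ω n hn A hA
  have e1 : ((n + 1 : ℕ) : ℂ) - 1 = n := by push_cast; ring
  rw [e1]
  set b := ∫ t in (0:ℝ)..ω, A t with hb
  set J := ∫ t in (0:ℝ)..ω, Complex.exp ((n : ℂ) * ∫ s in (0:ℝ)..t, A s) with hJ
  constructor
  · rintro ⟨ε, hε, hc⟩
    have key : ∀ c : ℂ, ‖c‖ < min δ ε → c ≠ 0 →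
        Complex.exp b * Complex.exp (-(Complex.log (1 - n * c ^ n * J)) / n) = 1 := by
      intro c hcn hc0
      obtain ⟨hS, -⟩ := (H c (hcn.trans_le (min_le_left _ _))).resolve_right hω.not_gt
      obtain ⟨z, hz, hz0, hz1⟩ := hc c (hcn.trans_le (min_le_right _ _))
      have := aux_unique ω hω (n+1) A hA _ z hS hz (by simp [hz0])
      rw [hz1] at this
      apply mul_left_cancel₀ hc0
      rw [mul_one, ← mul_assoc]
      exact this
    have hB : Complex.exp b = 1 := by
      have hcont : ContinuousAt (fun c : ℂ => Complex.exp b * Complex.exp (-(Complex.log (1 - n * c ^ n * J)) / n)) 0 := by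
        have : ContinuousAt (fun c : ℂ => Complex.log (1 - n * c ^ n * J)) 0 := by
          apply ContinuousAt.clog
          · fun_prop
          · simp [show n ≠ 0 by omega]
        fun_prop
      have h1 : Tendsto (fun c : ℂ => Complex.exp b * Complex.exp (-(Complex.log (1 - n * c ^ n * J)) / n)) (𝓝[≠] 0) (𝓝 1) := by
        refine tendsto_const_nhds.congr' ?_
        filter_upwards [self_mem_nhdsWithin, mem_nhdsWithin_of_mem_nhds (Metric.ball_mem_nhds (0:ℂ) (lt_min hδ hε))] with c h1 h2
        exact (key c (by simpa using h2) h1).symm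
      have h2 := tendsto_nhds_unique (hcont.tendsto.mono_left nhdsWithin_le_nhds) h1
      simpa [show n ≠ 0 by omega] using h2
    refine ⟨hB, ?_⟩
    have hm : 0 < min δ ε := lt_min hδ hε
    set c : ℂ := ((min δ ε / 2 : ℝ) : ℂ) with hcdef
    have hc0 : c ≠ 0 := by
      rw [hcdef]; exact_mod_cast (half_pos hm).ne'
    have hcn : ‖c‖ < min δ ε := by
      rw [hcdef, Complex.norm_of_nonneg (half_pos hm).le]; exact half_lt_self hm
    have hk := key c hcn hc0
    have hw := ((H c (hcn.trans_le (min_le_left _ _))).resolve_right hω.not_gt).2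
    have hw0 := Complex.slitPlane_ne_zero hw
    rw [hB, one_mul] at hk
    have h3 := congrArg (· ^ n) hk
    simp only [one_pow] at h3
    rw [← Complex.exp_nat_mul, mul_div_cancel₀ _ hn0, Complex.exp_neg, Complex.exp_log hw0, inv_eq_one] at h3
    have h4 : n * c ^ n * J = 0 := by linear_combination -h3
    exact (mul_eq_zero.1 h4).resolve_left (mul_ne_zero hn0 (pow_ne_zero _ hc0))
  · rintro ⟨hB, hJ0⟩
    refine ⟨δ, hδ, fun c hc => ⟨_, ((H c hc).resolve_right hω.not_gt).1, by simp, ?_⟩⟩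
    change c * Complex.exp b * Complex.exp (-(Complex.log (1 - n * c ^ n * J)) / n) = c
    simp [hB, hJ0]
end

section
/- Let ω > 0, let N ≥ 2 be an integer, and let A : ℝ → ℂ be continuous. Suppose z : ℂ → ℝ → ℂ is a family such that for some ε > 0 and every c with |c| < ε, t ↦ z(c,t) is a solution of ż = z^N + A(t)z on [0,ω] with z(c,0) = c, and suppose the displacement map q(c) = z(c,ω) − c is analytic at c = 0. Then q has a zero of order exactly N at c = 0 (i.e. the multiplicity of z = 0 is N) if and only if e^{∫₀^ω A(t)dt} = 1 and ∫₀^ω e^{(N−1)∫₀^t A(s)ds} dt ≠ 0. -/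
theorem bern_sol (ω : ℝ) (hω : 0 < ω) (n : ℕ) (hn : 1 ≤ n) (a u I : ℝ → ℂ) (c : ℂ)
    (ha : Continuous a) (hu : ∀ t ∈ Set.Icc (0:ℝ) ω, HasDerivAt u (a t * u t ^ (n+1)) t)
    (hI : ∀ t, HasDerivAt I (a t) t) (hI0 : I 0 = 0) (hu0 : u 0 = c)
    (hD : ∀ t ∈ Set.Icc (0:ℝ) ω, 1 - n * c ^ n * I t ∈ Complex.slitPlane) :
    u ω = c * (1 - n * c ^ n * I ω) ^ (-(1 / (n:ℂ))) := by
  have hn0 : (n:ℂ) ≠ 0 := by exact_mod_cast (by omega : n ≠ 0)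
  have hDd : ∀ t, HasDerivAt (fun t => 1 - n * c ^ n * I t) (-(n * c ^ n * a t)) t := by
    intro t
    simpa using ((hI t).const_mul ((n:ℂ) * c ^ n)).const_sub 1
  have huc : ContinuousOn u (Set.Icc 0 ω) := fun t ht => (hu t ht).continuousAt.continuousWithinAt
  -- first integral
  have hf : ∀ t ∈ Set.Icc (0:ℝ) ω, HasDerivAt (fun t => u t ^ n * (1 - n * c ^ n * I t) - c ^ n)
      (n * a t * u t ^ n * (u t ^ n * (1 - n * c ^ n * I t) - c ^ n)) t := by
    intro t ht
    have h := (((hu t ht).pow n).mul (hDd t)).sub_const (c ^ n)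
    refine h.congr_deriv ?_
    obtain ⟨m, rfl⟩ : ∃ m, n = m + 1 := ⟨n - 1, by omega⟩
    simp only [Nat.add_sub_cancel, Pi.pow_apply]
    ring
  have hf0 : ∀ t ∈ Set.Icc (0:ℝ) ω, u t ^ n * (1 - n * c ^ n * I t) - c ^ n = 0 := by
    obtain ⟨K, hK⟩ := isCompact_Icc.exists_bound_of_continuousOn
      (f := fun t => n * a t * u t ^ n) (s := Set.Icc 0 ω)
      ((continuousOn_const.mul ha.continuousOn).mul (huc.pow n))
    refine eq_zero_of_abs_deriv_le_mul_abs_self_of_eq_zero_right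
      (f := fun t => u t ^ n * (1 - n * c ^ n * I t) - c ^ n) (K := K)
      (fun t ht => (hf t ht).continuousAt.continuousWithinAt)
      (fun t ht => (hf t ⟨ht.1, ht.2.le⟩).hasDerivWithinAt) (by simp [hu0, hI0]) ?_
    intro t ht
    rw [norm_mul]
    exact mul_le_mul_of_nonneg_right (hK t ⟨ht.1, ht.2.le⟩) (norm_nonneg _)
  have hw : ∀ t ∈ Set.Icc (0:ℝ) ω,
      HasDerivAt (fun t => u t * (1 - n * c ^ n * I t) ^ (1 / (n:ℂ))) 0 t := by
    intro t ht
    have h1 : HasDerivAt (fun t => (1 - n * c ^ n * I t) ^ (1 / (n:ℂ)))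
        ((1 / (n:ℂ)) * (1 - n * c ^ n * I t) ^ (1 / (n:ℂ) - 1) * (-(n * c ^ n * a t))) t := by
      have := (HasDerivAt.cpow_const (c := 1 / (n:ℂ)) (hasDerivAt_id (1 - n * c ^ n * I t)) (hD t ht))
      simp only [id, mul_one] at this
      exact HasDerivAt.comp t this (hDd t)
    refine ((hu t ht).mul h1).congr_deriv ?_
    have h0 : (1 - n * c ^ n * I t) ≠ 0 := Complex.slitPlane_ne_zero (hD t ht)
    have h2 : (1 - n * c ^ n * I t) ^ (1 / (n:ℂ))
        = (1 - n * c ^ n * I t) ^ (1 / (n:ℂ) - 1) * (1 - n * c ^ n * I t) := by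
      rw [Complex.cpow_sub _ _ h0, Complex.cpow_one, div_mul_cancel₀ _ h0]
    rw [h2]
    generalize (1 - n * c ^ n * I t) ^ (1 / (n:ℂ) - 1) = X
    have h3 := hf0 t ht
    field_simp
    linear_combination (X * a t * u t) * h3
  have hc := constant_of_has_deriv_right_zero
    (f := fun t => u t * (1 - n * c ^ n * I t) ^ (1 / (n:ℂ))) (a := 0) (b := ω)
      (fun t ht => (hw t ht).continuousAt.continuousWithinAt)
      (fun t ht => (hw t ⟨ht.1, ht.2.le⟩).hasDerivWithinAt) ω ⟨hω.le, le_rfl⟩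
  simp only [hI0, hu0, mul_zero, sub_zero, Complex.one_cpow, mul_one] at hc
  have h0 : (1 - n * c ^ n * I ω) ≠ 0 := Complex.slitPlane_ne_zero (hD ω ⟨hω.le, le_rfl⟩)
  have h4 : (1 - n * c ^ n * I ω) ^ (1 / (n:ℂ)) ≠ 0 := by
    simp [Complex.cpow_eq_zero_iff, h0]
  rw [Complex.cpow_neg, eq_mul_inv_iff_mul_eq₀ h4]
  exact hc

theorem order_lem (n : ℕ) (hn : 1 ≤ n) (E J : ℂ) (q : ℂ → ℂ)
    (hq : ∀ᶠ c in nhds (0:ℂ), q c = E * (c * (1 - n * c ^ n * J) ^ (-(1 / (n:ℂ)))) - c) :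
    HasZeroOfOrderExactly q (n+1) ↔ E = 1 ∧ J ≠ 0 := by
  have hn0 : (n:ℂ) ≠ 0 := by exact_mod_cast (by omega : n ≠ 0)
  have hn1 : n ≠ 0 := by omega
  let φ : ℂ → ℂ := fun x => (1 - n * x * J) ^ (-(1 / (n:ℂ)))
  have hφa : AnalyticAt ℂ φ 0 := by
    refine AnalyticAt.cpow (by fun_prop) (by fun_prop) (by simp)
  have hφ0 : φ 0 = 1 := by simp [φ]
  have hφd : HasDerivAt φ J 0 := by
    have h1 : HasDerivAt (fun x : ℂ => 1 - n * x * J) (-(n * J)) 0 := by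
      simpa using (((hasDerivAt_id (0:ℂ)).const_mul (n:ℂ)).mul_const J).const_sub 1
    refine (h1.cpow_const (c := -(1 / (n:ℂ))) (by simp)).congr_deriv ?_
    simp [hn0]
  let ψ : ℂ → ℂ := dslope φ 0
  have hψa : AnalyticAt ℂ ψ 0 := by
    obtain ⟨p, hp⟩ := hφa
    exact ⟨_, hp.has_fpower_series_dslope_fslope⟩
  have hψ0 : ψ 0 = J := by simp [ψ, dslope_same, hφd.deriv]
  have hφψ : ∀ x, φ x = 1 + x * ψ x := by
    intro x
    have := sub_smul_dslope φ 0 x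
    simp only [sub_zero, smul_eq_mul, hφ0] at this
    simp only [ψ, this]; ring
  have hga : AnalyticAt ℂ (fun c => ψ (c ^ n)) 0 := by
    refine AnalyticAt.comp (g := ψ) (f := fun c : ℂ => c ^ n) ?_ (by fun_prop)
    simpa [hn1] using hψa
  have hq' : ∀ᶠ c in nhds (0:ℂ), q c = E * (c * (1 + c ^ n * ψ (c ^ n))) - c := by
    filter_upwards [hq] with c hc
    rw [hc, ← hφψ]
  constructor
  · rintro ⟨g, hg, hg0, hgq⟩
    have hlim : ∀ F G : ℂ → ℂ, ContinuousAt F 0 → ContinuousAt G 0 →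
        (∀ᶠ c in nhdsWithin (0:ℂ) {0}ᶜ, F c = G c) → F 0 = G 0 := by
      intro F G hF hG h
      exact tendsto_nhds_unique_of_eventuallyEq
        (hF.tendsto.mono_left nhdsWithin_le_nhds) (hG.tendsto.mono_left nhdsWithin_le_nhds) h
    have hE : E = 1 := by
      have := hlim (fun c => c ^ n * g c) (fun c => E * (1 + c ^ n * ψ (c ^ n)) - 1)
        ((continuousAt_id.pow n).mul hg.continuousAt)
        ((continuousAt_const.mul (continuousAt_const.add
          ((continuousAt_id.pow n).mul hga.continuousAt))).sub continuousAt_const) (by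
          filter_upwards [nhdsWithin_le_nhds hq', nhdsWithin_le_nhds hgq, self_mem_nhdsWithin]
            with c h1 h2 h3
          apply mul_left_cancel₀ (h3 : c ≠ 0)
          linear_combination h1 - h2)
      simp [hn1] at this
      linear_combination -this
    refine ⟨hE, ?_⟩
    have := hlim g (fun c => ψ (c ^ n)) hg.continuousAt hga.continuousAt (by
          filter_upwards [nhdsWithin_le_nhds hq', nhdsWithin_le_nhds hgq, self_mem_nhdsWithin]
            with c h1 h2 h3
          apply mul_left_cancel₀ (pow_ne_zero (n+1) (h3 : c ≠ 0))
          rw [hE] at h1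
          linear_combination h1 - h2)
    simp only [zero_pow hn1, hψ0] at this
    rwa [← this]
  · rintro ⟨rfl, hJ⟩
    refine ⟨_, hga, by simpa [hn1, hψ0] using hJ, ?_⟩
    filter_upwards [hq'] with c hc
    rw [hc]; ring

theorem stmt_11 (ω : ℝ) (hω : 0 < ω)
    (N : ℕ) (hN : 2 ≤ N)
    (A : ℝ → ℂ) (hA : Continuous A)
    (z : ℂ → ℝ → ℂ) (ε : ℝ) (hε : 0 < ε)
    (hsol : ∀ c : ℂ, ‖c‖ < ε →
      IsSolution ω (fun t w => w ^ N + A t * w) (z c) ∧ z c 0 = c)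
    (q : ℂ → ℂ) (hq : ∀ c : ℂ, q c = z c ω - c)
    (hqa : AnalyticAt ℂ q 0) :
    HasZeroOfOrderExactly q N ↔
      Complex.exp (∫ t in (0:ℝ)..ω, A t) = 1 ∧
      (∫ t in (0:ℝ)..ω, Complex.exp (((N : ℂ) - 1) * ∫ s in (0:ℝ)..t, A s)) ≠ 0 := by
  obtain ⟨n, rfl⟩ : ∃ n, N = n + 1 := ⟨N - 1, by omega⟩
  have hn : 1 ≤ n := by omega
  have hcast : (((n + 1 : ℕ) : ℂ) - 1) = n := by push_cast; ring
  rw [hcast]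
  set P : ℝ → ℂ := fun t => ∫ s in (0:ℝ)..t, A s with hP
  have hPd : ∀ t, HasDerivAt P (A t) t := fun t => hA.integral_hasStrictDerivAt 0 t |>.hasDerivAt
  have hPc : Continuous P := continuous_iff_continuousAt.2 fun t => (hPd t).continuousAt
  set a : ℝ → ℂ := fun t => Complex.exp (n * P t) with hadef
  have ha : Continuous a := by fun_prop
  set I : ℝ → ℂ := fun t => ∫ s in (0:ℝ)..t, a s with hIdef
  have hId : ∀ t, HasDerivAt I (a t) t := fun t => ha.integral_hasStrictDerivAt 0 t |>.hasDerivAt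
  have hIc : Continuous I := continuous_iff_continuousAt.2 fun t => (hId t).continuousAt
  change _ ↔ Complex.exp (P ω) = 1 ∧ I ω ≠ 0
  apply order_lem n hn
  obtain ⟨M, hM⟩ := isCompact_Icc.exists_bound_of_continuousOn (s := Set.Icc 0 ω) hIc.continuousOn
  have hev : ∀ᶠ c in nhds (0:ℂ), n * ‖c‖ ^ n * M < 1 := by
    have : ContinuousAt (fun c : ℂ => n * ‖c‖ ^ n * M) 0 := by fun_prop
    refine this.eventually_lt continuousAt_const ?_
    simp [zero_pow (by omega : n ≠ 0)]
  have hev2 : ∀ᶠ c in nhds (0:ℂ), ‖c‖ < ε := by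
    filter_upwards [Metric.ball_mem_nhds (0:ℂ) hε] with c hc
    simpa using hc
  filter_upwards [hev, hev2] with c h1 h2
  obtain ⟨hz, hz0⟩ := hsol c h2
  have key := bern_sol ω hω n hn a (fun t => z c t * Complex.exp (-P t)) I c ha ?_ hId
    (by simp [I]) (by simp [hz0, P]) ?_
  · rw [hq, ← key, mul_comm (z c ω), ← mul_assoc, ← Complex.exp_add]
    simp
  · intro t ht
    have h3 := (hz t ht).mul ((hPd t).neg.cexp)
    refine h3.congr_deriv ?_
    have h4 : Complex.exp (-P t) ^ (n+1) * a t = Complex.exp (-P t) := by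
      rw [hadef, ← Complex.exp_nat_mul, ← Complex.exp_add]
      congr 1; push_cast; ring
    rw [mul_pow]
    simp only [Pi.neg_apply]
    linear_combination (-(z c t)^(n+1)) * h4
  · intro t ht
    rw [sub_eq_add_neg]
    apply Complex.mem_slitPlane_of_norm_lt_one
    rw [norm_neg, norm_mul, norm_mul, norm_pow, Complex.norm_natCast]
    exact (mul_le_mul_of_nonneg_left (hM t ht) (by positivity)).trans_lt h1
end

section
/- Let ω > 0 and N ≥ 2 an integer. Let p : ℝ → ℝ be continuously differentiable with p(ω) = p(0), let q : ℝ → ℂ be continuous with e^{∫₀^ω q(t)dt} = 1, and let f_k : ℝ → ℂ be continuous for 2 ≤ k ≤ N. Then z = 0 is a center for the differential equation ż = q(t)·z + Σ_{k=2}^{N} p'(t)·f_k(p(t))·e^{(1−k)∫₀^t q(s)ds}·z^k. -/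
theorem pow_lip_aux (x y : ℂ) (hx : ‖x‖ ≤ 1) (hy : ‖y‖ ≤ 1) (k : ℕ) :
    ‖x ^ k - y ^ k‖ ≤ k * ‖x - y‖ := by
  induction k with
  | zero => simp
  | succ k ih =>
    have e : x ^ (k+1) - y ^ (k+1) = x ^ k * (x - y) + (x ^ k - y ^ k) * y := by ring
    rw [e]
    refine (norm_add_le _ _).trans ?_
    rw [norm_mul, norm_mul, norm_pow]
    have h1 : ‖x‖ ^ k ≤ 1 := pow_le_one₀ (norm_nonneg _) hx
    have h2 := mul_le_mul_of_nonneg_right h1 (norm_nonneg (x - y))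
    have h3 := mul_le_mul_of_nonneg_left hy (norm_nonneg (x ^ k - y ^ k))
    push_cast
    linarith

theorem stmt_15 (ω : ℝ) (hω : 0 < ω) (N : ℕ) (hN : 2 ≤ N)
    (p p' : ℝ → ℝ) (hp : ∀ t, HasDerivAt p (p' t) t) (hp' : Continuous p')
    (hper : p ω = p 0)
    (q : ℝ → ℂ) (hq : Continuous q)
    (hqint : Complex.exp (∫ t in (0:ℝ)..ω, q t) = 1)
    (f : ℕ → ℝ → ℂ) (hf : ∀ k, 2 ≤ k → k ≤ N → Continuous (f k)) :
    IsCenter ω (fun t z => q t * z +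
      ∑ k ∈ Finset.Icc 2 N, (p' t : ℂ) * f k (p t) *
        Complex.exp ((1 - (k : ℂ)) * ∫ s in (0:ℝ)..t, q s) * z ^ k) := by
  have hpc : Continuous p := continuous_iff_continuousAt.2 fun t => (hp t).continuousAt
  obtain ⟨M, hM1, hM⟩ : ∃ M : ℝ, 1 ≤ M ∧ ∀ t ∈ Set.Icc 0 ω, |p t - p 0| < M := by
    obtain ⟨M, hM⟩ := (isCompact_Icc (a := (0:ℝ)) (b := ω)).exists_bound_of_continuousOn
      (f := fun t => p t - p 0) (by fun_prop)
    refine ⟨max 1 (M + 1), le_max_left _ _, fun t ht => ?_⟩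
    have := hM t ht
    rw [Real.norm_eq_abs] at this
    exact lt_of_lt_of_le (by linarith) (le_max_right _ _)
  obtain ⟨C, hC1, hC⟩ : ∃ C : ℝ, 1 ≤ C ∧ ∀ x ∈ Set.Icc (p 0 - M) (p 0 + M),
      ∑ k ∈ Finset.Icc 2 N, ‖f k x‖ ≤ C := by
    obtain ⟨C, hC⟩ := (isCompact_Icc (a := p 0 - M) (b := p 0 + M)).exists_bound_of_continuousOn
      (f := fun x => ∑ k ∈ Finset.Icc 2 N, ‖f k x‖) (by
        refine Continuous.continuousOn (continuous_finsetSum _ fun k hk => ?_)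
        rw [Finset.mem_Icc] at hk
        exact (hf k hk.1 hk.2).norm)
    refine ⟨max 1 C, le_max_left _ _, fun t ht => ?_⟩
    exact ((le_abs_self _).trans (hC t ht)).trans (le_max_right _ _)
  have hC0 : 0 < C := by linarith
  have hM0 : 0 < M := by linarith
  obtain ⟨a, ha0, ha1, haM⟩ : ∃ a : ℝ, 0 < a ∧ a ≤ 1 ∧ C * a ^ 2 * M = a / 2 := by
    refine ⟨1 / (2 * C * M), by positivity, ?_, by field_simp⟩
    rw [div_le_one (by positivity)]
    nlinarith
  have hPL : IsPicardLindelof (fun x w => ∑ k ∈ Finset.Icc 2 N, f k x * w ^ k)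
      (tmin := p 0 - M) (tmax := p 0 + M) ⟨p 0, by constructor <;> linarith⟩ (0 : ℂ)
      ⟨a, ha0.le⟩ ⟨a / 2, by positivity⟩ ⟨C * a ^ 2, by positivity⟩ ⟨C * N, by positivity⟩ := by
    refine ⟨fun t ht => ?_, fun x hx => ?_, fun t ht x hx => ?_, ?_⟩
    · refine LipschitzOnWith.of_dist_le_mul fun x hx y hy => ?_
      have hx1 : ‖x‖ ≤ 1 := (mem_closedBall_zero_iff.1 hx).trans ha1
      have hy1 : ‖y‖ ≤ 1 := (mem_closedBall_zero_iff.1 hy).trans ha1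
      rw [dist_eq_norm, dist_eq_norm, ← Finset.sum_sub_distrib]
      change _ ≤ C * N * ‖x - y‖
      calc _ ≤ ∑ k ∈ Finset.Icc 2 N, ‖f k t‖ * (N * ‖x - y‖) := by
            refine norm_sum_le_of_le _ fun k hk => ?_
            rw [← mul_sub, norm_mul]
            refine mul_le_mul_of_nonneg_left ((pow_lip_aux x y hx1 hy1 k).trans ?_) (norm_nonneg _)
            have : (k : ℝ) ≤ N := by exact_mod_cast (Finset.mem_Icc.1 hk).2
            exact mul_le_mul_of_nonneg_right this (norm_nonneg _)
        _ = (∑ k ∈ Finset.Icc 2 N, ‖f k t‖) * (N * ‖x - y‖) := by rw [Finset.sum_mul]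
        _ ≤ C * (N * ‖x - y‖) := mul_le_mul_of_nonneg_right (hC t ht) (by positivity)
        _ = _ := by ring
    · refine Continuous.continuousOn (continuous_finsetSum _ fun k hk => ?_)
      rw [Finset.mem_Icc] at hk
      exact (hf k hk.1 hk.2).mul continuous_const
    · have hx1 : ‖x‖ ≤ a := mem_closedBall_zero_iff.1 hx
      change _ ≤ C * a ^ 2
      calc _ ≤ ∑ k ∈ Finset.Icc 2 N, ‖f k t‖ * a ^ 2 := by
            refine norm_sum_le_of_le _ fun k hk => ?_
            rw [norm_mul, norm_pow]
            refine mul_le_mul_of_nonneg_left ?_ (norm_nonneg _)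
            exact (pow_le_pow_left₀ (norm_nonneg _) hx1 k).trans
              (pow_le_pow_of_le_one ha0.le ha1 (Finset.mem_Icc.1 hk).1)
        _ = (∑ k ∈ Finset.Icc 2 N, ‖f k t‖) * a ^ 2 := by rw [Finset.sum_mul]
        _ ≤ C * a ^ 2 := mul_le_mul_of_nonneg_right (hC t ht) (by positivity)
    · change C * a ^ 2 * max (p 0 + M - p 0) (p 0 - (p 0 - M)) ≤ a - a / 2
      have h1 : p 0 + M - p 0 = M := by ring
      have h2 : p 0 - (p 0 - M) = M := by ring
      rw [h1, h2, max_self, haM]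
      linarith
  refine ⟨a / 2, by positivity, fun c hc => ?_⟩
  obtain ⟨w, hw0, hw⟩ := hPL.exists_eq_forall_mem_Icc_hasDerivWithinAt (x := c)
    (mem_closedBall_zero_iff.2 hc.le)
  change w (p 0) = c at hw0
  refine ⟨fun t => Complex.exp (∫ s in (0:ℝ)..t, q s) * w (p t), fun t ht => ?_, ?_, ?_⟩
  · have hmem := abs_lt.1 (hM t ht)
    have h1 : HasDerivAt w (∑ k ∈ Finset.Icc 2 N, f k (p t) * w (p t) ^ k) (p t) :=
      (hw (p t) ⟨by linarith, by linarith⟩).hasDerivAt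
        (Icc_mem_nhds (by linarith) (by linarith))
    have h2 := HasDerivAt.scomp t h1 (hp t)
    have h3 : HasDerivAt (fun t => ∫ s in (0:ℝ)..t, q s) (q t) t :=
      intervalIntegral.integral_hasDerivAt_right (hq.intervalIntegrable _ _)
        (hq.stronglyMeasurableAtFilter _ _) hq.continuousAt
    have h4 := h3.cexp.mul h2
    refine h4.congr_deriv ?_
    simp only [Function.comp, Complex.real_smul]
    rw [Finset.mul_sum, Finset.mul_sum]
    have e : ∀ k ∈ Finset.Icc 2 N, Complex.exp (∫ s in (0:ℝ)..t, q s) *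
        ((p' t : ℂ) * (f k (p t) * w (p t) ^ k)) = (p' t : ℂ) * f k (p t) *
        Complex.exp ((1 - (k : ℂ)) * ∫ s in (0:ℝ)..t, q s) *
        (Complex.exp (∫ s in (0:ℝ)..t, q s) * w (p t)) ^ k := by
      intro k _
      generalize (∫ s in (0:ℝ)..t, q s) = Q
      have : Complex.exp Q = Complex.exp ((1 - (k : ℂ)) * Q) * Complex.exp Q ^ k := by
        rw [← Complex.exp_nat_mul, ← Complex.exp_add]
        congr 1
        ring
      rw [mul_pow]
      conv_lhs => rw [this]
      ring
    rw [Finset.sum_congr rfl e]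
    ring
  · simp [hw0]
  · simp [hqint, hper, hw0]
end

section
/- Let ω > 0 and let A, B : ℝ → ℂ be continuous. Define B̃(t) = ∫₀^t B(s)ds, d₂(t) = B̃(t), d₃(t) = ∫₀^t (A(s) + 2·B(s)·d₂(s)) ds, and d₄(t) = ∫₀^t (1 + 3·A(s)·d₂(s) + 2·B(s)·d₃(s) + B(s)·d₂(s)²) ds. Then: (i) d₂(ω) = ∫₀^ω B(t)dt; (ii) if ∫₀^ω B(t)dt = 0 then d₃(ω) = ∫₀^ω A(t)dt; and (iii) if ∫₀^ω B(t)dt = 0 and ∫₀^ω A(t)dt = 0 then d₄(ω) = ω + ∫₀^ω B̃(t)·A(t) dt. -/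
theorem stmt_16 (ω : ℝ) (hω : 0 < ω)
    (A B : ℝ → ℂ) (hA : Continuous A) (hB : Continuous B)
    (Btil d₂ d₃ d₄ : ℝ → ℂ)
    (hBtil : ∀ t, Btil t = ∫ s in (0:ℝ)..t, B s)
    (hd₂ : ∀ t, d₂ t = Btil t)
    (hd₃ : ∀ t, d₃ t = ∫ s in (0:ℝ)..t, (A s + 2 * B s * d₂ s))
    (hd₄ : ∀ t, d₄ t = ∫ s in (0:ℝ)..t,
      (1 + 3 * A s * d₂ s + 2 * B s * d₃ s + B s * (d₂ s) ^ 2)) :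
    d₂ ω = (∫ t in (0:ℝ)..ω, B t) ∧
    ((∫ t in (0:ℝ)..ω, B t) = 0 → d₃ ω = ∫ t in (0:ℝ)..ω, A t) ∧
    ((∫ t in (0:ℝ)..ω, B t) = 0 → (∫ t in (0:ℝ)..ω, A t) = 0 →
      d₄ ω = (ω : ℂ) + ∫ t in (0:ℝ)..ω, Btil t * A t) := by
  have hb : ∀ t, HasDerivAt Btil (B t) t := by
    intro t
    rw [funext hBtil]
    exact intervalIntegral.integral_hasDerivAt_right (hB.intervalIntegrable _ _)
      hB.stronglyMeasurable.stronglyMeasurableAtFilter hB.continuousAt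
  have cb : Continuous Btil := continuous_iff_continuousAt.2 fun t => (hb t).continuousAt
  obtain rfl : d₂ = Btil := funext hd₂
  have c3 : Continuous (fun s => A s + 2 * B s * d₂ s) := by fun_prop
  have h3 : ∀ t, HasDerivAt d₃ (A t + 2 * B t * d₂ t) t := by
    intro t
    rw [funext hd₃]
    exact intervalIntegral.integral_hasDerivAt_right (c3.intervalIntegrable _ _)
      c3.stronglyMeasurable.stronglyMeasurableAtFilter c3.continuousAt
  have cd3 : Continuous d₃ := continuous_iff_continuousAt.2 fun t => (h3 t).continuousAt
  have b0 : d₂ 0 = 0 := by rw [hBtil]; simp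
  refine ⟨hBtil ω, fun h => ?_, fun h _ => ?_⟩
  · have bω : d₂ ω = 0 := by rw [hBtil, h]
    have key : ∫ s in (0:ℝ)..ω, 2 * B s * d₂ s = 0 := by
      have := intervalIntegral.integral_eq_sub_of_hasDerivAt (a := 0) (b := ω)
        (f := fun s => d₂ s ^ 2) (f' := fun s => 2 * B s * d₂ s)
        (fun t _ => by
          have := (hb t).pow 2
          refine this.congr_deriv ?_
          push_cast; ring)
        (Continuous.intervalIntegrable (by fun_prop) _ _)
      rw [this]; simp [b0, bω]
    rw [hd₃, intervalIntegral.integral_add (hA.intervalIntegrable _ _)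
      (Continuous.intervalIntegrable (by fun_prop) _ _), key, add_zero]
  · have bω : d₂ ω = 0 := by rw [hBtil, h]
    have key : ∫ s in (0:ℝ)..ω, (2 * A s * d₂ s + 2 * B s * d₃ s + B s * d₂ s ^ 2) = 0 := by
      have := intervalIntegral.integral_eq_sub_of_hasDerivAt (a := 0) (b := ω)
        (f := fun s => 2 * (d₂ s * d₃ s) - d₂ s ^ 3)
        (f' := fun s => 2 * A s * d₂ s + 2 * B s * d₃ s + B s * d₂ s ^ 2)
        (fun t _ => by
          have := (((hb t).mul (h3 t)).const_mul 2).sub ((hb t).pow 3)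
          refine this.congr_deriv ?_
          push_cast; ring)
        (Continuous.intervalIntegrable (by fun_prop) _ _)
      rw [this]; simp [b0, bω]
    have e : ∀ s, 1 + 3 * A s * d₂ s + 2 * B s * d₃ s + B s * (d₂ s) ^ 2 =
        (1 + d₂ s * A s) + (2 * A s * d₂ s + 2 * B s * d₃ s + B s * d₂ s ^ 2) := by
      intro s; ring
    rw [hd₄]
    simp_rw [e]
    rw [intervalIntegral.integral_add (Continuous.intervalIntegrable (by fun_prop) _ _)
      (Continuous.intervalIntegrable (by fun_prop) _ _), key, add_zero,
      intervalIntegral.integral_add (Continuous.intervalIntegrable (by fun_prop) _ _)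
      (Continuous.intervalIntegrable (by fun_prop) _ _)]
    simp
end
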